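/- There exist constants κ > 0, C ≥ 1, c > 0 and N₀ (depending only on h and the choice of the roots z_p) such that the following holds. Let N ≥ N₀ be an integer, let d ≤ N^ρ be a positive integer, and let A ⊆ {1,…,N} be h_d-free with density σ = |A|/N > (log N)^{−log log log N}. Then there exist a real number B with c·σ^C ≤ B ≤ C·σ^{−C}, an integer Q with 1 ≤ Q ≤ C·σ^{−C}, a set Γ ⊆ {(a,q) : 1 ≤ q ≤ Q, 1 ≤ a ≤ q, gcd(a,q) = 1}, and for each (a,q) ∈ Γ a frequency γ_{a,q} ∈ 𝔐_{a,q}(N, κ/σ), such that: (i) ∑_{(a,q) ∈ Γ} |1̂_A(γ_{a,q})| ≥ c·B·|A|·Q^{1/2}/( (log N)^{1/4}·(log(1/σ))² ); and (ii) for each (a,q) ∈ Γ, ∫_{𝔐_{a,q}(N,κ/σ)} | 1̂_A(γ) − σ·1̂_{[N]}(γ) |² dγ ≥ c·σ·|A|/B². -/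

import Mathlib

/-- `e(x) = e^{2πix}`. -/
noncomputable def e (x : ℝ) : ℂ := Complex.exp (2 * Real.pi * Complex.I * x)
/-- The distance from `x` to the nearest integer, i.e. the norm of the image of `x` in
`𝕋 = ℝ/ℤ`. -/
noncomputable def torusNorm (x : ℝ) : ℝ := |x - round x|

section
theorem e_add (x y : ℝ) : e (x + y) = e x * e y := by
  unfold e; rw [← Complex.exp_add]; congr 1; push_cast; ring
theorem e_zero : e 0 = 1 := by simp [e]
theorem e_int (n : ℤ) : e n = 1 := by
  unfold e
  rw [Complex.exp_eq_one_iff]; exact ⟨n, by push_cast; ring⟩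
theorem e_norm (x : ℝ) : ‖e x‖ = 1 := by
  unfold e
  rw [show (2 * Real.pi * Complex.I * x : ℂ) = ((2 * Real.pi * x : ℝ) : ℂ) * Complex.I by
    push_cast; ring]
  exact Complex.norm_exp_ofReal_mul_I _
theorem e_conj (x : ℝ) : (starRingEnd ℂ) (e x) = e (-x) := by
  unfold e
  rw [← Complex.exp_conj]; congr 1
  simp [Complex.conj_ofNat]
theorem e_ne (x : ℝ) : e x ≠ 0 := by
  intro h; have := e_norm x; rw [h] at this; simp at this
theorem e_sub (x y : ℝ) : e (x - y) = e x * (starRingEnd ℂ) (e y) := by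
  rw [e_conj, ← e_add, sub_eq_add_neg]
theorem e_add_int (x : ℝ) (n : ℤ) : e (x + n) = e x := by rw [e_add, e_int, mul_one]
theorem e_nat_mul (x : ℝ) (n : ℕ) : e (n * x) = e x ^ n := by
  unfold e; rw [← Complex.exp_nat_mul]; congr 1; push_cast; ring
theorem e_sub_one_norm (x : ℝ) : ‖e x - 1‖ = |2 * Real.sin (Real.pi * x)| := by
  unfold e
  have := Complex.norm_exp_I_mul_ofReal_sub_one (2 * Real.pi * x)
  rw [show (2 * Real.pi * Complex.I * x : ℂ) = Complex.I * ((2 * Real.pi * x : ℝ) : ℂ) by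
    push_cast; ring, this, Real.norm_eq_abs]
  congr 3; ring
theorem e_sub_one_le (x : ℝ) : ‖e x - 1‖ ≤ 2 * Real.pi * |x| := by
  rw [e_sub_one_norm, abs_mul, abs_two, mul_assoc]
  have := Real.abs_sin_le_abs (x := Real.pi * x)
  rw [abs_mul, abs_of_pos Real.pi_pos] at this
  linarith
theorem e_sub_one_ge (x : ℝ) : 4 * |x - round x| ≤ ‖e x - 1‖ := by
  have h1 : e x = e (x - round x) := by
    have := e_add_int (x - round x) (round x)
    rw [← this]; congr 1; ring
  rw [h1, e_sub_one_norm]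
  have h2 := abs_sub_round x
  set y := x - round x
  rw [abs_mul, abs_two]
  have h3 : 2 * |y| ≤ |Real.sin (Real.pi * y)| := by
    have key : ∀ u : ℝ, 0 ≤ u → u ≤ 1/2 → 2 * u ≤ Real.sin (Real.pi * u) := by
      intro u h0 h1
      have := Real.mul_le_sin (x := Real.pi * u) (by positivity)
        (by nlinarith [Real.pi_pos])
      calc 2 * u = 2 / Real.pi * (Real.pi * u) := by field_simp
        _ ≤ _ := this
    rcases abs_cases y with ⟨h, h'⟩ | ⟨h, h'⟩
    · rw [h] at h2 ⊢
      exact (key y h' h2).trans (le_abs_self _)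
    · rw [h] at h2 ⊢
      have := key (-y) (by linarith) h2
      rw [mul_neg, mul_neg, Real.sin_neg] at this
      rw [mul_neg]
      exact this.trans (neg_le_abs _)
  linarith

theorem lin_sum (x y : ℝ) (M : ℕ) :
    ‖∑ n ∈ Finset.range M, e (x * n + y)‖ * (2 * |x - round x|) ≤ 1 := by
  have h1 : ∑ n ∈ Finset.range M, e (x * n + y) = e y * ∑ n ∈ Finset.range M, e x ^ n := by
    rw [Finset.mul_sum]; refine Finset.sum_congr rfl fun n _ => ?_
    rw [e_add, mul_comm, mul_comm x, e_nat_mul]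
  have h2 := congrArg norm (geom_sum_mul (e x) M)
  rw [h1, norm_mul, e_norm, one_mul]
  rw [norm_mul] at h2
  have h3 : ‖e x ^ M - 1‖ ≤ 2 := by
    refine (norm_sub_le _ _).trans ?_
    rw [norm_pow, e_norm]; norm_num
  have h4 := e_sub_one_ge x
  have h5 := norm_nonneg (∑ n ∈ Finset.range M, e x ^ n)
  nlinarith [mul_le_mul_of_nonneg_left h4 h5]

theorem vdc (u : ℕ → ℂ) (M : ℕ) :
    ‖∑ n ∈ Finset.range M, u n‖ ^ 2 + ∑ n ∈ Finset.range M, ‖u n‖ ^ 2 =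
      2 * (∑ h ∈ Finset.range M, ∑ n ∈ Finset.range (M - h),
        u (n + h) * (starRingEnd ℂ) (u n)).re := by
  induction M with
  | zero => simp
  | succ M ih =>
    have h1 : ∑ h ∈ Finset.range (M+1), ∑ n ∈ Finset.range (M + 1 - h),
        u (n + h) * (starRingEnd ℂ) (u n) =
        (∑ h ∈ Finset.range M, ∑ n ∈ Finset.range (M - h),
        u (n + h) * (starRingEnd ℂ) (u n)) +
        u M * (starRingEnd ℂ) (∑ n ∈ Finset.range (M+1), u n) := by
      have h2 : ∀ h ∈ Finset.range (M+1), ∑ n ∈ Finset.range (M + 1 - h),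
        u (n + h) * (starRingEnd ℂ) (u n) = ∑ n ∈ Finset.range (M - h),
        u (n + h) * (starRingEnd ℂ) (u n) + u M * (starRingEnd ℂ) (u (M - h)) := by
        intro h hh
        have : h ≤ M := by simpa [Nat.lt_succ_iff] using hh
        rw [Nat.sub_add_comm this, Finset.sum_range_succ, Nat.sub_add_cancel this]
      rw [Finset.sum_congr rfl h2, Finset.sum_add_distrib, Finset.sum_range_succ]
      simp only [Nat.sub_self, Finset.range_zero, Finset.sum_empty, add_zero]
      rw [map_sum, Finset.mul_sum,
        ← Finset.sum_range_reflect (fun i => u M * (starRingEnd ℂ) (u i)) (M+1)]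
      simp
    rw [h1, Complex.add_re, mul_add, ← ih, Finset.sum_range_succ, Finset.sum_range_succ]
    set S := ∑ n ∈ Finset.range M, u n
    simp only [← Complex.normSq_eq_norm_sq, Complex.normSq_apply, Complex.mul_re, map_add,
      Complex.conj_re, Complex.conj_im, Complex.add_re, Complex.add_im]
    ring

theorem vdc_le (u : ℕ → ℂ) (M : ℕ) :
    ‖∑ n ∈ Finset.range M, u n‖ ^ 2 ≤
      2 * ∑ h ∈ Finset.range M, ‖∑ n ∈ Finset.range (M - h),
        u (n + h) * (starRingEnd ℂ) (u n)‖ := by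
  have h1 := vdc u M
  have h2 : 0 ≤ ∑ n ∈ Finset.range M, ‖u n‖ ^ 2 := Finset.sum_nonneg fun _ _ => by positivity
  have h3 := (Complex.re_le_norm _).trans (norm_sum_le (Finset.range M) (fun h =>
    ∑ n ∈ Finset.range (M - h), u (n + h) * (starRingEnd ℂ) (u n)))
  linarith

theorem recur (α ε δ : ℝ) (M : ℕ) (Gd : Finset ℕ) (hsub : Gd ⊆ Finset.Icc 1 M)
    (hcard : ε * M ≤ Gd.card) (hG : ∀ h ∈ Gd, ∃ a : ℤ, |h * α - a| ≤ δ)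
    (hε : 0 < ε) (hε1 : ε ≤ 1) (hδ : δ ≤ ε ^ 2 / 100) (hM : 100 / ε ≤ M) :
    ∃ q : ℕ, 1 ≤ q ∧ (q : ℝ) ≤ 4 / ε ∧ ∃ a : ℤ, |q * α - a| ≤ 4 * δ / (ε ^ 2 * M) := by
  have hM0 : (0 : ℝ) < M := lt_of_lt_of_le (by positivity) hM
  have hεM : 100 ≤ ε * M := by rw [div_le_iff₀ hε] at hM; linarith
  have hcpos : 0 < Gd.card := by
    have : (0 : ℝ) < Gd.card := by linarith
    exact_mod_cast this
  have hGne : Gd.Nonempty := Finset.card_pos.mp hcpos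
  have hδ0 : 0 ≤ δ := by
    obtain ⟨h, hh⟩ := hGne
    obtain ⟨a, ha⟩ := hG h hh
    exact (abs_nonneg _).trans ha
  set n : ℕ := ⌈16 * M / ε⌉₊ with hn
  have hn0 : 0 < n := Nat.ceil_pos.mpr (by positivity)
  have hn1 : 16 * M / ε ≤ (n : ℝ) := Nat.le_ceil _
  have hn2 : (n : ℝ) ≤ 16 * M / ε + 1 := (Nat.ceil_lt_add_one (by positivity)).le
  obtain ⟨p, hp1, hp2⟩ := Real.exists_rat_abs_sub_le_and_den_le α hn0
  set q := p.den with hq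
  set a := p.num with ha
  have hq0 : 0 < q := p.den_pos
  have hq0' : (0 : ℝ) < q := by exact_mod_cast hq0
  have hqa : |q * α - a| ≤ ε / (16 * M) := by
    have h1 : (p : ℝ) = a / q := by rw [Rat.cast_def]
    have h2 : (q : ℝ) * α - a = q * (α - p) := by rw [h1]; field_simp
    rw [h2, abs_mul, abs_of_pos hq0']
    calc (q : ℝ) * |α - p| ≤ q * (1 / ((n + 1) * q)) := by gcongr
      _ = 1 / (n + 1) := by field_simp
      _ ≤ 1 / (16 * M / ε) := by gcongr; linarith
      _ = _ := by field_simp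
  choose! b hb using hG
  have hz : ∀ h ∈ Gd, |((h * a - q * b h : ℤ) : ℝ)| ≤ ε / 16 + q * δ := by
    intro h hh
    have h1 : ((h * a - q * b h : ℤ) : ℝ) = q * (h * α - b h) - h * (q * α - a) := by
      push_cast; ring
    have h2 : (h : ℝ) ≤ M := by exact_mod_cast (Finset.mem_Icc.mp (hsub hh)).2
    rw [h1]
    refine (abs_sub _ _).trans ?_
    rw [abs_mul, abs_mul, abs_of_pos hq0', abs_of_nonneg (Nat.cast_nonneg h : (0:ℝ) ≤ h)]
    have h3 : (h : ℝ) * |q * α - a| ≤ M * (ε / (16 * M)) := by gcongr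
    have h4 : (M : ℝ) * (ε / (16 * M)) = ε / 16 := by field_simp
    have := mul_le_mul_of_nonneg_left (hb h hh) hq0'.le
    linarith
  by_cases hcase : (q : ℝ) ≤ 4 / ε
  · refine ⟨q, hq0, hcase, a, ?_⟩
    have hqε : q * ε ≤ 4 := by rwa [le_div_iff₀ hε] at hcase
    have hqδ : q * δ ≤ ε / 25 := by
      have h1 : (q : ℝ) * δ ≤ q * (ε ^ 2 / 100) := by gcongr
      nlinarith
    have hz0 : ∀ h ∈ Gd, (h * a - q * b h : ℤ) = 0 := by
      intro h hh
      have h1 := hz h hh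
      have h2 : |((h * a - q * b h : ℤ) : ℝ)| < 1 := by linarith
      have h3 : |(h * a - q * b h : ℤ)| < 1 := by exact_mod_cast h2
      exact Int.abs_lt_one_iff.mp h3
    obtain ⟨h, hh, hbig⟩ : ∃ h ∈ Gd, Gd.card ≤ h := by
      refine ⟨Gd.max' hGne, Finset.max'_mem _ _, ?_⟩
      have : Gd ⊆ Finset.Icc 1 (Gd.max' hGne) := fun x hx => Finset.mem_Icc.mpr
        ⟨(Finset.mem_Icc.mp (hsub hx)).1, Finset.le_max' _ _ hx⟩
      simpa using Finset.card_le_card this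
    have hbig' : ε * M ≤ h := hcard.trans (by exact_mod_cast hbig)
    have h1 : (h : ℝ) * a - q * b h = 0 := by exact_mod_cast hz0 h hh
    have h2 : (h : ℝ) * (q * α - a) = q * (h * α - b h) := by linarith
    have h3 : (h : ℝ) * |q * α - a| ≤ q * δ := by
      have := congrArg abs h2
      rw [abs_mul, abs_mul, abs_of_pos hq0', abs_of_nonneg (Nat.cast_nonneg h : (0:ℝ) ≤ h)] at this
      rw [this]; exact mul_le_mul_of_nonneg_left (hb h hh) hq0'.le
    rw [le_div_iff₀ (by positivity)]
    have h4 : ε * M * |q * α - a| ≤ q * δ :=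
      (mul_le_mul_of_nonneg_right hbig' (abs_nonneg _)).trans h3
    nlinarith
  · exfalso
    push Not at hcase
    set Z : ℤ := ⌊ε / 16 + q * δ⌋ with hZ
    have hZ0 : 0 ≤ Z := Int.floor_nonneg.mpr (by positivity)
    have hinj : Gd.card ≤ (Finset.range (M / q + 1) ×ˢ Finset.Icc (-Z) Z).card := by
      refine Finset.card_le_card_of_injOn (fun h => (h / q, (h * a - q * b h : ℤ))) ?_ ?_
      · intro h hh
        have h1 := hz h hh
        have h2 : |(h * a - q * b h : ℤ)| ≤ Z := by
          rw [hZ, Int.le_floor]; exact_mod_cast h1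
        simp only [Finset.coe_product, Set.mem_prod, Finset.mem_coe, Finset.mem_range,
          Finset.mem_Icc]
        exact ⟨Nat.lt_succ_of_le (Nat.div_le_div_right (Finset.mem_Icc.mp (hsub hh)).2),
          abs_le.mp h2⟩
      · intro h hh h' hh' heq
        simp only [Prod.mk.injEq] at heq
        obtain ⟨e1, e2⟩ := heq
        have hcop : IsCoprime (q : ℤ) a := by
          have := p.reduced
          rw [Int.isCoprime_iff_gcd_eq_one, Int.gcd_comm]
          exact this
        have hdvd : (q : ℤ) ∣ (h - h' : ℤ) := by
          refine hcop.dvd_of_dvd_mul_right ⟨b h - b h', ?_⟩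
          linarith
        have hmod : h' % q = h % q := (Nat.modEq_iff_dvd).mpr hdvd
        rw [← Nat.div_add_mod h q, ← Nat.div_add_mod h' q, e1, hmod]
    rw [Finset.card_product, Finset.card_range, Int.card_Icc] at hinj
    have hc2 : (Gd.card : ℝ) ≤ (M / q + 1) * (2 * (ε / 16 + q * δ) + 1) := by
      have h1 : ((M / q : ℕ) : ℝ) ≤ M / q := Nat.cast_div_le
      have h2 : (((Z + 1 - -Z).toNat : ℕ) : ℝ) = 2 * Z + 1 := by
        have : (((Z + 1 - -Z).toNat : ℕ) : ℤ) = 2 * Z + 1 := by omega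
        exact_mod_cast this
      have h3 : (Z : ℝ) ≤ ε / 16 + q * δ := Int.floor_le _
      have h4 : (Gd.card : ℝ) ≤ ((M / q : ℕ) + 1) * (2 * Z + 1) := by
        rw [← h2]; exact_mod_cast hinj
      have hZ0' : (0 : ℝ) ≤ Z := by exact_mod_cast hZ0
      refine h4.trans ?_
      gcongr
    have hqn : (q : ℝ) ≤ n := by exact_mod_cast hp2
    have t1 : (M : ℝ) / q ≤ ε * M / 4 := by
      rw [div_le_iff₀ hq0']
      rw [div_lt_iff₀ hε] at hcase
      nlinarith
    have t2 : (q : ℝ) * δ ≤ 17 / 100 * (ε * M) := by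
      have h1 : (q : ℝ) ≤ 17 * M / ε := by
        have : 1 ≤ M / ε := by rw [le_div_iff₀ hε]; nlinarith
        calc (q : ℝ) ≤ 16 * M / ε + 1 := hqn.trans hn2
          _ ≤ 16 * M / ε + M / ε := by linarith
          _ = _ := by ring
      calc (q : ℝ) * δ ≤ (17 * M / ε) * (ε ^ 2 / 100) := by gcongr
        _ = _ := by field_simp
    have t3 : (M : ℝ) / q * (q * δ) ≤ ε * M / 100 := by
      have h1 : (M : ℝ) / q * (q * δ) = M * δ := by field_simp
      rw [h1]
      nlinarith
    have t0 : 0 ≤ (M : ℝ) / q := by positivity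
    nlinarith [mul_nonneg hε.le t0]
end

section
/-- polynomially bounded in `1/τ` -/
def PB (F : ℝ → ℝ) : Prop := ∃ C : ℕ, 1 ≤ C ∧ ∀ τ : ℝ, 0 < τ → τ ≤ 1 → |F τ| ≤ (C / τ) ^ C

theorem PB_mono_aux {C C' : ℕ} (hC : 1 ≤ C) (h : C ≤ C') {τ : ℝ} (h0 : 0 < τ) (h1 : τ ≤ 1) :
    ((C : ℝ) / τ) ^ C ≤ (C' / τ) ^ C' := by
  have hC' : (1 : ℝ) ≤ C := by exact_mod_cast hC
  have hh : (C : ℝ) ≤ C' := by exact_mod_cast h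
  have h3 : (1 : ℝ) ≤ C / τ := by rw [le_div_iff₀ h0]; linarith
  calc ((C : ℝ) / τ) ^ C ≤ (C / τ) ^ C' := pow_le_pow_right₀ h3 h
    _ ≤ _ := by gcongr

theorem PB.mul {F G : ℝ → ℝ} (hF : PB F) (hG : PB G) : PB (fun τ => F τ * G τ) := by
  obtain ⟨C, hC, h⟩ := hF
  obtain ⟨C', hC', h'⟩ := hG
  refine ⟨C + C', by omega, fun τ h0 h1 => ?_⟩
  rw [abs_mul, pow_add]
  refine mul_le_mul ((h τ h0 h1).trans ?_) ((h' τ h0 h1).trans ?_) (abs_nonneg _) (by positivity)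
  · gcongr; simp
  · gcongr; simp
theorem PB.const (c : ℝ) : PB (fun _ => c) := by
  obtain ⟨n, hn⟩ := exists_nat_ge |c|
  refine ⟨n + 1, by omega, fun τ h0 h1 => ?_⟩
  have h3 : (n + 1 : ℝ) ≤ (n + 1 : ℕ) / τ := by
    rw [le_div_iff₀ h0]; push_cast; nlinarith [(Nat.cast_nonneg n : (0 : ℝ) ≤ n)]
  have h4 : (0 : ℝ) ≤ n := Nat.cast_nonneg n
  calc |c| ≤ (n + 1 : ℕ) / τ := by linarith
    _ ≤ _ := le_self_pow₀ (by linarith) (by omega)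
theorem PB.add {F G : ℝ → ℝ} (hF : PB F) (hG : PB G) : PB (fun τ => F τ + G τ) := by
  obtain ⟨C, hC, h⟩ := hF
  obtain ⟨C', hC', h'⟩ := hG
  have key : PB (fun τ => 2 * ((((C + C' : ℕ) : ℝ)) / τ) ^ (C + C')) := by
    refine (PB.const 2).mul ⟨C + C', by omega, fun τ h0 h1 => ?_⟩
    rw [abs_of_nonneg (by positivity)]
  obtain ⟨C'', hC'', h''⟩ := key
  refine ⟨C'', hC'', fun τ h0 h1 => ?_⟩
  refine le_trans ?_ ((le_abs_self _).trans (h'' τ h0 h1))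
  have := abs_add_le (F τ) (G τ)
  have e1 := (h τ h0 h1).trans (PB_mono_aux hC (Nat.le_add_right C C') h0 h1)
  have e2 := (h' τ h0 h1).trans (PB_mono_aux hC' (Nat.le_add_left C' C) h0 h1)
  linarith
theorem PB.inv : PB (fun τ => 1 / τ) :=
  ⟨1, le_rfl, fun τ h0 _ => by rw [abs_of_pos (by positivity)]; simp⟩
theorem PB.pow {F : ℝ → ℝ} (hF : PB F) (n : ℕ) : PB (fun τ => F τ ^ n) := by
  induction n with
  | zero => simpa using PB.const 1
  | succ n ih => simpa [pow_succ] using ih.mul hF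
theorem PB.mono {F G : ℝ → ℝ} (hG : PB G) (h : ∀ τ, 0 < τ → τ ≤ 1 → |F τ| ≤ G τ) : PB F := by
  obtain ⟨C', hC', h'⟩ := hG
  exact ⟨C', hC', fun τ h0 h1 => (h τ h0 h1).trans ((le_abs_self _).trans (h' τ h0 h1))⟩
theorem PB.self (C : ℕ) (hC : 1 ≤ C) : PB (fun τ => ((C : ℝ) / τ) ^ C) :=
  ⟨C, hC, fun τ h0 _ => by rw [abs_of_nonneg (by positivity)]⟩
theorem PB.compsq (c : ℝ) {F : ℝ → ℝ} (hF : PB F) (hc : 0 < c) (hc1 : c ≤ 1) (n : ℕ) :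
    PB (fun τ => F (c * τ ^ n)) := by
  obtain ⟨C, hC, h⟩ := hF
  have : PB (fun τ => ((C : ℝ) * (1 / c) * (1 / τ) ^ n) ^ C) :=
    (((PB.const C).mul (PB.const (1/c))).mul (PB.inv.pow n)).pow C
  refine this.mono fun τ h0 h1 => ?_
  refine (h _ (by positivity) ?_).trans (le_of_eq ?_)
  · exact mul_le_one₀ hc1 (by positivity) (pow_le_one₀ h0.le h1)
  · congr 1; rw [one_div_pow]; field_simp

open Finset Polynomial

def WLprop (k : ℕ) (F : ℝ → ℝ) : Prop :=
  ∀ (f : Polynomial ℝ) (M : ℕ) (τ : ℝ), f.natDegree ≤ k → 1 ≤ M → 0 < τ → τ ≤ 1 →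
    τ * M ≤ ‖∑ n ∈ range M, e (f.eval (n : ℝ))‖ →
    ∃ q : ℕ, 1 ≤ q ∧ (q : ℝ) ≤ F τ ∧ ∃ a : ℤ, |q * f.coeff k - a| ≤ F τ / M ^ k

theorem WL_one : WLprop 1 (fun τ => 1 / τ) := by
  intro f M τ hd hM h0 h1 hS
  have hM' : (1 : ℝ) ≤ M := by exact_mod_cast hM
  refine ⟨1, le_rfl, ?_, round (f.coeff 1), ?_⟩
  · rw [Nat.cast_one, le_div_iff₀ h0]; linarith
  · have h2 : ∀ x : ℝ, f.eval x = f.coeff 1 * x + f.coeff 0 := by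
      intro x
      conv_lhs => rw [Polynomial.eq_X_add_C_of_natDegree_le_one hd]
      simp
    have h3 := lin_sum (f.coeff 1) (f.coeff 0) M
    simp only [h2] at hS
    rw [Nat.cast_one, one_mul, div_div, pow_one, le_div_iff₀ (by positivity)]
    have h4 := abs_nonneg (f.coeff 1 - round (f.coeff 1))
    nlinarith [mul_le_mul_of_nonneg_right hS h4]

set_option maxHeartbeats 2000000 in
theorem WL_step (k : ℕ) (hk : 1 ≤ k) (F : ℝ → ℝ) (hF : PB F) (hW : WLprop k F) :
    ∃ G, PB G ∧ WLprop (k + 1) G := by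
  obtain ⟨C, hC, hFC⟩ := hF
  set R : ℝ → ℝ := fun τ => (8 * C * (1 / τ) ^ 2) ^ C with hR
  set E : ℝ → ℝ := fun τ => 4 * R τ * (1 / τ) ^ 2 with hE
  set D : ℝ → ℝ := fun τ => R τ * (8 * (1 / τ) ^ 2) ^ k with hD
  set M0 : ℝ → ℝ := fun τ => 100 * D τ * E τ ^ 2 with hM0
  set G : ℝ → ℝ := fun τ => R τ * (k + 1) * (4 * E τ) + 4 * D τ * E τ ^ 2 + M0 τ ^ (k + 1) with hG
  have pR : PB R := (((PB.const (8 * C))).mul (PB.inv.pow 2)).pow C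
  have pE : PB E := ((PB.const 4).mul pR).mul (PB.inv.pow 2)
  have pD : PB D := pR.mul (((PB.const 8).mul (PB.inv.pow 2)).pow k)
  have pM : PB M0 := ((PB.const 100).mul pD).mul (pE.pow 2)
  have pG : PB G := (((pR.mul (PB.const _)).mul ((PB.const 4).mul pE)).add
    (((PB.const 4).mul pD).mul (pE.pow 2))).add (pM.pow _)
  refine ⟨G, pG, ?_⟩
  intro f M τ hd hM h0 h1 hS
  have hM' : (1 : ℝ) ≤ M := by exact_mod_cast hM
  have hinv : 1 ≤ 1 / τ := by rw [le_div_iff₀ h0]; linarith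
  have hC' : (1 : ℝ) ≤ C := by exact_mod_cast hC
  have hinv2 : 1 ≤ (1 / τ) ^ 2 := one_le_pow₀ hinv
  have hR1 : 1 ≤ R τ := one_le_pow₀ (by nlinarith)
  have hE1 : 1 ≤ E τ := by simp only [hE]; nlinarith
  have h8 : 1 ≤ (8 * (1 / τ) ^ 2) ^ k := one_le_pow₀ (by linarith)
  have hDR : R τ ≤ D τ := le_mul_of_one_le_right (by linarith) h8
  have hD1 : 1 ≤ D τ := hR1.trans hDR
  have hEE : E τ ≤ E τ ^ 2 := by nlinarith
  have hM01 : 100 * E τ ≤ M0 τ := by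
    simp only [hM0]
    have : 100 * 1 * E τ ≤ 100 * D τ * E τ ^ 2 := by gcongr
    linarith
  have hM02 : 100 * D τ ≤ M0 τ := by
    simp only [hM0]
    have : 100 * D τ * 1 ≤ 100 * D τ * E τ ^ 2 := by gcongr; nlinarith
    linarith
  have hM1 : 1 ≤ M0 τ := by linarith
  have hGa : R τ * (k + 1) * (4 * E τ) ≤ G τ := by simp only [hG]; have : 0 ≤ M0 τ ^ (k+1) := by positivity
                                                   have : 0 ≤ 4 * D τ * E τ ^ 2 := by positivity
                                                   linarith
  have hGb : 4 * D τ * E τ ^ 2 ≤ G τ := by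
    simp only [hG]
    have : 0 ≤ M0 τ ^ (k+1) := by positivity
    have : 0 ≤ R τ * (k + 1) * (4 * E τ) := by positivity
    linarith
  have hGc : M0 τ ^ (k + 1) ≤ G τ := by
    simp only [hG]
    have : 0 ≤ R τ * (k + 1) * (4 * E τ) := by positivity
    have : 0 ≤ 4 * D τ * E τ ^ 2 := by positivity
    linarith
  by_cases hMs : (M : ℝ) < M0 τ
  · refine ⟨1, le_rfl, ?_, round (f.coeff (k + 1)), ?_⟩
    · rw [Nat.cast_one]; exact (one_le_pow₀ hM1).trans hGc
    · rw [Nat.cast_one, one_mul, le_div_iff₀ (by positivity)]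
      have a1 := abs_sub_round (f.coeff (k+1))
      have a2 : (M : ℝ) ^ (k + 1) ≤ M0 τ ^ (k + 1) := by gcongr
      have a3 : (0 : ℝ) ≤ (M : ℝ) ^ (k+1) := by positivity
      nlinarith [abs_nonneg (f.coeff (k+1) - round (f.coeff (k+1)))]
  push Not at hMs
  set S : ℕ → ℂ := fun h => ∑ n ∈ range (M - h), e ((taylor (h : ℝ) f - f).eval (n : ℝ)) with hSdef
  have hv := vdc_le (fun n => e (f.eval (n : ℝ))) M
  have hSS : ∀ h, ∑ n ∈ range (M - h), e (f.eval ((n + h : ℕ) : ℝ)) *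
      (starRingEnd ℂ) (e (f.eval (n : ℝ))) = S h := by
    intro h
    refine sum_congr rfl fun n _ => ?_
    rw [← e_sub, eval_sub, taylor_eval]; push_cast; rfl
  simp only [hSS] at hv
  have hSM : ∀ h, ‖S h‖ ≤ M := by
    intro h
    refine (norm_sum_le _ _).trans ?_
    simp only [e_norm, sum_const, card_range, nsmul_eq_mul, mul_one]
    exact_mod_cast Nat.sub_le M h
  set Good := (Finset.Ico 1 M).filter (fun h => τ ^ 2 / 8 * M ≤ ‖S h‖) with hGood
  have hcardG : τ ^ 2 / 4 * M ≤ Good.card := by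
    have s1 : ∑ h ∈ range M, ‖S h‖ ≤ M + Good.card * M + M * (τ ^ 2 / 8 * M) := by
      rw [range_eq_Ico, sum_eq_sum_Ico_succ_bot (by omega)]
      have := hSM 0
      have s2 : ∑ h ∈ Finset.Ico 1 M, ‖S h‖ ≤ ∑ h ∈ Finset.Ico 1 M,
          ((if τ ^ 2 / 8 * M ≤ ‖S h‖ then (M : ℝ) else 0) + τ ^ 2 / 8 * M) := by
        refine sum_le_sum fun h _ => ?_
        split_ifs with hc
        · have := hSM h; nlinarith [sq_nonneg τ]
        · push Not at hc; linarith
      rw [sum_add_distrib, ← sum_filter, sum_const, sum_const, nsmul_eq_mul, nsmul_eq_mul,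
        Nat.card_Ico] at s2
      have s3 : ((M - 1 : ℕ) : ℝ) * (τ ^ 2 / 8 * M) ≤ M * (τ ^ 2 / 8 * M) := by
        gcongr; exact Nat.sub_le _ _
      linarith
    have s2 : (τ * M) ^ 2 ≤ 2 * ∑ h ∈ range M, ‖S h‖ := by
      refine le_trans ?_ hv; gcongr
    have s3 : 8 ≤ τ ^ 2 * M := by
      have : 100 * (8 * (1 / τ) ^ 2) ≤ M := by
        have : (8 * (1 / τ) ^ 2) ≤ (8 * (1 / τ) ^ 2) ^ k := le_self_pow₀ (by linarith) (by omega)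
        have : (8 * (1 / τ) ^ 2) ^ k ≤ D τ := le_mul_of_one_le_left (by linarith) hR1
        linarith
      have h5 : τ ^ 2 * (100 * (8 * (1 / τ) ^ 2)) = 800 := by field_simp; norm_num
      nlinarith [mul_le_mul_of_nonneg_left this (sq_nonneg τ)]
    have hMpos : (0:ℝ) < M := by linarith
    have s4 : τ ^ 2 * M * M ≤ 2 * (1 + Good.card + τ ^ 2 / 8 * M) * M := by nlinarith
    have s5 := le_of_mul_le_mul_right s4 hMpos
    linarith
  -- apply IH
  have hIH : ∀ h ∈ Good, ∃ q : ℕ, 1 ≤ q ∧ (q : ℝ) ≤ R τ ∧ ∃ a : ℤ,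
      |h * (q * (k + 1) * f.coeff (k + 1)) - a| ≤ D τ / M ^ k := by
    intro h hh
    rw [hGood, mem_filter, Finset.mem_Ico] at hh
    obtain ⟨⟨hh1, hh2⟩, hh3⟩ := hh
    have hMh : ((M - h : ℕ) : ℝ) = M - h := by rw [Nat.cast_sub hh2.le]
    have hMhle : ((M - h : ℕ) : ℝ) ≤ M := by exact_mod_cast Nat.sub_le M h
    have hτ' : 0 < τ ^ 2 / 8 := by positivity
    have hτ'1 : τ ^ 2 / 8 ≤ 1 := by nlinarith
    have hdeg : (taylor (h : ℝ) f - f).natDegree ≤ k := by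
      rw [natDegree_le_iff_coeff_eq_zero]
      intro n hn
      rw [coeff_sub, taylor_coeff]
      rcases lt_or_eq_of_le (Nat.succ_le_of_lt hn) with hlt | heq
      · have h3 : f.coeff n = 0 := coeff_eq_zero_of_natDegree_lt (by omega)
        have h4 : hasseDeriv n f = 0 := by
          ext i; rw [hasseDeriv_coeff, coeff_eq_zero_of_natDegree_lt (by omega)]; simp
        rw [h3, h4]; simp
      · have h4 : hasseDeriv n f = Polynomial.C (f.coeff n) := by
          ext i
          rw [hasseDeriv_coeff, coeff_C]
          split_ifs with hi
          · simp [hi]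
          · rw [coeff_eq_zero_of_natDegree_lt (by omega)]; simp
        rw [h4]; simp
    have hcoef : (taylor (h : ℝ) f - f).coeff k = h * (k + 1) * f.coeff (k + 1) := by
      rw [coeff_sub, taylor_coeff]
      have h4 : hasseDeriv k f = Polynomial.C (f.coeff k) +
          Polynomial.C ((k + 1) * f.coeff (k + 1)) * X := by
        ext i
        rw [hasseDeriv_coeff, coeff_add, coeff_C, coeff_C_mul, coeff_X]
        rcases i with _ | _ | i
        · simp
        · simp [add_comm]
        · rw [coeff_eq_zero_of_natDegree_lt (by omega)]; simp
      rw [h4]; simp; ring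
    obtain ⟨q, hq1, hq2, a, ha⟩ := hW (taylor (h : ℝ) f - f) (M - h) (τ ^ 2 / 8) hdeg
      (by omega) hτ' hτ'1 (le_trans (by gcongr) hh3)
    have hFR : F (τ ^ 2 / 8) ≤ R τ := by
      refine (le_abs_self _).trans ((hFC _ hτ' hτ'1).trans (le_of_eq ?_))
      simp only [hR]; congr 1; field_simp
    refine ⟨q, hq1, hq2.trans hFR, a, ?_⟩
    rw [hcoef] at ha
    have e1 : (h : ℝ) * (q * (k + 1) * f.coeff (k + 1)) - a = q * (h * (k + 1) * f.coeff (k + 1)) - a := by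
      ring
    rw [e1]
    refine ha.trans ?_
    have hbig : τ ^ 2 / 8 * M ≤ ((M - h : ℕ) : ℝ) := by
      refine hh3.trans ((norm_sum_le _ _).trans ?_)
      simp [e_norm]
    have hpos : 0 < τ ^ 2 / 8 * M := by positivity
    calc F (τ ^ 2 / 8) / ((M - h : ℕ) : ℝ) ^ k ≤ R τ / (τ ^ 2 / 8 * M) ^ k := by gcongr
      _ = D τ / M ^ k := by
          simp only [hD]
          rw [show 8 * (1 / τ) ^ 2 = (τ ^ 2 / 8)⁻¹ by field_simp, inv_pow, mul_pow]; field_simp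
  choose! q hq1 hq2 hq3 using hIH
  have hRf : 0 < ⌊R τ⌋₊ := Nat.floor_pos.mpr hR1
  obtain ⟨Q, hQ, hQc⟩ : ∃ Q ∈ Finset.Icc 1 ⌊R τ⌋₊, (Good.card : ℝ) / (Finset.Icc 1 ⌊R τ⌋₊).card ≤
      (Good.filter (fun h => q h = Q)).card := by
    refine Finset.exists_le_card_fiber_of_nsmul_le_card_of_maps_to ?_ ?_ ?_
    · intro h hh
      exact Finset.mem_Icc.mpr ⟨hq1 h hh, Nat.le_floor (hq2 h hh)⟩
    · exact ⟨1, Finset.mem_Icc.mpr ⟨le_rfl, hRf⟩⟩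
    · rw [Nat.card_Icc, nsmul_eq_mul, Nat.add_sub_cancel]
      have : (0:ℝ) < ⌊R τ⌋₊ := by exact_mod_cast hRf
      field_simp; rfl
  have hεE : (0 : ℝ) < 1 / E τ := by positivity
  have hfloor : ((⌊R τ⌋₊ : ℕ) : ℝ) ≤ R τ := Nat.floor_le (by linarith)
  have hQ2 : (Q : ℝ) ≤ R τ := le_trans (by exact_mod_cast (Finset.mem_Icc.mp hQ).2) hfloor
  have hQ1 : 1 ≤ Q := (Finset.mem_Icc.mp hQ).1
  have hMk : (M : ℝ) ≤ M ^ k := le_self_pow₀ hM' (by omega)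
  obtain ⟨q2, hq21, hq22, a, ha⟩ := recur (Q * (k + 1) * f.coeff (k + 1)) (1 / E τ) (D τ / M ^ k) M
    (Good.filter (fun h => q h = Q))
    (fun h hh => by
      rw [mem_filter, hGood, mem_filter, Finset.mem_Ico] at hh
      exact Finset.mem_Icc.mpr ⟨hh.1.1.1, hh.1.1.2.le⟩)
    (by
      refine le_trans ?_ hQc
      rw [Nat.card_Icc, Nat.add_sub_cancel]
      have : (0:ℝ) < ⌊R τ⌋₊ := by exact_mod_cast hRf
      calc 1 / E τ * M = τ ^ 2 / 4 * M / R τ := by simp only [hE]; field_simp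
        _ ≤ Good.card / R τ := by gcongr
        _ ≤ _ := by gcongr)
    (fun h hh => by
      rw [mem_filter] at hh
      obtain ⟨a, ha⟩ := hq3 h hh.1
      rw [hh.2] at ha
      exact ⟨a, ha⟩)
    hεE (by rw [div_le_one (by linarith)]; exact hE1)
    (by
      rw [div_le_iff₀ (by positivity)]
      have h6 : M0 τ ≤ M ^ k := hMs.trans hMk
      calc D τ = (1 / E τ) ^ 2 / 100 * M0 τ := by simp only [hM0]; field_simp
        _ ≤ _ := by gcongr)
    (by
      have : 100 / (1 / E τ) = 100 * E τ := by field_simp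
      rw [this]; linarith)
  refine ⟨q2 * (Q * (k + 1)), by have : 0 < q2 * (Q * (k+1)) := by positivity
                                 omega, ?_, a, ?_⟩
  · refine le_trans ?_ hGa
    push_cast
    have h7 : (q2 : ℝ) ≤ 4 * E τ := by
      have : 4 / (1 / E τ) = 4 * E τ := by field_simp
      rwa [this] at hq22
    calc (q2 : ℝ) * (Q * (k + 1)) ≤ (4 * E τ) * (R τ * (k + 1)) := by gcongr
      _ = _ := by ring
  · push_cast
    have e1 : (q2 : ℝ) * (Q * (k + 1)) * f.coeff (k + 1) - a =
      q2 * (Q * (k + 1) * f.coeff (k + 1)) - a := by ring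
    rw [e1]
    refine ha.trans ?_
    calc 4 * (D τ / M ^ k) / ((1 / E τ) ^ 2 * M) = 4 * D τ * E τ ^ 2 / M ^ (k + 1) := by
          field_simp; rw [pow_succ]
      _ ≤ _ := by gcongr

theorem WL (k : ℕ) (hk : 1 ≤ k) : ∃ F, PB F ∧ WLprop k F := by
  induction k, hk using Nat.le_induction with
  | base => exact ⟨_, PB.inv, WL_one⟩
  | succ k hk ih => obtain ⟨F, h1, h2⟩ := ih; exact WL_step k hk F h1 h2
end

section
open Finset Polynomial

theorem sum_range_mul_split {E : Type*} [AddCommMonoid E] (a b : ℕ) (f : ℕ → E) :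
    ∑ n ∈ range (a * b), f n = ∑ s ∈ range a, ∑ m ∈ range b, f (s + a * m) := by
  rw [sum_comm]
  induction b with
  | zero => simp
  | succ b ih =>
    rw [Nat.mul_succ, sum_range_succ, ← ih, sum_range_add]
    congr 1
    exact sum_congr rfl fun x _ => by rw [add_comm]

theorem PB.exC {F : ℝ → ℝ} (hF : PB F) : ∃ C : ℕ, 1 ≤ C ∧
    ∀ τ : ℝ, 0 < τ → τ ≤ 1 → F τ ≤ (C / τ) ^ C := by
  obtain ⟨C, hC, h⟩ := hF
  exact ⟨C, hC, fun τ h0 h1 => (le_abs_self _).trans (h τ h0 h1)⟩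

theorem PB_one_le {C : ℕ} (hC : 1 ≤ C) {τ : ℝ} (h0 : 0 < τ) (h1 : τ ≤ 1) :
    (1 : ℝ) ≤ (C / τ) ^ C := by
  have hC' : (1 : ℝ) ≤ C := by exact_mod_cast hC
  refine one_le_pow₀ ?_
  rw [le_div_iff₀ h0]; linarith

def Rprop (k : ℕ) (F : ℝ → ℝ) : Prop :=
  ∀ (P : Polynomial ℤ) (q M : ℕ) (τ : ℝ), P.natDegree ≤ k → 1 ≤ q → 0 < τ → τ ≤ 1 →
    F τ * q ≤ M → τ * M ≤ ‖∑ n ∈ range M, e ((P.eval (n : ℤ) : ℤ) / (q : ℝ))‖ →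
    ∃ Q : ℕ, 1 ≤ Q ∧ (Q : ℝ) ≤ F τ ∧ ∀ i, 1 ≤ i → (q : ℤ) ∣ Q * P.coeff i

theorem Rprop_mono {k : ℕ} {F G : ℝ → ℝ} (h : Rprop k F)
    (hFG : ∀ τ : ℝ, 0 < τ → τ ≤ 1 → F τ ≤ G τ) : Rprop k G := by
  intro P q M τ hd hq h0 h1 hM hS
  obtain ⟨Q, a, b, c⟩ := h P q M τ hd hq h0 h1
    ((mul_le_mul_of_nonneg_right (hFG τ h0 h1) (Nat.cast_nonneg q)).trans hM) hS
  exact ⟨Q, a, b.trans (hFG τ h0 h1), c⟩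

theorem WLprop_mono {k : ℕ} {F G : ℝ → ℝ} (h : WLprop k F)
    (hFG : ∀ τ : ℝ, 0 < τ → τ ≤ 1 → F τ ≤ G τ) : WLprop k G := by
  intro f M τ hd hM h0 h1 hS
  obtain ⟨Q, a, b, c, d⟩ := h f M τ hd hM h0 h1 hS
  refine ⟨Q, a, b.trans (hFG τ h0 h1), c, d.trans ?_⟩
  have := hFG τ h0 h1
  gcongr

theorem R_zero : Rprop 0 (fun _ => 1) := by
  intro P q M τ hd hq h0 h1 hM hS
  refine ⟨1, le_rfl, by simp, fun i hi => ?_⟩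
  rw [coeff_eq_zero_of_natDegree_lt (by omega)]; simp

theorem dvd_eval_of_coeff {q : ℤ} {g : ℤ[X]} (h : ∀ i, q ∣ g.coeff i) (x : ℤ) :
    q ∣ g.eval x := by
  rw [eval_eq_sum_range]
  exact dvd_sum fun i _ => (h i).mul_right _

theorem e_div_congr {a b : ℤ} {q : ℕ} (hq : 1 ≤ q) (h : (q : ℤ) ∣ a - b) :
    e ((a : ℝ) / q) = e ((b : ℝ) / q) := by
  obtain ⟨c, hc⟩ := h
  have hq' : (q : ℝ) ≠ 0 := by positivity
  have : (a : ℝ) / q = b / q + c := by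
    have : (a : ℝ) - b = q * c := by exact_mod_cast hc
    field_simp; linarith
  rw [this, e_add_int]

theorem R_step (k : ℕ) (F : ℝ → ℝ) (hF : PB F) (hR : Rprop k F) :
    ∃ G, PB G ∧ Rprop (k + 1) G := by
  obtain ⟨C2, hC2, hF2⟩ := hF.exC
  replace hR := Rprop_mono hR hF2
  obtain ⟨FW, pW, hW⟩ := WL (k + 1) (by omega)
  obtain ⟨C1, hC1, hF1⟩ := pW.exC
  replace hW := WLprop_mono hW hF1
  set X : ℝ → ℝ := fun τ => (C1 / τ) ^ C1 with hX
  set Y : ℝ → ℝ := fun τ => (C2 / τ) ^ C2 with hY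
  set G : ℝ → ℝ := fun τ => 16 * X τ ^ (k + 2) * Y (1 / 2 * τ ^ 1) * (1 / τ) with hG
  have pG : PB G := (((PB.const 16).mul ((PB.self C1 hC1).pow _)).mul
    (PB.compsq (1/2) (PB.self C2 hC2) (by norm_num) (by norm_num) 1)).mul PB.inv
  refine ⟨G, pG, ?_⟩
  intro P q M τ hd hq h0 h1 hM hS
  have hX1 : 1 ≤ X τ := PB_one_le hC1 h0 h1
  have hτ2 : 1 / 2 * τ ^ 1 = τ / 2 := by ring
  have hY1 : 1 ≤ Y (τ / 2) := PB_one_le hC2 (by linarith) (by linarith)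
  have hq' : (1 : ℝ) ≤ q := by exact_mod_cast hq
  have hinv : 1 ≤ 1 / τ := by rw [le_div_iff₀ h0]; linarith
  simp only [hG, hτ2] at hM ⊢
  set x := X τ
  set y := Y (τ / 2)
  have hxk : x ≤ x ^ (k + 2) := le_self_pow₀ hX1 (by omega)
  have m1 : 16 * x * y * q * (1 / τ) ≤ M := by
    refine le_trans ?_ hM
    have : 16 * x * y * q * (1 / τ) ≤ 16 * x ^ (k + 2) * y * q * (1 / τ) := by gcongr
    linarith
  have m1' : 16 * x * y * q ≤ τ * M := by
    have := mul_le_mul_of_nonneg_left m1 h0.le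
    have e1 : τ * (16 * x * y * q * (1 / τ)) = 16 * x * y * q := by field_simp
    linarith
  have hyq : 1 ≤ y * q := one_le_mul_of_one_le_of_one_le hY1 hq'
  have m2 : 16 * x ≤ τ * M := by nlinarith
  have hMpos : (0 : ℝ) < M := by
    by_contra hcon
    push Not at hcon
    nlinarith
  have hMM : τ * M ≤ M := by nlinarith
  have hM1 : 1 ≤ M := by
    have : 0 < M := by exact_mod_cast hMpos
    omega
  set p := P.coeff (k + 1) with hp
  -- leading coefficient
  set f : ℝ[X] := Polynomial.C (1 / (q : ℝ)) * P.map (Int.castRingHom ℝ) with hf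
  have hfe : ∀ n : ℕ, f.eval (n : ℝ) = (P.eval (n : ℤ) : ℤ) / (q : ℝ) := by
    intro n
    rw [hf, eval_mul, eval_C, eval_natCast_map]
    simp; ring
  obtain ⟨Q1, hQ1, hQ1x, a, ha⟩ := hW f M τ ((natDegree_C_mul_le _ _).trans
    (natDegree_map_le.trans hd)) hM1 h0 h1 (by simp only [hfe]; exact hS)
  have hQ1' : (1 : ℝ) ≤ Q1 := by exact_mod_cast hQ1
  have hdvd : (q : ℤ) ∣ Q1 * p := by
    have h2 : f.coeff (k + 1) = p / q := by
      rw [hf, coeff_C_mul, coeff_map]; simp; ring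
    rw [h2] at ha
    have h3 : |((Q1 * p - q * a : ℤ) : ℝ)| < 1 := by
      have h4 : ((Q1 * p - q * a : ℤ) : ℝ) = q * (Q1 * (p / q) - a) := by
        push_cast; field_simp
      rw [h4, abs_mul, abs_of_pos (by linarith)]
      have h5 : (M : ℝ) ≤ M ^ (k + 1) :=
        le_self_pow₀ (by exact_mod_cast hM1) (by omega)
      calc (q : ℝ) * |(Q1 : ℝ) * ((p : ℝ) / q) - a| ≤ q * (x / M ^ (k + 1)) := by gcongr
        _ ≤ q * (x / M) := by gcongr
        _ = q * x / M := by ring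
        _ < 1 := by
          rw [div_lt_one hMpos]
          nlinarith [mul_le_mul_of_nonneg_left hY1 (by positivity : (0:ℝ) ≤ x * q)]
    have h6 : |(Q1 * p - q * a : ℤ)| < 1 := by exact_mod_cast h3
    have h7 := Int.abs_lt_one_iff.mp h6
    exact ⟨a, by linarith⟩
  -- splitting
  set M1 := M / Q1 with hM1def
  have hdm : Q1 * M1 + M % Q1 = M := Nat.div_add_mod M Q1
  have hrem : M % Q1 < Q1 := Nat.mod_lt _ hQ1
  set u : ℕ → ℂ := fun n => e ((P.eval (n : ℤ) : ℤ) / (q : ℝ)) with hu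
  have hsum : ∑ n ∈ range M, u n = ∑ s ∈ range Q1, ∑ m ∈ range M1, u (s + Q1 * m) +
      ∑ x ∈ range (M % Q1), u (Q1 * M1 + x) := by
    rw [← sum_range_mul_split, ← sum_range_add, hdm]
  have hS2 : 3 / 4 * τ * M ≤ ∑ s ∈ range Q1, ‖∑ m ∈ range M1, u (s + Q1 * m)‖ := by
    have h2 : ‖∑ x ∈ range (M % Q1), u (Q1 * M1 + x)‖ ≤ Q1 := by
      refine (norm_sum_le _ _).trans ?_
      simp only [hu, e_norm, sum_const, card_range, nsmul_eq_mul, mul_one]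
      exact_mod_cast hrem.le
    have h3 := norm_add_le (∑ s ∈ range Q1, ∑ m ∈ range M1, u (s + Q1 * m))
      (∑ x ∈ range (M % Q1), u (Q1 * M1 + x))
    rw [← hsum] at h3
    have h4 := norm_sum_le (range Q1) (fun s => ∑ m ∈ range M1, u (s + Q1 * m))
    linarith
  obtain ⟨s, hs, hSs⟩ : ∃ s ∈ range Q1, τ / 2 * M1 ≤ ‖∑ m ∈ range M1, u (s + Q1 * m)‖ := by
    by_contra hcon
    push Not at hcon
    have h2 : ∑ s ∈ range Q1, ‖∑ m ∈ range M1, u (s + Q1 * m)‖ ≤ ∑ s ∈ range Q1, τ / 2 * M1 :=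
      sum_le_sum fun s hs => (hcon s hs).le
    rw [sum_const, card_range, nsmul_eq_mul] at h2
    have h3 : (Q1 : ℝ) * M1 ≤ M := by exact_mod_cast (by omega : Q1 * M1 ≤ M)
    have h4 : (Q1 : ℝ) * (τ / 2 * M1) ≤ τ / 2 * M := by nlinarith
    have : 0 < τ * M := by positivity
    linarith
  set R : ℤ[X] := P - Polynomial.C p * Polynomial.X ^ (k + 1) with hRdef
  have hRdeg : R.natDegree ≤ k := by
    rw [natDegree_le_iff_coeff_eq_zero]
    intro n hn
    rw [hRdef, coeff_sub, coeff_C_mul, coeff_X_pow]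
    split_ifs with hh
    · rw [hh]; simp [hp]
    · rw [coeff_eq_zero_of_natDegree_lt (by omega)]; simp
  set R' := taylor (s : ℤ) R with hR'
  set P2 : ℤ[X] := R'.comp (Polynomial.C (Q1 : ℤ) * Polynomial.X) with hP2
  have hP2deg : P2.natDegree ≤ k := by
    refine natDegree_comp_le.trans ?_
    rw [hR', natDegree_taylor]
    calc R.natDegree * _ ≤ k * 1 := Nat.mul_le_mul hRdeg ((natDegree_C_mul_le _ _).trans natDegree_X_le)
      _ = k := mul_one k
  have hP2e : ∀ m : ℕ, u (s + Q1 * m) = e ((p * s ^ (k + 1) : ℤ) / (q : ℝ)) *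
      e ((P2.eval (m : ℤ) : ℤ) / (q : ℝ)) := by
    intro m
    rw [← e_add, ← add_div, ← Int.cast_add]
    refine e_div_congr hq ?_
    have h2 : P2.eval (m : ℤ) = P.eval ((s + Q1 * m : ℕ) : ℤ) - p * ((s + Q1 * m : ℕ) : ℤ) ^ (k + 1) := by
      rw [hP2, eval_comp, hR', taylor_eval, hRdef]
      simp [add_comm]
    rw [h2]
    have h3 : ((s + Q1 * m : ℕ) : ℤ) - s ∣ ((s + Q1 * m : ℕ) : ℤ) ^ (k + 1) - (s : ℤ) ^ (k + 1) :=
      sub_dvd_pow_sub_pow _ _ _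
    have h4 : ((s + Q1 * m : ℕ) : ℤ) - s = Q1 * m := by push_cast; ring
    rw [h4] at h3
    obtain ⟨c, hc⟩ := h3
    obtain ⟨b, hb⟩ := hdvd
    refine ⟨b * m * c, ?_⟩
    calc P.eval ((s + Q1 * m : ℕ) : ℤ) - (p * s ^ (k + 1) + (P.eval ((s + Q1 * m : ℕ) : ℤ) -
          p * ((s + Q1 * m : ℕ) : ℤ) ^ (k + 1)))
        = p * (((s + Q1 * m : ℕ) : ℤ) ^ (k + 1) - (s : ℤ) ^ (k + 1)) := by ring
      _ = (Q1 * p) * m * c := by rw [hc]; ring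
      _ = _ := by rw [hb]; ring
  simp only [hP2e] at hSs
  rw [← mul_sum, norm_mul, e_norm, one_mul] at hSs
  obtain ⟨Q2, hQ2, hQ2y, hQ2d⟩ := hR P2 q M1 (τ / 2) hP2deg hq (by linarith) (by linarith)
    (by
      change y * q ≤ M1
      have h2 : (M : ℝ) ≤ Q1 * (M1 + 1) := by
        have : M ≤ Q1 * (M1 + 1) := by rw [Nat.mul_succ]; omega
        exact_mod_cast this
      have h3 : (Q1 : ℝ) * (M1 + 1) ≤ x * (M1 + 1) := by gcongr
      have h4 : x * (16 * y * q) ≤ x * (M1 + 1) := by linarith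
      have := le_of_mul_le_mul_left h4 (by linarith)
      nlinarith) hSs
  refine ⟨Q2 * Q1 ^ (k + 1), Nat.mul_pos hQ2 (pow_pos hQ1 _), ?_, fun i hi => ?_⟩
  · push_cast
    change (Q2 : ℝ) ≤ y at hQ2y
    calc (Q2 : ℝ) * Q1 ^ (k + 1) ≤ y * x ^ (k + 1) := by gcongr
      _ ≤ y * x ^ (k + 2) := by gcongr <;> first | exact hX1 | omega
      _ ≤ 16 * x ^ (k + 2) * y * 1 := by nlinarith [(by positivity : 0 ≤ y * x ^ (k + 2))]
      _ ≤ _ := by gcongr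
  · have hR'd : ∀ j, 1 ≤ j → (q : ℤ) ∣ ((Q2 * Q1 ^ (k + 1) : ℕ) : ℤ) * R'.coeff j := by
      intro j hj
      by_cases hjk : j ≤ k
      · have h2 := hQ2d j hj
        rw [hP2, comp_C_mul_X_coeff] at h2
        obtain ⟨c, hc⟩ := Nat.exists_eq_add_of_le hjk
        have h3 : k + 1 = j + (c + 1) := by omega
        push_cast
        rw [h3, pow_add]
        have := h2.mul_right ((Q1 : ℤ) ^ (c + 1))
        exact this.trans (dvd_of_eq (by ring))
      · rw [coeff_eq_zero_of_natDegree_lt (by rw [hR', natDegree_taylor]; omega)]; simp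
    have hRd : (q : ℤ) ∣ ((Q2 * Q1 ^ (k + 1) : ℕ) : ℤ) * R.coeff i := by
      have h2 : R = taylor (-(s : ℤ)) R' := by
        rw [hR', taylor_taylor]; simp
      rw [h2, taylor_coeff, ← eval_C_mul]
      refine dvd_eval_of_coeff (fun j => ?_) _
      rw [coeff_C_mul, hasseDeriv_coeff]
      have := (hR'd (j + i) (by omega)).mul_left (((j + i).choose i : ℕ) : ℤ)
      refine this.trans (dvd_of_eq ?_)
      push_cast; ring
    have h3 : P.coeff i = R.coeff i + p * (if i = k + 1 then 1 else 0) := by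
      rw [hRdef, coeff_sub, coeff_C_mul, coeff_X_pow]; ring
    rw [h3, mul_add]
    refine dvd_add hRd ?_
    have h4 : ((Q2 * Q1 ^ (k + 1) : ℕ) : ℤ) * (p * (if i = k + 1 then 1 else 0)) =
      (Q1 * p) * (Q2 * Q1 ^ k * (if i = k + 1 then 1 else 0)) := by push_cast; ring
    rw [h4]
    exact hdvd.mul_right _

theorem RR (k : ℕ) : ∃ F, PB F ∧ Rprop k F := by
  induction k with
  | zero => exact ⟨_, PB.const 1, R_zero⟩
  | succ k ih => obtain ⟨F, h1, h2⟩ := ih; exact R_step k F h1 h2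
end

section
open Finset Polynomial

/-- facts about the auxiliary polynomials used later -/
structure HD (k : ℕ) (lam : ℕ → ℕ) (H : ℕ → Polynomial ℤ) (b G Ch : ℕ) : Prop where
  hk : 1 ≤ k
  hb : 1 ≤ b
  hG : 1 ≤ G
  deg : ∀ d, 0 < d → (H d).natDegree ≤ k
  lam_pos : ∀ d, 0 < d → 0 < lam d
  dvd_lam : ∀ d, 0 < d → d ∣ lam d
  lam_dvd : ∀ d, 0 < d → lam d ∣ d ^ k
  lead : ∀ d, 0 < d → (H d).coeff k = b * ((d ^ k / lam d : ℕ) : ℤ)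
  bound : ∀ d, 0 < d → ∀ i, |(H d).coeff i| ≤ Ch * ((d ^ k / lam d : ℕ) : ℤ)
  content : ∀ d, 0 < d → ∀ q Q : ℕ, 0 < q → 0 < Q →
    (∀ i, 1 ≤ i → (q : ℤ) ∣ Q * (H d).coeff i) → q ∣ Q * G
  sub : ∀ d t, 0 < d → 0 < t → ∀ n : ℕ, 0 < n → ∃ m : ℕ, 0 < m ∧
    (lam t : ℤ) * (H (d * t)).eval (n : ℤ) = (H d).eval (m : ℤ)

theorem bez (g : ℚ[X]) : ∀ n : ℕ, ∀ f : ℚ[X], f ≠ 0 → f.natDegree ≤ n → ∃ b : ℚ[X],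
    ∀ (K : Type) [Field K] [Algebra ℚ K] (z : K), aeval z f = 0 → aeval z g ≠ 0 →
      aeval z b * aeval z g = 1 := by
  intro n
  induction n with
  | zero =>
    intro f hf hd
    refine ⟨0, fun K _ _ z h0 _ => ?_⟩
    rw [eq_C_of_natDegree_le_zero hd] at h0 hf
    simp only [aeval_C] at h0
    have : f.coeff 0 = 0 := (map_eq_zero (algebraMap ℚ K)).mp h0
    rw [this] at hf; simp at hf
  | succ n ih =>
    intro f hf hd
    by_cases hc : IsCoprime f g
    · obtain ⟨a, b, hab⟩ := hc
      refine ⟨b, fun K _ _ z h0 _ => ?_⟩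
      have := congrArg (aeval z) hab
      simpa [h0] using this
    · set c := EuclideanDomain.gcd f g with hcd
      have hcu : ¬ IsUnit c := by
        rwa [hcd, EuclideanDomain.gcd_isUnit_iff]
      obtain ⟨f', hf'⟩ := EuclideanDomain.gcd_dvd_left f g
      obtain ⟨g', hg'⟩ := EuclideanDomain.gcd_dvd_right f g
      rw [← hcd] at hf' hg'
      have hc0 : c ≠ 0 := by rintro h; rw [h] at hf'; simp at hf'; exact hf hf'
      have hf'0 : f' ≠ 0 := by rintro h; rw [h] at hf'; simp at hf'; exact hf hf'
      have hcdeg : 0 < c.natDegree := by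
        rcases Nat.eq_zero_or_pos c.natDegree with h | h
        · exact absurd (isUnit_iff_degree_eq_zero.mpr (by
            rw [degree_eq_natDegree hc0, h]; rfl)) hcu
        · exact h
      have hdeg : f'.natDegree ≤ n := by
        have := natDegree_mul hc0 hf'0
        rw [← hf'] at this; omega
      obtain ⟨b, hb⟩ := ih f' hf'0 hdeg
      refine ⟨b, fun K _ _ z h0 h1 => hb K z ?_ h1⟩
      rw [hf', map_mul] at h0
      rcases mul_eq_zero.mp h0 with h | h
      · exact absurd (by rw [hg', map_mul, h, zero_mul]) h1
      · exact h

theorem bezZ (f g : ℤ[X]) (hf : f ≠ 0) : ∃ D : ℤ, D ≠ 0 ∧ ∀ (p : ℕ) [Fact p.Prime] (z : ℤ_[p]),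
    aeval z f = 0 → aeval z g ≠ 0 → aeval z g ∣ (D : ℤ_[p]) := by
  obtain ⟨b, hb⟩ := bez (g.map (algebraMap ℤ ℚ)) _ (f.map (algebraMap ℤ ℚ))
    (by rwa [Ne, Polynomial.map_eq_zero_iff (RingHom.injective_int _)]) le_rfl
  obtain ⟨D, hDm, hD⟩ := IsLocalization.integerNormalization_spec (nonZeroDivisors ℤ) b
  refine ⟨D, nonZeroDivisors.ne_zero hDm, fun p _ z h0 h1 => ?_⟩
  have key : ∀ u : ℤ[X], aeval (z : ℚ_[p]) (u.map (algebraMap ℤ ℚ)) = ((aeval z u : ℤ_[p]) : ℚ_[p]) := by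
    intro u
    rw [aeval_map_algebraMap, aeval_def, aeval_def]
    change _ = PadicInt.Coe.ringHom (eval₂ (algebraMap ℤ ℤ_[p]) z u)
    rw [hom_eval₂ u _ PadicInt.Coe.ringHom z]
    congr 1
  have h2 := hb ℚ_[p] (z : ℚ_[p]) (by rw [key, h0]; simp) (by rw [key]; simpa using h1)
  refine ⟨aeval z (IsLocalization.integerNormalization (nonZeroDivisors ℤ) b), ?_⟩
  have h3 := key (IsLocalization.integerNormalization (nonZeroDivisors ℤ) b)
  rw [hD] at h3
  rw [key] at h2
  have h4 : aeval (z : ℚ_[p]) ((D : ℤ) • b) = (D : ℤ) • aeval (z : ℚ_[p]) b := by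
    rw [map_zsmul]
  apply Subtype.ext
  rw [PadicInt.coe_mul, ← h3]
  change _ = _ * aeval (z : ℚ_[p]) ((D : ℤ) • b)
  rw [h4, zsmul_eq_mul]
  push_cast
  linear_combination (-(D : ℤ) : ℚ_[p]) * h2

theorem eval_bound (u : ℤ[X]) (n K : ℕ) (hn : u.natDegree ≤ n) (hnK : n ≤ K) (r : ℤ) (d : ℕ)
    (hd : 0 < d) (hr : |r| ≤ d) : |u.eval r| ≤ (∑ j ∈ range (K + 1), |u.coeff j|) * (d : ℤ) ^ n := by
  rw [eval_eq_sum_range' (n := K + 1) (by omega), sum_mul]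
  refine (abs_sum_le_sum_abs _ _).trans (sum_le_sum fun j _ => ?_)
  rw [abs_mul, abs_pow]
  by_cases hj : j ≤ n
  · gcongr
    calc |r| ^ j ≤ (d : ℤ) ^ j := by gcongr
      _ ≤ _ := pow_le_pow_right₀ (by exact_mod_cast hd) hj
  · rw [coeff_eq_zero_of_natDegree_lt (by omega)]; simp

theorem mkHD (k : ℕ) (hk : 0 < k)
    (h : Polynomial ℤ) (hdeg : h.natDegree = k) (hlead : 0 < h.leadingCoeff)
    (z : ∀ (p : ℕ) [Fact p.Prime], ℤ_[p])
    (hz : ∀ (p : ℕ) [Fact p.Prime], Polynomial.aeval (z p) h = 0)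
    (lam : ℕ → ℕ) (hlam1 : lam 1 = 1)
    (hlamMul : ∀ a b : ℕ, lam (a * b) = lam a * lam b)
    (hlamP : ∀ (p : ℕ) [Fact p.Prime],
      lam p = p ^ Polynomial.rootMultiplicity (z p) (h.map (algebraMap ℤ ℤ_[p])))
    (r : ℕ → ℤ)
    (hr : ∀ d : ℕ, 0 < d → -(d : ℤ) < r d ∧ r d ≤ 0)
    (hrz : ∀ d : ℕ, 0 < d → ∀ (p : ℕ) [Fact p.Prime], ∀ α : ℕ, p ^ α ∣ d →
      (p : ℤ_[p]) ^ α ∣ (z p - (r d : ℤ_[p])))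
    (H : ℕ → Polynomial ℤ)
    (hH : ∀ d : ℕ, 0 < d →
      Polynomial.C (lam d : ℤ) * H d =
        h.comp (Polynomial.C (r d) + Polynomial.C (d : ℤ) * Polynomial.X)) :
    ∃ b G Ch : ℕ, HD k lam H b G Ch := by
  have hh0 : h ≠ 0 := by rintro rfl; simp at hlead
  have hmap0 : ∀ (p : ℕ) [Fact p.Prime], h.map (algebraMap ℤ ℤ_[p]) ≠ 0 := by
    intro p _
    rwa [Ne, Polynomial.map_eq_zero_iff (RingHom.injective_int _)]
  have hm1 : ∀ (p : ℕ) [Fact p.Prime],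
      1 ≤ Polynomial.rootMultiplicity (z p) (h.map (algebraMap ℤ ℤ_[p])) := by
    intro p _
    rw [Nat.one_le_iff_ne_zero, ← Nat.pos_iff_ne_zero, rootMultiplicity_pos (hmap0 p), IsRoot,
      eval_map_algebraMap]
    exact hz p
  have hmk : ∀ (p : ℕ) [Fact p.Prime],
      Polynomial.rootMultiplicity (z p) (h.map (algebraMap ℤ ℤ_[p])) ≤ k := by
    intro p _
    rw [rootMultiplicity_eq_natTrailingDegree]
    refine (natTrailingDegree_le_natDegree _).trans ?_
    rw [natDegree_comp]
    simp only [natDegree_X_add_C, mul_one]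
    exact natDegree_map_le.trans hdeg.le
  have hdl : ∀ d, 0 < d → d ∣ lam d ∧ lam d ∣ d ^ k := by
    intro d
    induction d using Nat.recOnMul with
    | zero => intro h; omega
    | one => intro _; simp [hlam1]
    | prime p hp =>
      intro _
      have := Fact.mk hp
      rw [hlamP p]
      exact ⟨dvd_pow_self _ (by have := hm1 p; omega), pow_dvd_pow _ (hmk p)⟩
    | mul a b ha hb =>
      intro hab
      have ha' := ha (Nat.pos_of_mul_pos_right hab)
      have hb' := hb (Nat.pos_of_mul_pos_left hab)
      rw [hlamMul, mul_pow]
      exact ⟨mul_dvd_mul ha'.1 hb'.1, mul_dvd_mul ha'.2 hb'.2⟩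
  have hlpos : ∀ d, 0 < d → 0 < lam d := fun d hd =>
    Nat.pos_of_dvd_of_pos (hdl d hd).2 (pow_pos hd k)
  have hed : ∀ d, 0 < d → d ^ k / lam d * lam d = d ^ k := fun d hd =>
    Nat.div_mul_cancel (hdl d hd).2
  have hco : ∀ d, 0 < d → ∀ i, (lam d : ℤ) * (H d).coeff i =
      (hasseDeriv i h).eval (r d) * (d : ℤ) ^ i := by
    intro d hd i
    have h1 : h.comp (Polynomial.C (r d) + Polynomial.C (d : ℤ) * Polynomial.X) =
        (taylor (r d) h).comp (Polynomial.C (d : ℤ) * Polynomial.X) := by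
      rw [taylor_apply, comp_assoc]; congr 1; simp [add_comm]
    rw [← taylor_coeff, ← comp_C_mul_X_coeff, ← h1, ← hH d hd, coeff_C_mul]
  have hHdeg : ∀ d, 0 < d → (H d).natDegree ≤ k := by
    intro d hd
    rw [natDegree_le_iff_coeff_eq_zero]
    intro n hn
    have h1 := hco d hd n
    have h4 : hasseDeriv n h = 0 := by
      ext i; rw [hasseDeriv_coeff, coeff_eq_zero_of_natDegree_lt (by omega)]; simp
    rw [h4, eval_zero, zero_mul] at h1
    have := hlpos d hd
    rcases mul_eq_zero.mp h1 with h | h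
    · exact absurd h (by positivity)
    · exact h
  have hld : ∀ d, 0 < d → (H d).coeff k = (h.leadingCoeff.toNat : ℤ) * ((d ^ k / lam d : ℕ) : ℤ) := by
    intro d hd
    have h1 := hco d hd k
    have h4 : hasseDeriv k h = Polynomial.C h.leadingCoeff := by
      ext i
      rw [hasseDeriv_coeff, coeff_C]
      split_ifs with hi
      · subst hi; simp [leadingCoeff, hdeg]
      · rw [coeff_eq_zero_of_natDegree_lt (by omega)]; simp
    rw [h4, eval_C] at h1
    have hl : (lam d : ℤ) ≠ 0 := by have := hlpos d hd; positivity
    apply mul_left_cancel₀ hl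
    rw [h1, Int.toNat_of_nonneg hlead.le]
    have h5 : ((d ^ k / lam d : ℕ) : ℤ) * lam d = (d : ℤ) ^ k := by exact_mod_cast hed d hd
    rw [← h5]; ring
  choose D hD0 hD using fun m => bezZ h (hasseDeriv m h) hh0
  set Δ : ℤ := ∏ m ∈ range (k + 1), D m with hΔ
  have hΔ0 : Δ ≠ 0 := prod_ne_zero_iff.mpr fun m _ => hD0 m
  set b := h.leadingCoeff.toNat with hb
  have hb0 : 0 < b := by omega
  set G : ℕ := b * Δ.natAbs ^ k with hGd
  set Ch : ℕ := (∑ i ∈ range (k + 1), ∑ j ∈ range (k + 1), |(hasseDeriv i h).coeff j|).toNat with hCh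
  refine ⟨b, G, Ch, ⟨hk, hb0, Nat.mul_pos hb0 (pow_pos (Int.natAbs_pos.mpr hΔ0) _), hHdeg, hlpos,
    fun d hd => (hdl d hd).1, fun d hd => (hdl d hd).2, hld, ?_, ?_, ?_⟩⟩
  · intro d hd i
    by_cases hi : i ≤ k
    · have h1 := hco d hd i
      have hl : (0 : ℤ) < lam d := by exact_mod_cast hlpos d hd
      have h2 : |(hasseDeriv i h).eval (r d)| ≤
          (∑ j ∈ range (k + 1), |(hasseDeriv i h).coeff j|) * (d : ℤ) ^ (k - i) := by
        refine eval_bound _ _ _ ?_ (by omega) _ d hd (abs_le.mpr ?_)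
        · rw [natDegree_le_iff_coeff_eq_zero]
          intro n hn
          rw [hasseDeriv_coeff, coeff_eq_zero_of_natDegree_lt (by omega)]; simp
        · have := hr d hd; omega
      have h3 : ∑ j ∈ range (k + 1), |(hasseDeriv i h).coeff j| ≤ Ch := by
        rw [hCh, Int.toNat_of_nonneg (sum_nonneg fun _ _ => sum_nonneg fun _ _ => abs_nonneg _)]
        exact single_le_sum (f := fun i => ∑ j ∈ range (k + 1), |(hasseDeriv i h).coeff j|)
          (fun _ _ => sum_nonneg fun _ _ => abs_nonneg _) (mem_range.mpr (by omega))
      have h5 : ((d ^ k / lam d : ℕ) : ℤ) * lam d = (d : ℤ) ^ k := by exact_mod_cast hed d hd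
      refine le_of_mul_le_mul_left ?_ hl
      have h6 : (lam d : ℤ) * |(H d).coeff i| = |(hasseDeriv i h).eval (r d)| * (d : ℤ) ^ i := by
        have h7 := congrArg abs h1
        rwa [abs_mul, abs_of_pos hl, abs_mul, abs_pow, Nat.abs_cast] at h7
      rw [h6]
      calc |(hasseDeriv i h).eval (r d)| * (d : ℤ) ^ i
          ≤ (∑ j ∈ range (k + 1), |(hasseDeriv i h).coeff j|) * (d : ℤ) ^ (k - i) * (d : ℤ) ^ i := by
            gcongr
        _ = (∑ j ∈ range (k + 1), |(hasseDeriv i h).coeff j|) * (d : ℤ) ^ k := by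
            rw [mul_assoc, ← pow_add, Nat.sub_add_cancel hi]
        _ ≤ Ch * (d : ℤ) ^ k := by gcongr
        _ = _ := by rw [← h5]; ring
    · rw [coeff_eq_zero_of_natDegree_lt (by have := hHdeg d hd; omega)]
      simp; positivity
  · -- content
    intro d hd q Q hq hQ hdiv
    have key : ∀ p : ℕ, p.Prime → ∃ i, 1 ≤ i ∧ ∀ n : ℕ, ((p : ℤ) ^ n ∣ (H d).coeff i) → p ^ n ∣ G := by
      intro p hp
      have := Fact.mk hp
      set m := Polynomial.rootMultiplicity (z p) (h.map (algebraMap ℤ ℤ_[p])) with hm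
      set w : ℤ_[p] := aeval (z p) (hasseDeriv m h) with hw
      have hw0 : w ≠ 0 := by
        have h1 : w = (taylor (z p) (h.map (algebraMap ℤ ℤ_[p]))).coeff m := by
          have h2 : hasseDeriv m (h.map (algebraMap ℤ ℤ_[p])) =
              (hasseDeriv m h).map (algebraMap ℤ ℤ_[p]) := by
            ext i; simp [hasseDeriv_coeff]
          rw [taylor_coeff, hw, h2, eval_map_algebraMap]
        rw [h1, hm, rootMultiplicity_eq_natTrailingDegree, ← taylor_apply]
        have : taylor (z p) (h.map (algebraMap ℤ ℤ_[p])) ≠ 0 := by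
          rw [Ne, taylor_eq_zero]; exact hmap0 p
        exact trailingCoeff_nonzero_iff_nonzero.mpr this
      have hwΔ : w ∣ (Δ : ℤ_[p]) := by
        refine (hD m p (z p) (hz p) hw0).trans ?_
        have : D m ∣ Δ := dvd_prod_of_mem _ (mem_range.mpr (by have := hmk p; omega))
        exact (Int.castRingHom ℤ_[p]).map_dvd this
      set v := w.valuation with hv
      have hws := PadicInt.unitCoeff_spec hw0
      have hpv : (p : ℤ_[p]) ^ v ∣ w := ⟨_, by rw [mul_comm]; exact hws⟩
      have hpv1 : ¬ (p : ℤ_[p]) ^ (v + 1) ∣ w := by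
        rw [hws, pow_succ, mul_comm, ← hv]
        intro hcon
        have h2 := (mul_dvd_mul_iff_right (pow_ne_zero v (by exact_mod_cast hp.ne_zero))).mp hcon
        exact PadicInt.prime_p.not_unit (isUnit_of_dvd_unit h2 (Units.isUnit _))
      have hpΔ : p ^ v ∣ Δ.natAbs := by
        have := (PadicInt.pow_p_dvd_int_iff v Δ).mp (hpv.trans hwΔ)
        exact Int.natCast_dvd.mp (by exact_mod_cast this)
      obtain ⟨α, d', hpd', hdd⟩ := Nat.exists_eq_pow_mul_and_not_dvd hd.ne' p hp.ne_one
      have hd'0 : 0 < d' := by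
        rcases Nat.eq_zero_or_pos d' with h | h
        · subst h; simp at hpd'
        · exact h
      have hcop : IsCoprime (p : ℤ) (d' : ℤ) := by
        rw [Nat.isCoprime_iff_coprime]
        exact (Nat.Prime.coprime_iff_not_dvd hp).mpr hpd'
      by_cases hα : v < α
      · refine ⟨m, hm1 p, fun n hn => ?_⟩
        have h1 := hco d hd m
        have hnd : (p : ℤ) ^ n ∣ (hasseDeriv m h).eval (r d) := by
          have hlamd : lam d = p ^ (α * m) * lam d' := by
            rw [hdd, hlamMul]
            congr 1
            have : ∀ a, lam (p ^ a) = p ^ (a * m) := by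
              intro a
              induction a with
              | zero => simp [hlam1]
              | succ a ih => rw [pow_succ, hlamMul, ih, hlamP p, ← hm]; ring
            exact this α
          have h2 : ((p : ℤ) ^ (α * m)) * (lam d' * (H d).coeff m) =
              ((p : ℤ) ^ (α * m)) * ((hasseDeriv m h).eval (r d) * (d' : ℤ) ^ m) := by
            have e1 : (lam d : ℤ) = (p : ℤ) ^ (α * m) * lam d' := by exact_mod_cast hlamd
            have e2 : (d : ℤ) = (p : ℤ) ^ α * d' := by exact_mod_cast hdd
            rw [e1, e2, mul_pow, ← pow_mul] at h1
            linarith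
          have h3 := mul_left_cancel₀ (pow_ne_zero _ (by exact_mod_cast hp.ne_zero)) h2
          have h4 : (p : ℤ) ^ n ∣ (hasseDeriv m h).eval (r d) * (d' : ℤ) ^ m := by
            rw [← h3]; exact hn.mul_left _
          exact (IsCoprime.pow hcop).dvd_of_dvd_mul_right h4
        have hnv : n ≤ v := by
          by_contra hcon
          push Not at hcon
          apply hpv1
          have e1 : (p : ℤ_[p]) ^ (v + 1) ∣ (((hasseDeriv m h).eval (r d) : ℤ) : ℤ_[p]) := by
            rw [PadicInt.pow_p_dvd_int_iff]
            exact (pow_dvd_pow _ hcon).trans hnd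
          have e2 : (p : ℤ_[p]) ^ (v + 1) ∣ z p - (r d : ℤ_[p]) :=
            hrz d hd p (v + 1) ((pow_dvd_pow p hα).trans ⟨d', hdd⟩)
          have e3 : z p - (r d : ℤ_[p]) ∣ w - (((hasseDeriv m h).eval (r d) : ℤ) : ℤ_[p]) := by
            have e4 := sub_dvd_eval_sub (z p) (r d : ℤ_[p]) ((hasseDeriv m h).map (algebraMap ℤ ℤ_[p]))
            rw [eval_map_algebraMap, eval_intCast_map] at e4
            exact e4
          have := dvd_add (e2.trans e3) e1
          simpa using this
        exact ((pow_dvd_pow p hnv).trans (hpΔ.trans (dvd_pow_self _ (by omega)))).mul_left _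
      · push Not at hα
        refine ⟨k, hk, fun n hn => ?_⟩
        rw [hld d hd] at hn
        have h1 : p ^ n ∣ b * (d ^ k / lam d) := by exact_mod_cast hn
        have h2 : p ^ n ∣ b * d ^ k := by
          rw [← hed d hd, ← mul_assoc]; exact h1.mul_right _
        rw [hdd, mul_pow, ← mul_assoc] at h2
        have h3 : p ^ n ∣ b * (p ^ α) ^ k := by
          refine (Nat.Coprime.dvd_of_dvd_mul_right ?_ h2)
          exact Nat.Coprime.pow _ _ ((Nat.Prime.coprime_iff_not_dvd hp).mpr hpd')
        exact h3.trans (mul_dvd_mul_left b (pow_dvd_pow_of_dvd ((pow_dvd_pow p hα).trans hpΔ) k))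
    rw [Nat.dvd_iff_prime_pow_dvd_dvd]
    intro p n hp hpn
    obtain ⟨i, hi, hin⟩ := key p hp
    have h1 : p ^ n ∣ Q * ((H d).coeff i).natAbs := by
      have : ((p ^ n : ℕ) : ℤ) ∣ Q * (H d).coeff i :=
        (Int.natCast_dvd_natCast.mpr hpn).trans (hdiv i hi)
      have := Int.natCast_dvd.mp this
      rwa [Int.natAbs_mul, Int.natAbs_natCast] at this
    obtain ⟨a1, a2, h3, h4, h5⟩ := exists_dvd_and_dvd_of_dvd_mul h1
    obtain ⟨j, hj, rfl⟩ := (Nat.dvd_prime_pow hp).mp (⟨a1, by rw [h5]; ring⟩ : a2 ∣ p ^ n)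
    rw [h5]
    refine mul_dvd_mul h3 (hin j ?_)
    have := Int.natCast_dvd.mpr h4
    exact_mod_cast this
  · -- subprogression
    intro d t hd ht n hn
    have hdt : 0 < d * t := Nat.mul_pos hd ht
    have hdv : (d : ℤ) ∣ r (d * t) - r d := by
      rw [Int.natCast_dvd, Nat.dvd_iff_prime_pow_dvd_dvd]
      intro p α hp hpα
      have := Fact.mk hp
      have e1 := hrz d hd p α hpα
      have e2 := hrz (d * t) hdt p α (hpα.mul_right t)
      have e3 := dvd_sub e1 e2
      have e4 : (p : ℤ_[p]) ^ α ∣ ((r (d * t) - r d : ℤ) : ℤ_[p]) := by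
        push_cast; convert e3 using 1; ring
      rw [PadicInt.pow_p_dvd_int_iff] at e4
      exact Int.natCast_dvd.mp (by exact_mod_cast e4)
    obtain ⟨s, hs⟩ := hdv
    have hpos : 0 < s + t * n := by
      have h1 := hr (d * t) hdt
      have h2 := hr d hd
      have h3 : (d : ℤ) * (s + t * n) = r (d * t) - r d + (d * t : ℕ) * n := by
        rw [hs]; push_cast; ring
      have h4 : ((d * t : ℕ) : ℤ) * 1 ≤ (d * t : ℕ) * n := by
        gcongr; exact_mod_cast hn
      have h5 : (0 : ℤ) < d * (s + t * n) := by rw [h3]; linarith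
      exact pos_of_mul_pos_right h5 (by positivity)
    refine ⟨(s + t * n).toNat, by omega, ?_⟩
    rw [Int.toNat_of_nonneg hpos.le]
    have e1 := congrArg (eval (s + t * n : ℤ)) (hH d hd)
    have e2 := congrArg (eval (n : ℤ)) (hH (d * t) hdt)
    simp only [eval_mul, eval_C, eval_comp, eval_add, eval_X] at e1 e2
    have e3 : r d + (d : ℤ) * (s + t * n) = r (d * t) + ((d * t : ℕ) : ℤ) * n := by
      push_cast; linarith
    rw [e3, ← e2, hlamMul] at e1
    have hl : (lam d : ℤ) ≠ 0 := by have := hlpos d hd; positivity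
    apply mul_left_cancel₀ hl
    rw [e1]; push_cast; ring
end

section
open Finset Polynomial

theorem taylor_dvd {q Q s : ℤ} {R : ℤ[X]} (h : ∀ j, 1 ≤ j → q ∣ Q * (taylor s R).coeff j) (i : ℕ)
    (hi : 1 ≤ i) : q ∣ Q * R.coeff i := by
  have h2 : R = taylor (-s) (taylor s R) := by rw [taylor_taylor]; simp
  rw [h2, taylor_coeff, ← eval_C_mul]
  refine dvd_eval_of_coeff (fun j => ?_) _
  rw [coeff_C_mul, hasseDeriv_coeff]
  have := (h (j + i) (by omega)).mul_left (((j + i).choose i : ℕ) : ℤ)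
  refine this.trans (dvd_of_eq ?_)
  push_cast; ring

theorem pow_sub_pow_bound (x y n : ℝ) (hx : 0 ≤ x) (hy : 0 ≤ y) (hxn : x ≤ n) (hyn : y ≤ n)
    (hn : 1 ≤ n) (i k : ℕ) (hik : i ≤ k) (hk : 1 ≤ k) :
    |x ^ i - y ^ i| ≤ k * n ^ (k - 1) * |x - y| := by
  rcases Nat.eq_zero_or_pos i with rfl | hi
  · simp; positivity
  have h1 := (Commute.all x y).geom_sum₂_mul i
  rw [← h1, abs_mul]
  gcongr
  refine (abs_sum_le_sum_abs _ _).trans ?_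
  have : ∀ j ∈ range i, |x ^ j * y ^ (i - 1 - j)| ≤ n ^ (k - 1) := by
    intro j hj
    rw [mem_range] at hj
    rw [abs_of_nonneg (by positivity)]
    calc x ^ j * y ^ (i - 1 - j) ≤ n ^ j * n ^ (i - 1 - j) := by gcongr
      _ = n ^ (i - 1) := by rw [← pow_add]; congr 1; omega
      _ ≤ _ := pow_le_pow_right₀ hn (by omega)
  refine (sum_le_sum this).trans ?_
  rw [sum_const, card_range, nsmul_eq_mul]
  gcongr

theorem poly_var (P : ℤ[X]) (k : ℕ) (hk : 1 ≤ k) (hd : P.natDegree ≤ k) (B : ℝ)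
    (hB : ∀ i, |((P.coeff i : ℤ) : ℝ)| ≤ B) (x y n : ℕ) (hx : x ≤ n) (hy : y ≤ n) (hn : 1 ≤ n) :
    |((P.eval (x : ℤ) : ℤ) : ℝ) - ((P.eval (y : ℤ) : ℤ) : ℝ)| ≤
      B * (k + 1) ^ 2 * (n : ℝ) ^ (k - 1) * |(x : ℝ) - y| := by
  rw [eval_eq_sum_range' (n := k + 1) (by omega), eval_eq_sum_range' (n := k + 1) (by omega)]
  push_cast
  rw [← sum_sub_distrib]
  refine (abs_sum_le_sum_abs _ _).trans ?_
  have hB0 : 0 ≤ B := (abs_nonneg _).trans (hB 0)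
  have : ∀ i ∈ range (k + 1), |(P.coeff i : ℝ) * (x : ℝ) ^ i - P.coeff i * (y : ℝ) ^ i| ≤
      B * (k * (n : ℝ) ^ (k - 1) * |(x : ℝ) - y|) := by
    intro i hi
    rw [mem_range] at hi
    rw [← mul_sub, abs_mul]
    refine mul_le_mul (hB i) ?_ (abs_nonneg _) hB0
    exact pow_sub_pow_bound x y n (by positivity) (by positivity) (by exact_mod_cast hx)
      (by exact_mod_cast hy) (by exact_mod_cast hn) i k (by omega) hk
  refine (sum_le_sum this).trans ?_
  rw [sum_const, card_range, nsmul_eq_mul]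
  push_cast
  have : (0:ℝ) ≤ B * (n : ℝ) ^ (k - 1) * |(x : ℝ) - y| * (k+1) := by positivity
  nlinarith

set_option maxHeartbeats 4000000 in
theorem weylHD {k : ℕ} {lam : ℕ → ℕ} {H : ℕ → Polynomial ℤ} {b G Ch : ℕ}
    (hHD : HD k lam H b G Ch) : ∃ C0 : ℕ, 1 ≤ C0 ∧ ∀ (d n1 : ℕ) (τ γ : ℝ), 0 < d → 0 < τ → τ ≤ 1 →
      (C0 / τ) ^ C0 * ((d ^ k / lam d : ℕ) : ℝ) ≤ n1 →
      τ * n1 ≤ ‖∑ n ∈ range n1, e (((H d).eval ((n + 1 : ℕ) : ℤ) : ℤ) * γ)‖ →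
      ∃ q : ℕ, 1 ≤ q ∧ (q : ℝ) ≤ (C0 / τ) ^ C0 ∧ ∃ a : ℤ,
        |γ - a / q| ≤ (C0 / τ) ^ C0 / (((d ^ k / lam d : ℕ) : ℝ) * n1 ^ k) := by
  have hk := hHD.hk
  obtain ⟨FW, pW, hW⟩ := WL k hk
  obtain ⟨C1, hC1, hF1⟩ := pW.exC
  replace hW := WLprop_mono hW hF1
  obtain ⟨FR, pR, hR⟩ := RR k
  obtain ⟨C2, hC2, hF2⟩ := pR.exC
  replace hR := Rprop_mono hR hF2
  set X : ℝ → ℝ := fun τ => (C1 / τ) ^ C1 with hX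
  set Y : ℝ → ℝ := fun τ => (C2 / τ) ^ C2 with hY
  set T : ℝ → ℝ := fun τ => 28 * X τ * (Ch + 1) * (k + 1) ^ 2 * (1 / τ) + 1 with hT
  have pX : PB X := PB.self C1 hC1
  have pY : PB (fun τ => Y (1 / 4 * τ ^ 1)) :=
    PB.compsq (1/4) (PB.self C2 hC2) (by norm_num) (by norm_num) 1
  have pT : PB T := (((((PB.const 28).mul pX).mul (PB.const _)).mul (PB.const _)).mul PB.inv).add
    (PB.const 1)
  obtain ⟨C0, hC0, hF0⟩ := (((((((PB.const 4).mul pT).mul PB.inv).mul pY).mul pX).mul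
    (PB.const (b * G)))).exC
  refine ⟨C0, hC0, ?_⟩
  intro d n1 τ γ hd h0 h1 hn1 hS
  have hF0 := hF0 τ h0 h1
  have hX1 : 1 ≤ X τ := PB_one_le hC1 h0 h1
  have hτ4 : 1 / 4 * τ ^ 1 = τ / 4 := by ring
  rw [hτ4] at hF0
  have hY1 : 1 ≤ Y (τ / 4) := PB_one_le hC2 (by linarith) (by linarith)
  have hinv : 1 ≤ 1 / τ := by rw [le_div_iff₀ h0]; linarith
  have hT1 : 1 ≤ T τ := by
    have : 0 ≤ 28 * X τ * (Ch + 1) * (k + 1) ^ 2 * (1 / τ) := by positivity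
    simp only [hT]; linarith
  have hTx : 28 * X τ * (Ch + 1) * (k + 1) ^ 2 ≤ τ * T τ := by
    have : τ * (28 * X τ * (Ch + 1) * (k + 1) ^ 2 * (1 / τ)) = 28 * X τ * (Ch + 1) * (k + 1) ^ 2 := by
      field_simp
    simp only [hT]; linarith
  set x := X τ
  set y := Y (τ / 4)
  set t := T τ
  set K0 : ℝ := (C0 / τ) ^ C0
  set ed : ℕ := d ^ k / lam d with hed
  have hed1 : 1 ≤ ed := by
    have h2 := Nat.div_mul_cancel (hHD.lam_dvd d hd)
    have : 0 < d ^ k := pow_pos hd k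
    rcases Nat.eq_zero_or_pos ed with h | h
    · rw [← hed, h] at h2; omega
    · exact h
  have hed1' : (1 : ℝ) ≤ ed := by exact_mod_cast hed1
  have hb1 : (1 : ℝ) ≤ b := by exact_mod_cast hHD.hb
  have hG1 : (1 : ℝ) ≤ G := by exact_mod_cast hHD.hG
  have hbG : (1 : ℝ) ≤ b * G := one_le_mul_of_one_le_of_one_le hb1 hG1
  -- consequences
  have hKx : x ≤ K0 := by
    refine le_trans ?_ hF0
    calc x = 1 * 1 * 1 * 1 * x * 1 := by ring
      _ ≤ _ := by gcongr <;> linarith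
  have hKy : y * G ≤ K0 := by
    refine le_trans ?_ hF0
    calc y * G = 1 * 1 * 1 * y * 1 * (1 * G) := by ring
      _ ≤ _ := by gcongr <;> linarith
  have hnbig : 4 * t * (1 / τ) * y * x * b * ed ≤ n1 := by
    refine le_trans ?_ hn1
    gcongr
    refine le_trans ?_ hF0
    calc 4 * t * (1 / τ) * y * x * b = 4 * t * (1 / τ) * y * x * (b * 1) := by ring
      _ ≤ _ := by gcongr
  have hnbig' : 4 * t * (y * x * b * ed) ≤ τ * n1 := by
    have := mul_le_mul_of_nonneg_left hnbig h0.le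
    have e1 : τ * (4 * t * (1 / τ) * y * x * b * ed) = 4 * t * (y * x * b * ed) := by field_simp
    linarith
  have hprod : 1 ≤ y * x * b * ed := by
    calc (1:ℝ) = 1 * 1 * 1 * 1 := by ring
      _ ≤ _ := by gcongr
  have hn1pos : (0 : ℝ) < n1 := by
    by_contra hcon
    push Not at hcon
    nlinarith
  have hn1one : 1 ≤ n1 := by
    have : 0 < n1 := by exact_mod_cast hn1pos
    omega
  have hn1one' : (1 : ℝ) ≤ n1 := by exact_mod_cast hn1one
  -- step 1: leading coefficient
  set f : ℝ[X] := Polynomial.C γ * (taylor (1 : ℤ) (H d)).map (Int.castRingHom ℝ) with hf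
  have hfe : ∀ n : ℕ, f.eval (n : ℝ) = ((H d).eval ((n + 1 : ℕ) : ℤ) : ℤ) * γ := by
    intro n
    rw [hf, eval_mul, eval_C, eval_natCast_map, taylor_eval]
    push_cast; simp; ring
  obtain ⟨Q1, hQ1, hQ1x, a0, ha0⟩ := hW f n1 τ ((natDegree_C_mul_le _ _).trans
    (natDegree_map_le.trans (by rw [natDegree_taylor]; exact hHD.deg d hd))) hn1one h0 h1
    (by simp only [hfe]; exact hS)
  have hQ1' : (1 : ℝ) ≤ Q1 := by exact_mod_cast hQ1
  change (Q1 : ℝ) ≤ x at hQ1x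
  change _ ≤ x / (n1 : ℝ) ^ k at ha0
  have hfk : f.coeff k = γ * (b * ed) := by
    have h4 : hasseDeriv k (H d) = Polynomial.C ((H d).coeff k) := by
      ext i
      rw [hasseDeriv_coeff, coeff_C]
      split_ifs with hi
      · subst hi; simp
      · rw [coeff_eq_zero_of_natDegree_lt (by have := hHD.deg d hd; omega)]; simp
    rw [hf, coeff_C_mul, coeff_map, taylor_coeff, h4, eval_C, hHD.lead d hd]
    simp only [eq_intCast, Int.cast_mul, Int.cast_natCast]
    simp only [hed]
  rw [hfk] at ha0
  set qr : ℚ := (a0 : ℚ) / ((Q1 * b * ed : ℕ) : ℚ) with hqr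
  set q := qr.den with hq
  set a := qr.num with ha
  have hq0 : 0 < q := qr.den_pos
  have hq0' : (0 : ℝ) < q := by exact_mod_cast hq0
  have hQbe : 0 < Q1 * b * ed := Nat.mul_pos (Nat.mul_pos hQ1 hHD.hb) hed1
  have hqle : (q : ℝ) ≤ x * b * ed := by
    have h2 : (q : ℤ) ∣ ((Q1 * b * ed : ℕ) : ℤ) := by
      have h8 : qr = Rat.divInt a0 ((Q1 * b * ed : ℕ) : ℤ) := by
        rw [hqr, Rat.divInt_eq_div]; rfl
      rw [hq, h8]
      exact Rat.den_dvd a0 ((Q1 * b * ed : ℕ) : ℤ)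
    have h3 : q ≤ Q1 * b * ed := Nat.le_of_dvd hQbe (by exact_mod_cast h2)
    calc (q : ℝ) ≤ (Q1 * b * ed : ℕ) := by exact_mod_cast h3
      _ = Q1 * b * ed := by push_cast; ring
      _ ≤ _ := by gcongr
  have hqra : (a : ℝ) / q = a0 / (Q1 * b * ed) := by
    have h2 : ((qr : ℚ) : ℝ) = a / q := by rw [Rat.cast_def]
    rw [← h2, hqr]; push_cast; ring
  set β := γ - a / q with hβ
  have hβle : |β| ≤ x / (b * ed * n1 ^ k) := by
    have h2 : β = (Q1 * (γ * (b * ed)) - a0) / (Q1 * b * ed) := by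
      rw [hβ, hqra]; field_simp
    rw [h2, abs_div, abs_of_pos (by positivity : (0:ℝ) < Q1 * b * ed), div_le_iff₀ (by positivity)]
    refine ha0.trans ?_
    have h3 : x / (b * ed * (n1:ℝ) ^ k) * (Q1 * b * ed) = x / n1 ^ k * Q1 := by field_simp
    rw [h3]
    exact le_mul_of_one_le_right (by positivity) hQ1'
  -- blocks
  set Bn := ⌈t⌉₊ with hBn
  have hBt : t ≤ Bn := Nat.le_ceil _
  have hBt2 : (Bn : ℝ) ≤ 2 * t := by
    have := (Nat.ceil_lt_add_one (by linarith : 0 ≤ t)).le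
    linarith
  have hBpos : (0 : ℝ) < Bn := by linarith
  have hBpos' : 0 < Bn := by exact_mod_cast hBpos
  set M1 := n1 / Bn with hM1
  have hdm : Bn * M1 + n1 % Bn = n1 := Nat.div_add_mod n1 Bn
  have hrem : n1 % Bn < Bn := Nat.mod_lt _ hBpos'
  have hBM : (Bn : ℝ) * M1 ≤ n1 := by exact_mod_cast (by omega : Bn * M1 ≤ n1)
  set u : ℕ → ℂ := fun n => e (((H d).eval ((n + 1 : ℕ) : ℤ) : ℤ) * γ) with hu
  have hsum : ∑ n ∈ range n1, u n = ∑ j ∈ range Bn, ∑ i ∈ range M1, u (i + M1 * j) +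
      ∑ i ∈ range (n1 % Bn), u (Bn * M1 + i) := by
    rw [sum_comm, ← sum_range_mul_split, mul_comm M1, ← sum_range_add, hdm]
  have hS2 : 1 / 2 * τ * n1 ≤ ∑ j ∈ range Bn, ‖∑ i ∈ range M1, u (i + M1 * j)‖ := by
    have h2 : ‖∑ i ∈ range (n1 % Bn), u (Bn * M1 + i)‖ ≤ Bn := by
      refine (norm_sum_le _ _).trans ?_
      simp only [hu, e_norm, sum_const, card_range, nsmul_eq_mul, mul_one]
      exact_mod_cast hrem.le
    have h3 := norm_add_le (∑ j ∈ range Bn, ∑ i ∈ range M1, u (i + M1 * j))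
      (∑ i ∈ range (n1 % Bn), u (Bn * M1 + i))
    rw [← hsum] at h3
    have h4 := norm_sum_le (range Bn) (fun j => ∑ i ∈ range M1, u (i + M1 * j))
    have h5 : (Bn : ℝ) ≤ 1 / 2 * τ * n1 := by nlinarith
    linarith
  obtain ⟨j, hj, hSj⟩ : ∃ j ∈ range Bn, τ / 2 * M1 ≤ ‖∑ i ∈ range M1, u (i + M1 * j)‖ := by
    refine exists_le_of_sum_le ⟨0, mem_range.mpr hBpos'⟩ (le_trans ?_ hS2)
    rw [sum_const, card_range, nsmul_eq_mul]
    nlinarith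
  rw [mem_range] at hj
  have hjM : M1 * j + M1 ≤ n1 := by
    calc M1 * j + M1 = M1 * (j + 1) := by ring
      _ ≤ M1 * Bn := Nat.mul_le_mul_left _ hj
      _ ≤ n1 := by rw [mul_comm]; omega
  set m0 : ℕ := M1 * j + 1 with hm0
  set P : ℤ[X] := Polynomial.C a * taylor (m0 : ℤ) (H d) with hP
  have hPe : ∀ i : ℕ, (P.eval (i : ℤ) : ℤ) = a * (H d).eval ((i + M1 * j + 1 : ℕ) : ℤ) := by
    intro i
    rw [hP, eval_C_mul, taylor_eval]
    congr 2
  -- compare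
  have hvar : ∀ i ∈ range M1, ‖u (i + M1 * j) - e (β * (((H d).eval (m0 : ℤ) : ℤ) : ℝ)) *
      e ((P.eval (i : ℤ) : ℤ) / (q : ℝ))‖ ≤ τ / 4 := by
    intro i hi
    rw [mem_range] at hi
    have e1 : u (i + M1 * j) = e (β * (((H d).eval (m0 : ℤ) : ℤ) : ℝ)) * e ((P.eval (i : ℤ) : ℤ) / (q : ℝ)) *
        e (β * ((((H d).eval ((i + M1 * j + 1 : ℕ) : ℤ) : ℤ) : ℝ) - (((H d).eval (m0 : ℤ) : ℤ) : ℝ))) := by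
      rw [hu, ← e_add, ← e_add]
      simp only
      congr 1
      rw [hPe, hβ]; push_cast; field_simp; ring
    rw [e1, ← mul_sub_one, norm_mul, norm_mul, e_norm, e_norm, one_mul, one_mul]
    refine (e_sub_one_le _).trans ?_
    have h2 := poly_var (H d) k hk (hHD.deg d hd) (Ch * ed) (fun i => by
      exact_mod_cast hHD.bound d hd i) (i + M1 * j + 1) m0 n1 (by omega) (by omega) hn1one
    have h3 : |((i + M1 * j + 1 : ℕ) : ℝ) - (m0 : ℝ)| ≤ M1 := by
      rw [hm0]; push_cast
      rw [show (i : ℝ) + M1 * j + 1 - (M1 * j + 1) = i by ring, Nat.abs_cast]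
      exact_mod_cast hi.le
    rw [abs_mul]
    have h4 : |(((H d).eval ((i + M1 * j + 1 : ℕ) : ℤ) : ℤ) : ℝ) - (((H d).eval (m0 : ℤ) : ℤ) : ℝ)| ≤
        Ch * ed * (k + 1) ^ 2 * (n1 : ℝ) ^ (k - 1) * M1 := h2.trans (by gcongr)
    have h5 : |β| * |(((H d).eval ((i + M1 * j + 1 : ℕ) : ℤ) : ℤ) : ℝ) - (((H d).eval (m0 : ℤ) : ℤ) : ℝ)| ≤
        x / (b * ed * n1 ^ k) * (Ch * ed * (k + 1) ^ 2 * (n1 : ℝ) ^ (k - 1) * M1) := by gcongr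
    have hnk : (n1 : ℝ) ^ k = n1 ^ (k - 1) * n1 := by
      rw [← pow_succ]; congr 1; omega
    have h6 : x / (b * ed * n1 ^ k) * (Ch * ed * (k + 1) ^ 2 * (n1 : ℝ) ^ (k - 1) * M1) =
        x * Ch * (k + 1) ^ 2 * M1 / (b * n1) := by
      rw [hnk]; field_simp
    have h7 : x * Ch * (k + 1) ^ 2 * M1 / (b * n1) ≤ τ / 28 := by
      rw [div_le_iff₀ (by positivity)]
      have h8 : x * Ch * (k + 1) ^ 2 ≤ τ * t / 28 := by
        have : x * Ch * (k+1)^2 ≤ x * (Ch + 1) * (k + 1) ^ 2 := by gcongr; linarith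
        linarith
      calc x * Ch * (k + 1) ^ 2 * M1 ≤ τ * t / 28 * M1 := by gcongr
        _ ≤ τ / 28 * (Bn * M1) := by
          have : τ * t / 28 * M1 = τ / 28 * (t * M1) := by ring
          rw [this]; gcongr
        _ ≤ τ / 28 * (1 * n1) := by rw [one_mul]; gcongr
        _ ≤ τ / 28 * (b * n1) := by gcongr
    have hpi := Real.pi_lt_d2
    have h9 : 0 ≤ |β| * |(((H d).eval ((i + M1 * j + 1 : ℕ) : ℤ) : ℤ) : ℝ) - (((H d).eval (m0 : ℤ) : ℤ) : ℝ)| := by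
      positivity
    have h10 := h5.trans (h6.le.trans h7)
    have h11 := mul_le_mul hpi.le h10 h9 (by norm_num)
    linarith
  have hSP : τ / 4 * M1 ≤ ‖∑ i ∈ range M1, e ((P.eval (i : ℤ) : ℤ) / (q : ℝ))‖ := by
    have h2 : ‖∑ i ∈ range M1, u (i + M1 * j) - ∑ i ∈ range M1, e (β * (((H d).eval (m0 : ℤ) : ℤ) : ℝ)) *
      e ((P.eval (i : ℤ) : ℤ) / (q : ℝ))‖ ≤ τ / 4 * M1 := by
      rw [← sum_sub_distrib]
      refine (norm_sum_le _ _).trans ((sum_le_sum hvar).trans ?_)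
      rw [sum_const, card_range, nsmul_eq_mul]; linarith
    have h3 : ‖∑ i ∈ range M1, e (β * (((H d).eval (m0 : ℤ) : ℤ) : ℝ)) * e ((P.eval (i : ℤ) : ℤ) / (q : ℝ))‖ =
        ‖∑ i ∈ range M1, e ((P.eval (i : ℤ) : ℤ) / (q : ℝ))‖ := by
      rw [← mul_sum, norm_mul, e_norm, one_mul]
    rw [← h3]
    have := norm_sub_norm_le (∑ i ∈ range M1, u (i + M1 * j)) (∑ i ∈ range M1, e (β * (((H d).eval (m0 : ℤ) : ℤ) : ℝ)) *
      e ((P.eval (i : ℤ) : ℤ) / (q : ℝ)))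
    linarith
  obtain ⟨Q, hQ, hQy, hQd⟩ := hR P q M1 (τ / 4) ((natDegree_C_mul_le _ _).trans
    (by rw [natDegree_taylor]; exact hHD.deg d hd)) hq0 (by linarith) (by linarith)
    (by
      change y * q ≤ M1
      have h2 : (n1 : ℝ) ≤ Bn * (M1 + 1) := by
        have : n1 ≤ Bn * (M1 + 1) := by rw [Nat.mul_succ]; omega
        exact_mod_cast this
      have h3 : (Bn : ℝ) * (M1 + 1) ≤ 2 * t * (M1 + 1) := by gcongr
      have h4 : 2 * t * (2 * (y * x * b * ed)) ≤ 2 * t * (M1 + 1) := by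
        have h8 : τ * n1 ≤ 1 * n1 := by gcongr
        have h9 : 2 * t * (2 * (y * x * b * ed)) = 4 * t * (y * x * b * ed) := by ring
        linarith
      have h5 := le_of_mul_le_mul_left h4 (by linarith)
      have h6 : y * q ≤ y * (x * b * ed) := by gcongr
      linarith) hSP
  change (Q : ℝ) ≤ y at hQy
  have hcop : IsCoprime (q : ℤ) a := by
    have := qr.reduced
    rw [Int.isCoprime_iff_gcd_eq_one, Int.gcd_comm]
    exact this
  have hqQG : q ∣ Q * G := by
    refine hHD.content d hd q Q hq0 hQ (fun i hi => taylor_dvd (s := (m0 : ℤ)) (fun j hj => ?_) i hi)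
    have := hQd j hj
    rw [hP, coeff_C_mul] at this
    refine hcop.dvd_of_dvd_mul_left (this.trans (dvd_of_eq (by ring)))
  refine ⟨q, hq0, ?_, a, ?_⟩
  · have h2 : q ≤ Q * G := Nat.le_of_dvd (Nat.mul_pos hQ hHD.hG) hqQG
    calc (q : ℝ) ≤ Q * G := by exact_mod_cast h2
      _ ≤ y * G := by gcongr
      _ ≤ _ := hKy
  · refine hβle.trans ?_
    have : (1 : ℝ) * (ed * n1 ^ k) ≤ b * ed * n1 ^ k := by
      rw [mul_assoc]; gcongr
    rw [one_mul] at this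
    gcongr
end

section
open Finset

theorem hc_bern (m : ℕ) (s : ℝ) (h1 : -1 ≤ s) (h3 : s ≤ 3) : (1 + s) ^ m ≤ 1 + m * s + 5 ^ m * s ^ 2 := by
  induction m with
  | zero => simp; positivity
  | succ m ih =>
    have h4 : (m : ℝ) ≤ 5 ^ m := by exact_mod_cast (Nat.lt_pow_self (by norm_num : 1 < 5)).le
    have h5 : (0:ℝ) ≤ s ^ 2 := sq_nonneg s
    calc (1 + s) ^ (m + 1) = (1 + s) ^ m * (1 + s) := pow_succ _ _
      _ ≤ (1 + m * s + 5 ^ m * s ^ 2) * (1 + s) := by gcongr; linarith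
      _ = 1 + (m + 1) * s + (m + 5 ^ m * (1 + s)) * s ^ 2 := by ring
      _ ≤ 1 + (m + 1) * s + (5 ^ m + 5 ^ m * (1 + 3)) * s ^ 2 := by gcongr
      _ = _ := by push_cast; ring

theorem hc_scalar (m : ℕ) (hm : 1 ≤ m) (a q u : ℝ) (ha : 0 ≤ a) (hq : 0 ≤ q) (hu : u ^ 2 ≤ a * q) :
    (a + 2 * u + q) ^ m ≤ a ^ m + 2 * m * a ^ (m - 1) * u + 50 ^ m * (a ^ (m - 1) * q + q ^ m) := by
  obtain ⟨l, rfl⟩ : ∃ l, m = l + 1 := ⟨m - 1, by omega⟩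
  simp only [Nat.add_sub_cancel]
  have hab := abs_le_of_sq_le_sq' (a := u) (b := √a * √q) (by
    rw [mul_pow, Real.sq_sqrt ha, Real.sq_sqrt hq]; exact hu) (by positivity)
  have ha2 := Real.sq_sqrt ha
  have hq2 := Real.sq_sqrt hq
  have hg := Real.sqrt_nonneg a
  have hh := Real.sqrt_nonneg q
  set g := √a
  set h := √q
  have hnn : 0 ≤ a + 2 * u + q := by nlinarith [sq_nonneg (g - h)]
  have hl5 : ((l + 1 : ℕ) : ℝ) ≤ 5 ^ (l + 1) := by exact_mod_cast (Nat.lt_pow_self (by norm_num : 1 < 5)).le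
  rcases le_total q a with hqa | hqa
  · rcases eq_or_lt_of_le ha with ha0 | ha0
    · have : q = 0 := by linarith
      have hu0 : u = 0 := by
        have : u ^ 2 ≤ 0 := by rw [← ha0, zero_mul] at hu; exact hu
        exact pow_eq_zero_iff (two_ne_zero) |>.mp (le_antisymm this (sq_nonneg u))
      subst this; rw [← ha0, hu0]; simp
    · have hhg : h ≤ g := Real.sqrt_le_sqrt hqa
      set s := (2 * u + q) / a with hs
      have hsa : s * a = 2 * u + q := by rw [hs]; field_simp
      have hs1 : -1 ≤ s := by rw [hs, le_div_iff₀ ha0]; linarith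
      have hs3 : s ≤ 3 := by rw [hs, div_le_iff₀ ha0]; nlinarith
      have hb := hc_bern (l + 1) s hs1 hs3
      have hs2 : s ^ 2 * a ≤ 9 * q := by
        have h1 : (s * a) ^ 2 ≤ (3 * (g * h)) ^ 2 := by
          rw [hsa]
          apply sq_le_sq'
          · nlinarith
          · nlinarith
        have h2 : (3 * (g * h)) ^ 2 = 9 * q * a := by rw [mul_pow, mul_pow, ha2, hq2]; ring
        rw [h2] at h1
        have h3 : (s * a) ^ 2 = s ^ 2 * a * a := by ring
        rw [h3] at h1
        exact le_of_mul_le_mul_right h1 ha0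
      have e1 : a + 2 * u + q = a * (1 + s) := by rw [mul_add, mul_comm a s, hsa]; ring
      rw [e1, mul_pow]
      calc a ^ (l + 1) * (1 + s) ^ (l + 1) ≤ a ^ (l + 1) * (1 + (l + 1 : ℕ) * s + 5 ^ (l + 1) * s ^ 2) := by gcongr
        _ = a ^ (l + 1) + (l + 1 : ℕ) * a ^ l * (s * a) + 5 ^ (l + 1) * a ^ l * (s ^ 2 * a) := by ring
        _ ≤ a ^ (l + 1) + (l + 1 : ℕ) * a ^ l * (2 * u + q) + 5 ^ (l + 1) * a ^ l * (9 * q) := by rw [hsa]; gcongr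
        _ = a ^ (l + 1) + 2 * (l + 1 : ℕ) * a ^ l * u + ((l + 1 : ℕ) + 9 * 5 ^ (l + 1)) * (a ^ l * q) := by ring
        _ ≤ a ^ (l + 1) + 2 * (l + 1 : ℕ) * a ^ l * u + 50 ^ (l + 1) * (a ^ l * q + q ^ (l + 1)) := by
          gcongr
          · have : (50 : ℝ) ^ (l + 1) = 10 ^ (l + 1) * 5 ^ (l + 1) := by rw [← mul_pow]; norm_num
            rw [this]
            have h10 : (10:ℝ) ≤ 10 ^ (l + 1) := le_self_pow₀ (by norm_num) (by omega)
            nlinarith [pow_pos (by norm_num : (0:ℝ) < 5) (l + 1)]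
          · exact le_add_of_nonneg_right (by positivity)
  · have hgh : g ≤ h := Real.sqrt_le_sqrt hqa
    have h1 : (a + 2 * u + q) ^ (l + 1) ≤ (4 * q) ^ (l + 1) := by
      gcongr; nlinarith
    have h2 : |u| ≤ q := abs_le.mpr ⟨by nlinarith, by nlinarith⟩
    have h3 : -(2 * (l + 1 : ℕ) * q ^ (l + 1)) ≤ 2 * (l + 1 : ℕ) * a ^ l * u := by
      have : |2 * (l + 1 : ℕ) * a ^ l * u| ≤ 2 * (l + 1 : ℕ) * q ^ l * q := by
        rw [abs_mul, abs_of_nonneg (by positivity : (0:ℝ) ≤ 2 * (l + 1 : ℕ) * a ^ l)]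
        gcongr
      have := (abs_le.mp this).1
      rw [pow_succ]; linarith
    have h4 : (4 * q) ^ (l + 1) + 2 * (l + 1 : ℕ) * q ^ (l + 1) ≤ 50 ^ (l + 1) * q ^ (l + 1) := by
      rw [mul_pow, ← add_mul]
      gcongr
      have : (50 : ℝ) ^ (l + 1) = 10 ^ (l + 1) * 5 ^ (l + 1) := by rw [← mul_pow]; norm_num
      have h10 : (10:ℝ) ≤ 10 ^ (l + 1) := le_self_pow₀ (by norm_num) (by omega)
      have h45 : (4:ℝ) ^ (l + 1) ≤ 5 ^ (l + 1) := by gcongr; norm_num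
      rw [this]
      nlinarith [pow_pos (by norm_num : (0:ℝ) < 5) (l + 1)]
    have h5 : 0 ≤ 50 ^ (l + 1) * (a ^ l * q) := by positivity
    have h6 : 0 ≤ a ^ (l + 1) := by positivity
    linarith

theorem hc_add_pow (l : ℕ) (a t : ℝ) (ha : 0 ≤ a) (ht : 0 ≤ t) :
    a ^ (l + 1) + a ^ l * t ≤ (a + t) ^ (l + 1) := by
  have : a ^ l ≤ (a + t) ^ l := by gcongr; linarith
  calc a ^ (l + 1) + a ^ l * t = a ^ l * (a + t) := by ring
    _ ≤ (a + t) ^ l * (a + t) := by gcongr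
    _ = _ := by ring

theorem hc_one {X : Type} [Fintype X] [Nonempty X] (m : ℕ) (hm : 1 ≤ m) (a : ℝ) (q u : X → ℝ) (ha : 0 ≤ a)
    (hq : ∀ x, 0 ≤ q x) (hu : ∀ x, u x ^ 2 ≤ a * q x) (hu0 : ∑ x, u x = 0) (Q : ℝ)
    (hQ : ∑ x, q x = Fintype.card X * Q) :
    ∑ x, (a + 2 * u x + q x) ^ m ≤ Fintype.card X * (a + 50 ^ m * Q) ^ m + 50 ^ m * ∑ x, q x ^ m := by
  have hQ0 : 0 ≤ Q := by
    have h1 : (0:ℝ) ≤ Fintype.card X * Q := by rw [← hQ]; exact sum_nonneg fun x _ => hq x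
    have : (0:ℝ) < Fintype.card X := by exact_mod_cast Fintype.card_pos
    exact nonneg_of_mul_nonneg_right h1 this
  calc ∑ x, (a + 2 * u x + q x) ^ m ≤
      ∑ x, (a ^ m + 2 * m * a ^ (m - 1) * u x + 50 ^ m * (a ^ (m - 1) * q x + q x ^ m)) :=
        sum_le_sum fun x _ => hc_scalar m hm a (q x) (u x) ha (hq x) (hu x)
    _ = Fintype.card X * (a ^ m + a ^ (m - 1) * (50 ^ m * Q)) + 50 ^ m * ∑ x, q x ^ m := by
      rw [sum_add_distrib, sum_add_distrib, ← mul_sum, hu0, ← mul_sum, sum_add_distrib, ← mul_sum, hQ]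
      simp; ring
    _ ≤ _ := by
      gcongr
      obtain ⟨l, rfl⟩ : ∃ l, m = l + 1 := ⟨m - 1, by omega⟩
      exact hc_add_pow l a _ ha (by positivity)

theorem sum_pcons {r : ℕ} {α : Fin (r + 1) → Type} [∀ i, Fintype (α i)] {M : Type} [AddCommMonoid M]
    (f : (∀ i, α i) → M) : ∑ x, f x = ∑ x0 : α 0, ∑ x' : (∀ i : Fin r, α i.succ), f (Fin.cons x0 x') := by
  rw [← Fintype.sum_prod_type']
  exact (Fintype.sum_equiv (Fin.consEquiv α) _ _ (fun x => rfl)).symm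

noncomputable def ch {r : ℕ} {n : Fin r → ℕ} [∀ i, NeZero (n i)] (γ x : ∀ i, ZMod (n i)) : ℂ :=
  ∏ i, ZMod.stdAddChar (γ i * x i)

def wt (B : ℝ) (u z : Bool) : ℝ := if z then 1 else if u then 0 else B
def sg (u z : Bool) : ℂ := if u = z then 0 else 1

theorem char_ortho (n : ℕ) [NeZero n] (g : ZMod n) :
    ∑ x : ZMod n, ZMod.stdAddChar (g * x) = if g = 0 then (n : ℂ) else 0 := by
  have h := AddChar.sum_mulShift g (ZMod.isPrimitive_stdAddChar n)
  simp_rw [mul_comm g]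
  rw [h, ZMod.card]
  split_ifs <;> simp

theorem char_conj (n : ℕ) [NeZero n] (g : ZMod n) :
    (starRingEnd ℂ) (ZMod.stdAddChar g) = ZMod.stdAddChar (-g) := by
  rw [AddChar.map_neg_eq_conj]

theorem char_parseval (n : ℕ) [NeZero n] (D : ZMod n → ℂ) :
    ∑ x : ZMod n, ‖∑ g, D g * ZMod.stdAddChar (g * x)‖ ^ 2 = n * ∑ g, ‖D g‖ ^ 2 := by
  have h : ((∑ x : ZMod n, ‖∑ g, D g * ZMod.stdAddChar (g * x)‖ ^ 2 : ℝ) : ℂ) =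
      ((n * ∑ g, ‖D g‖ ^ 2 : ℝ) : ℂ) := by
    push_cast
    simp_rw [← Complex.mul_conj', map_sum, map_mul, sum_mul_sum, char_conj]
    rw [sum_comm]
    calc _ = ∑ g, ∑ g', D g * (starRingEnd ℂ) (D g') * ∑ x : ZMod n, ZMod.stdAddChar ((g - g') * x) := by
          refine sum_congr rfl fun g _ => ?_
          rw [sum_comm]
          refine sum_congr rfl fun g' _ => ?_
          rw [mul_sum]
          refine sum_congr rfl fun x _ => ?_
          rw [sub_mul, sub_eq_add_neg, AddChar.map_add_eq_mul]; ring
      _ = _ := by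
          simp_rw [char_ortho, sub_eq_zero]
          simp [mul_sum, mul_comm]
  exact_mod_cast h
end

section
open Finset

theorem cs_w {J : Type} [Fintype J] (w : J → ℝ) (hw : ∀ j, 0 ≤ w j) (G H : J → ℂ) :
    (∑ j, w j * (G j * (starRingEnd ℂ) (H j)).re) ^ 2 ≤ (∑ j, w j * ‖G j‖ ^ 2) * ∑ j, w j * ‖H j‖ ^ 2 := by
  have h1 : |∑ j, w j * (G j * (starRingEnd ℂ) (H j)).re| ≤ ∑ j, (√(w j) * ‖G j‖) * (√(w j) * ‖H j‖) := by
    refine (abs_sum_le_sum_abs _ _).trans (sum_le_sum fun j _ => ?_)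
    rw [abs_mul, abs_of_nonneg (hw j)]
    have := Complex.abs_re_le_norm (G j * (starRingEnd ℂ) (H j))
    rw [norm_mul, RCLike.norm_conj] at this
    calc w j * |(G j * (starRingEnd ℂ) (H j)).re| ≤ w j * (‖G j‖ * ‖H j‖) :=
          mul_le_mul_of_nonneg_left this (hw j)
      _ = (√(w j) * √(w j)) * (‖G j‖ * ‖H j‖) := by rw [Real.mul_self_sqrt (hw j)]
      _ = _ := by ring
  rw [← sq_abs]
  refine (pow_le_pow_left₀ (abs_nonneg _) h1 2).trans ((sum_mul_sq_le_sq_mul_sq _ _ _).trans_eq ?_)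
  simp_rw [mul_pow, Real.sq_sqrt (hw _)]

theorem sq_norm_add (G H : ℂ) : ‖G + H‖ ^ 2 = ‖G‖ ^ 2 + 2 * (G * (starRingEnd ℂ) H).re + ‖H‖ ^ 2 := by
  rw [← Complex.normSq_eq_norm_sq, Complex.normSq_add, Complex.normSq_eq_norm_sq, Complex.normSq_eq_norm_sq]
  ring

theorem char_parseval0 (n : ℕ) [NeZero n] (D : ZMod n → ℂ) :
    ∑ x : ZMod n, ‖∑ g, sg true (decide (g = 0)) * D g * ZMod.stdAddChar (g * x)‖ ^ 2 =
      n * ∑ g, (if g = 0 then 0 else ‖D g‖ ^ 2) := by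
  rw [char_parseval n (fun g => sg true (decide (g = 0)) * D g)]
  congr 1
  refine sum_congr rfl fun g _ => ?_
  by_cases h : g = 0 <;> simp [sg, h]

theorem char_mean0 (n : ℕ) [NeZero n] (D : ZMod n → ℂ) :
    ∑ x : ZMod n, ∑ g, sg true (decide (g = 0)) * D g * ZMod.stdAddChar (g * x) = 0 := by
  rw [sum_comm]
  refine sum_eq_zero fun g _ => ?_
  rw [← mul_sum, char_ortho]
  by_cases h : g = 0 <;> simp [sg, h]

/-- one coordinate -/
theorem hc_step (n : ℕ) [NeZero n] (m : ℕ) (hm : 1 ≤ m) {J : Type} [Fintype J] (w : J → ℝ) (hw : ∀ j, 0 ≤ w j)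
    (D : J → ZMod n → ℂ) :
    ∑ x : ZMod n, (∑ j, w j * ‖∑ g, D j g * ZMod.stdAddChar (g * x)‖ ^ 2) ^ m ≤
      n * (∑ p : J × ZMod n, w p.1 * wt (50 ^ m) false (decide (p.2 = 0)) * ‖D p.1 p.2‖ ^ 2) ^ m +
      50 ^ m * ∑ x : ZMod n, (∑ j, w j * ‖∑ g, sg true (decide (g = 0)) * D j g * ZMod.stdAddChar (g * x)‖ ^ 2) ^ m := by
  set Hf : J → ZMod n → ℂ := fun j x => ∑ g, sg true (decide (g = 0)) * D j g * ZMod.stdAddChar (g * x) with hHf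
  have key : ∀ j x, ∑ g, D j g * ZMod.stdAddChar (g * x) = D j 0 + Hf j x := by
    intro j x
    have : ∀ g, D j g * ZMod.stdAddChar (g * x) = (if g = 0 then D j 0 else 0) +
        sg true (decide (g = 0)) * D j g * ZMod.stdAddChar (g * x) := by
      intro g
      by_cases h : g = 0 <;> simp [sg, h]
    simp_rw [this]
    rw [sum_add_distrib]
    simp [hHf]
  have h1 := hc_one (X := ZMod n) m hm (∑ j, w j * ‖D j 0‖ ^ 2) (fun x => ∑ j, w j * ‖Hf j x‖ ^ 2)
    (fun x => ∑ j, w j * (D j 0 * (starRingEnd ℂ) (Hf j x)).re)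
    (sum_nonneg fun j _ => mul_nonneg (hw j) (by positivity))
    (fun x => sum_nonneg fun j _ => mul_nonneg (hw j) (by positivity))
    (fun x => cs_w w hw _ _)
    (by
      rw [sum_comm]
      refine sum_eq_zero fun j _ => ?_
      rw [← mul_sum, ← Complex.re_sum, ← mul_sum, ← map_sum, char_mean0]
      simp)
    (∑ j, w j * ∑ g, (if g = 0 then 0 else ‖D j g‖ ^ 2))
    (by
      rw [sum_comm, ZMod.card, mul_sum]
      refine sum_congr rfl fun j _ => ?_
      rw [← mul_sum, char_parseval0]; ring)
  have e1 : ∀ x, ∑ j, w j * ‖∑ g, D j g * ZMod.stdAddChar (g * x)‖ ^ 2 =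
      ∑ j, w j * ‖D j 0‖ ^ 2 + 2 * ∑ j, w j * (D j 0 * (starRingEnd ℂ) (Hf j x)).re + ∑ j, w j * ‖Hf j x‖ ^ 2 := by
    intro x
    rw [mul_sum, ← sum_add_distrib, ← sum_add_distrib]
    refine sum_congr rfl fun j _ => ?_
    rw [key, sq_norm_add]; ring
  simp_rw [e1]
  refine h1.trans_eq ?_
  rw [ZMod.card]
  congr 3
  rw [Fintype.sum_prod_type, mul_sum, ← sum_add_distrib]
  refine sum_congr rfl fun j _ => ?_
  have : ∀ g, w j * wt (50 ^ m) false (decide (g = 0)) * ‖D j g‖ ^ 2 =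
      (if g = 0 then w j * ‖D j 0‖ ^ 2 else 0) + 50 ^ m * (w j * (if g = 0 then 0 else ‖D j g‖ ^ 2)) := by
    intro g
    by_cases h : g = 0
    · simp [wt, h]
    · simp [wt, h]; ring
  simp_rw [this]
  rw [sum_add_distrib, ← mul_sum, ← mul_sum]
  simp

theorem ch_cons {r : ℕ} {n : Fin (r + 1) → ℕ} [∀ i, NeZero (n i)] (g x : ZMod (n 0))
    (γ y : ∀ i : Fin r, ZMod (n i.succ)) :
    ch (n := n) (Fin.cons g γ) (Fin.cons x y) = ZMod.stdAddChar (g * x) * ch γ y := by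
  simp [ch, Fin.prod_univ_succ]

theorem cons_add' {r : ℕ} {n : Fin (r + 1) → ℕ} (g x : ZMod (n 0))
    (γ y : ∀ i : Fin r, ZMod (n i.succ)) :
    (Fin.cons g γ + Fin.cons x y : ∀ i, ZMod (n i)) = Fin.cons (g + x) (γ + y) := by
  funext i
  refine Fin.cases ?_ (fun i => ?_) i <;> simp

theorem HC (m : ℕ) (hm : 1 ≤ m) : ∀ (r : ℕ) (n : Fin r → ℕ) [∀ i, NeZero (n i)] (J : Type) [Fintype J] (w : J → ℝ)
    (_ : ∀ j, 0 ≤ w j) (c : J → (∀ i, ZMod (n i)) → ℂ),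
    ∑ x, (∑ j, w j * ‖∑ γ, c j γ * ch γ x‖ ^ 2) ^ m ≤
    ∑ U : Fin r → Bool, (∏ i, if U i then (50:ℝ) ^ m else 1) *
      ∑ x, (∑ j, ∑ β : (∀ i, ZMod (n i)), w j * (∏ i, wt (50 ^ m) (U i) (decide (β i = 0))) *
        ‖∑ θ : (∀ i, ZMod (n i)), (∏ i, sg (U i) (decide (θ i = 0))) * c j (β + θ) * ch θ x‖ ^ 2) ^ m := by
  intro r
  induction r with
  | zero =>
    intro n _ J _ w hw c
    have hu : ∀ (β θ : ∀ i : Fin 0, ZMod (n i)), β + θ = θ := fun β θ => Subsingleton.elim _ _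
    simp [hu]
  | succ r ih =>
    intro n _ J _ w hw c
    have L1 : ∀ x0 (x' : ∀ i : Fin r, ZMod (n i.succ)) j, ∑ γ, c j γ * ch γ (Fin.cons x0 x') =
        ∑ g, (∑ γ', c j (Fin.cons g γ') * ch γ' x') * ZMod.stdAddChar (g * x0) := by
      intro x0 x' j
      rw [sum_pcons]
      refine sum_congr rfl fun g _ => ?_
      rw [sum_mul]
      refine sum_congr rfl fun γ' _ => ?_
      rw [ch_cons]; ring
    rw [sum_pcons, sum_comm]
    simp_rw [L1]
    refine (sum_le_sum fun x' _ => hc_step (n 0) m hm w hw _).trans ?_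
    rw [sum_add_distrib, ← mul_sum, ← mul_sum]
    have I1 := ih (fun i => n i.succ) (J × ZMod (n 0)) (fun p => w p.1 * wt (50 ^ m) false (decide (p.2 = 0)))
      (fun p => mul_nonneg (hw _) (by unfold wt; split_ifs <;> simp_all)) (fun p γ' => c p.1 (Fin.cons p.2 γ'))
    have I2 := fun x0 : ZMod (n 0) => ih (fun i => n i.succ) J w hw
      (fun j γ' => ∑ g, sg true (decide (g = 0)) * c j (Fin.cons g γ') * ZMod.stdAddChar (g * x0))
    rw [sum_pcons (α := fun _ => Bool), Fintype.sum_bool, add_comm]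
    refine add_le_add ?_ ?_
    · rw [sum_comm]
      have E2 : ∀ (x0 : ZMod (n 0)) (x' : ∀ i : Fin r, ZMod (n i.succ)) j,
          ∑ g, sg true (decide (g = 0)) * (∑ γ', c j (Fin.cons g γ') * ch γ' x') * ZMod.stdAddChar (g * x0) =
          ∑ γ', (∑ g, sg true (decide (g = 0)) * c j (Fin.cons g γ') * ZMod.stdAddChar (g * x0)) * ch γ' x' := by
        intro x0 x' j
        simp_rw [mul_sum, sum_mul]
        rw [sum_comm]
        refine sum_congr rfl fun _ _ => sum_congr rfl fun _ _ => by ring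
      simp_rw [E2]
      refine (mul_le_mul_of_nonneg_left (sum_le_sum fun x0 _ => I2 x0) (by positivity)).trans_eq ?_
      rw [sum_comm, mul_sum]
      refine sum_congr rfl fun U _ => ?_
      rw [sum_pcons (α := fun i => ZMod (n i)), ← mul_sum, ← mul_assoc, Fin.prod_univ_succ]
      simp only [Fin.cons_zero, Fin.cons_succ, if_true]
      congr 1
      refine sum_congr rfl fun x0 _ => sum_congr rfl fun x' _ => ?_
      congr 1
      refine sum_congr rfl fun j _ => ?_
      rw [sum_pcons (α := fun i => ZMod (n i)), sum_eq_single (0 : ZMod (n 0))]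
      · refine sum_congr rfl fun β _ => ?_
        rw [Fin.prod_univ_succ]
        simp only [Fin.cons_zero, Fin.cons_succ]
        congr 1
        · simp [wt]
        · congr 2
          rw [sum_pcons (α := fun i => ZMod (n i)), sum_comm]
          refine sum_congr rfl fun θ _ => ?_
          rw [mul_sum, sum_mul]
          refine sum_congr rfl fun g _ => ?_
          rw [cons_add', zero_add, ch_cons, Fin.prod_univ_succ]
          simp only [Fin.cons_zero, Fin.cons_succ]
          ring
      · intro g _ hg
        refine sum_eq_zero fun β _ => ?_
        rw [Fin.prod_univ_succ]
        simp [wt, hg]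
      · simp
    · refine (mul_le_mul_of_nonneg_left I1 (by positivity)).trans_eq ?_
      rw [mul_sum]
      refine sum_congr rfl fun U _ => ?_
      rw [sum_pcons (α := fun i => ZMod (n i)), Fin.prod_univ_succ]
      simp only [Fin.cons_zero, Fin.cons_succ, Bool.false_eq_true, if_false, one_mul]
      rw [mul_left_comm]
      congr 1
      have E3 : ∀ (x0 : ZMod (n 0)) (x' : ∀ i : Fin r, ZMod (n i.succ)),
          (∑ p : J × ZMod (n 0), ∑ β : (∀ i : Fin r, ZMod (n i.succ)),
            w p.1 * wt (50 ^ m) false (decide (p.2 = 0)) * (∏ i, wt (50 ^ m) (U i) (decide (β i = 0))) *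
            ‖∑ θ : (∀ i : Fin r, ZMod (n i.succ)), (∏ i, sg (U i) (decide (θ i = 0))) *
              c p.1 (Fin.cons p.2 (β + θ)) * ch θ x'‖ ^ 2) =
          ∑ j, ∑ β : (∀ i, ZMod (n i)), w j * (∏ i, wt (50 ^ m) ((Fin.cons false U : Fin (r+1) → Bool) i) (decide (β i = 0))) *
            ‖∑ θ : (∀ i, ZMod (n i)), (∏ i, sg ((Fin.cons false U : Fin (r+1) → Bool) i) (decide (θ i = 0))) *
              c j (β + θ) * ch θ (Fin.cons x0 x')‖ ^ 2 := by
        intro x0 x'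
        rw [Fintype.sum_prod_type]
        refine sum_congr rfl fun j _ => ?_
        rw [sum_pcons (α := fun i => ZMod (n i))]
        refine sum_congr rfl fun g _ => sum_congr rfl fun β _ => ?_
        rw [Fin.prod_univ_succ]
        simp only [Fin.cons_zero, Fin.cons_succ]
        rw [mul_assoc (w j)]
        congr 3
        rw [sum_pcons (α := fun i => ZMod (n i)), sum_eq_single (0 : ZMod (n 0))]
        · refine sum_congr rfl fun θ _ => ?_
          rw [cons_add', add_zero, ch_cons, Fin.prod_univ_succ]
          simp [sg]
        · intro g _ hg
          refine sum_eq_zero fun β _ => ?_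
          rw [Fin.prod_univ_succ]
          simp [sg, hg]
        · simp
      simp_rw [← E3, sum_const]
      rw [card_univ, ZMod.card, nsmul_eq_mul]
end

section
open Finset

section
variable {r : ℕ} {n : Fin r → ℕ} [∀ i, NeZero (n i)]

def sp (γ : ∀ i, ZMod (n i)) : Finset (Fin r) := univ.filter (fun i => γ i ≠ 0)

def pt (n : Fin r → ℕ) (x : ℕ) : ∀ i, ZMod (n i) := fun i => (x : ZMod (n i))

theorem ch_add_left (γ δ x : ∀ i, ZMod (n i)) : ch (γ + δ) x = ch γ x * ch δ x := by
  simp only [ch, ← prod_mul_distrib, Pi.add_apply, add_mul, AddChar.map_add_eq_mul]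

theorem ch_add_right (γ x y : ∀ i, ZMod (n i)) : ch γ (x + y) = ch γ x * ch γ y := by
  simp only [ch, ← prod_mul_distrib, Pi.add_apply, mul_add, AddChar.map_add_eq_mul]

theorem ch_zero_left (x : ∀ i, ZMod (n i)) : ch 0 x = 1 := by simp [ch]

theorem ch_conj (γ x : ∀ i, ZMod (n i)) : (starRingEnd ℂ) (ch γ x) = ch (-γ) x := by
  simp [ch, map_prod, char_conj]

theorem ch_neg_swap (γ x : ∀ i, ZMod (n i)) : ch (-γ) x = ch γ (-x) := by
  simp [ch]

theorem ch_norm (γ x : ∀ i, ZMod (n i)) : ‖ch γ x‖ = 1 := by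
  simp [ch, norm_prod, AddChar.norm_apply]

theorem sum_ch (γ : ∀ i, ZMod (n i)) : ∑ x, ch γ x = if γ = 0 then ((∏ i, n i : ℕ) : ℂ) else 0 := by
  simp only [ch]
  rw [← Fintype.prod_sum (f := fun i (x : ZMod (n i)) => (ZMod.stdAddChar (γ i * x) : ℂ))]
  simp_rw [char_ortho]
  split_ifs with h
  · subst h; simp
  · obtain ⟨i, hi⟩ : ∃ i, γ i ≠ 0 := by
      by_contra hcon; push Not at hcon; exact h (funext hcon)
    exact prod_eq_zero (mem_univ i) (by simp [hi])

theorem ch_pt (γ : ∀ i, ZMod (n i)) (x : ℕ) : ch γ (pt n x) = ch γ (pt n 1) ^ x := by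
  induction x with
  | zero => simp [ch, pt]
  | succ x ih =>
    have : pt n (x + 1) = pt n x + pt n 1 := by funext i; simp [pt]
    rw [this, ch_add_right, ih, pow_succ]

theorem geom_bound (ζ : ℂ) (q N : ℕ) (hq : 0 < q) (h1 : ζ ≠ 1) (hn : ‖ζ‖ = 1) (hζ : ζ ^ q = 1) :
    ‖∑ x ∈ range N, ζ ^ x‖ ≤ q := by
  have h2 : ∑ x ∈ range N, ζ ^ x = ∑ x ∈ range (N % q), ζ ^ x := by
    rw [geom_sum_eq h1, geom_sum_eq h1]
    congr 2
    conv_lhs => rw [← Nat.mod_add_div N q, pow_add, pow_mul, hζ, one_pow, mul_one]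
  rw [h2]
  refine (norm_sum_le _ _).trans ?_
  simp only [norm_pow, hn, one_pow, sum_const, card_range, nsmul_eq_mul, mul_one]
  exact_mod_cast (Nat.mod_lt _ hq).le

theorem ch_sum_bound (hco : ∀ i j, i ≠ j → (n i).Coprime (n j)) (δ : ∀ i, ZMod (n i)) (hδ : δ ≠ 0) (N : ℕ) :
    ‖∑ x ∈ range N, ch δ (pt n x)‖ ≤ (∏ i ∈ sp δ, n i : ℕ) := by
  rw [sum_congr rfl fun x _ => ch_pt δ x]
  refine geom_bound _ _ N (prod_pos fun i _ => Nat.pos_of_neZero _) ?_ (ch_norm _ _) ?_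
  · intro h1
    obtain ⟨i, hi⟩ : ∃ i, δ i ≠ 0 := by
      by_contra hcon; push Not at hcon; exact hδ (funext hcon)
    have h2 : ch δ (pt n (∏ l ∈ univ.erase i, n l)) = 1 := by rw [ch_pt, h1, one_pow]
    rw [ch, prod_eq_single i] at h2
    · have h2 := ZMod.injective_stdAddChar (h2.trans (AddChar.map_zero_eq_one _).symm)
      simp only [pt] at h2
      have hu : IsUnit ((∏ l ∈ univ.erase i, n l : ℕ) : ZMod (n i)) := by
        rw [ZMod.isUnit_iff_coprime]
        exact Nat.Coprime.prod_left fun l hl => hco l i (ne_of_mem_erase hl)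
      exact hi (hu.mul_left_eq_zero.mp h2)
    · intro l _ hl
      have : ((∏ l ∈ univ.erase i, n l : ℕ) : ZMod (n l)) = 0 := by
        rw [ZMod.natCast_eq_zero_iff]
        exact dvd_prod_of_mem n (mem_erase.mpr ⟨hl, mem_univ _⟩)
      simp [pt, this]
    · simp
  · rw [← ch_pt, ch]
    refine prod_eq_one fun i _ => ?_
    by_cases h : δ i = 0
    · simp [h]
    · have : ((∏ l ∈ sp δ, n l : ℕ) : ZMod (n i)) = 0 := by
        rw [ZMod.natCast_eq_zero_iff]
        exact dvd_prod_of_mem n (by simp [sp, h])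
      simp only [pt, this]; simp

def TP (s : ℕ) (R : ℝ) (P : (∀ i, ZMod (n i)) → ℂ) : Prop :=
  ∃ a : (∀ i, ZMod (n i)) → ℂ, (∀ x, P x = ∑ δ, a δ * ch δ x) ∧ (∀ δ, a δ ≠ 0 → (sp δ).card ≤ s) ∧
    ∑ δ, ‖a δ‖ ≤ R

theorem sp_add (γ δ : ∀ i, ZMod (n i)) : sp (γ + δ) ⊆ sp γ ∪ sp δ := by
  intro i
  simp only [sp, mem_filter, mem_union, mem_univ, true_and, Pi.add_apply]
  contrapose!
  rintro ⟨h1, h2⟩; simp [h1, h2]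

theorem TP.mul {s s' : ℕ} {R R' : ℝ} {P P' : (∀ i, ZMod (n i)) → ℂ} (hR : 0 ≤ R) (h : TP s R P) (h' : TP s' R' P') :
    TP (s + s') (R * R') (fun x => P x * P' x) := by
  obtain ⟨a, h1, h2, h3⟩ := h
  obtain ⟨b, g1, g2, g3⟩ := h'
  refine ⟨fun η => ∑ δ, a δ * b (η - δ), ?_, ?_, ?_⟩
  · intro x
    beta_reduce
    rw [h1, g1, sum_mul]
    rw [sum_congr rfl fun η _ => sum_mul univ (fun δ => a δ * b (η - δ)) (ch η x), sum_comm]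
    refine sum_congr rfl fun δ _ => ?_
    rw [mul_sum, ← Equiv.sum_comp (Equiv.addLeft δ) (fun η => a δ * b (η - δ) * ch η x)]
    refine sum_congr rfl fun ε _ => ?_
    simp only [Equiv.coe_addLeft, add_sub_cancel_left, ch_add_left]; ring
  · intro η hη
    obtain ⟨δ, _, hδ⟩ := exists_ne_zero_of_sum_ne_zero hη
    have k1 := h2 δ (left_ne_zero_of_mul hδ)
    have k2 := g2 _ (right_ne_zero_of_mul hδ)
    have k3 := card_le_card (sp_add δ (η - δ))
    rw [add_sub_cancel] at k3
    exact k3.trans ((card_union_le _ _).trans (by omega))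
  · calc ∑ η, ‖∑ δ, a δ * b (η - δ)‖ ≤ ∑ η, ∑ δ, ‖a δ‖ * ‖b (η - δ)‖ :=
        sum_le_sum fun η _ => (norm_sum_le _ _).trans (by simp_rw [norm_mul]; rfl)
      _ = (∑ δ, ‖a δ‖) * ∑ ε, ‖b ε‖ := by
        rw [sum_comm, sum_mul]
        refine sum_congr rfl fun δ _ => ?_
        rw [← mul_sum]; congr 1
        exact Equiv.sum_comp (Equiv.subRight δ) (fun η => ‖b η‖)
      _ ≤ _ := by gcongr

theorem TP.conj {s : ℕ} {R : ℝ} {P : (∀ i, ZMod (n i)) → ℂ} (h : TP s R P) :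
    TP s R (fun x => (starRingEnd ℂ) (P x)) := by
  obtain ⟨a, h1, h2, h3⟩ := h
  refine ⟨fun η => (starRingEnd ℂ) (a (-η)), ?_, ?_, ?_⟩
  · intro x
    simp only [h1, map_sum, map_mul, ch_conj]
    rw [← Equiv.sum_comp (Equiv.neg _) (fun η => (starRingEnd ℂ) (a (-η)) * ch η x)]
    simp
  · intro η hη
    have := h2 (-η) (by simpa using hη)
    simpa [sp] using this
  · rw [← Equiv.sum_comp (Equiv.neg _)]; simpa using h3

theorem TP.pow {s : ℕ} {R : ℝ} {P : (∀ i, ZMod (n i)) → ℂ} (hR : 0 ≤ R) (h : TP s R P) (m : ℕ) :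
    TP (s * m) (R ^ m) (fun x => P x ^ m) := by
  induction m with
  | zero =>
    refine ⟨fun δ => if δ = 0 then 1 else 0, ?_, ?_, ?_⟩
    · intro x; simp [ch_zero_left]
    · intro δ hδ
      have : δ = 0 := by by_contra h0; simp [h0] at hδ
      subst this; simp [sp]
    · simp [apply_ite]
  | succ m ih =>
    simp_rw [pow_succ, Nat.mul_succ]
    exact ih.mul (by positivity) h

theorem TP.transfer (hco : ∀ i j, i ≠ j → (n i).Coprime (n j)) {Q0 : ℕ} (hQ : ∀ i, n i ≤ Q0) (hQ1 : 1 ≤ Q0)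
    {s : ℕ} {R : ℝ} {P : (∀ i, ZMod (n i)) → ℂ} (h : TP s R P) (N : ℕ) :
    ‖∑ x ∈ range N, P (pt n x) - N * ((∏ i, n i : ℕ) : ℂ)⁻¹ * ∑ x, P x‖ ≤ R * Q0 ^ s := by
  obtain ⟨a, h1, h2, h3⟩ := h
  have hpn : ((∏ i, n i : ℕ) : ℂ) ≠ 0 := by
    exact_mod_cast (prod_pos fun i _ => Nat.pos_of_neZero (n i)).ne'
  have e1 : ∑ x, P x = a 0 * ((∏ i, n i : ℕ) : ℂ) := by
    simp_rw [h1]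
    rw [sum_comm]
    simp_rw [← mul_sum, sum_ch]
    simp
  have e2 : ∑ x ∈ range N, P (pt n x) - N * ((∏ i, n i : ℕ) : ℂ)⁻¹ * ∑ x, P x =
      ∑ δ, a δ * (if δ = 0 then 0 else ∑ x ∈ range N, ch δ (pt n x)) := by
    rw [e1]
    simp_rw [h1]
    rw [sum_comm]
    simp_rw [← mul_sum]
    have : ∀ δ, a δ * ∑ x ∈ range N, ch δ (pt n x) = (if δ = 0 then N * a 0 else 0) +
        a δ * (if δ = 0 then 0 else ∑ x ∈ range N, ch δ (pt n x)) := by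
      intro δ
      split_ifs with h0
      · subst h0; simp [ch_zero_left, mul_comm]
      · simp
    simp_rw [this]
    rw [sum_add_distrib, sum_ite_eq' univ, if_pos (mem_univ _)]
    field_simp; ring
  rw [e2]
  refine (norm_sum_le _ _).trans ?_
  calc _ ≤ ∑ δ, ‖a δ‖ * (Q0 : ℝ) ^ s := by
        refine sum_le_sum fun δ _ => ?_
        rw [norm_mul]
        by_cases ha : a δ = 0
        · simp [ha]
        gcongr
        split_ifs with h0
        · simp
        · refine (ch_sum_bound hco δ h0 N).trans ?_
          have : ∏ i ∈ sp δ, n i ≤ Q0 ^ s :=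
            (prod_le_pow_card _ _ _ fun i _ => hQ i).trans (Nat.pow_le_pow_right hQ1 (h2 δ ha))
          exact_mod_cast this
    _ = (∑ δ, ‖a δ‖) * (Q0 : ℝ) ^ s := by rw [sum_mul]
    _ ≤ _ := by gcongr

end

theorem cnt_sp {r : ℕ} {α : Fin r → Type} [∀ i, Fintype (α i)] [∀ i, DecidableEq (α i)] (o : ∀ i, α i) (Q0 : ℕ)
    (hQ1 : 1 ≤ Q0) (hQ : ∀ i, Fintype.card (α i) ≤ Q0) (j : ℕ) :
    ((univ.filter (fun f : ∀ i, α i => (univ.filter (fun i => f i ≠ o i)).card ≤ j)).card : ℝ) ≤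
      3 * (((r + 1) * Q0 : ℕ) : ℝ) ^ j := by
  set z : ℝ := 1 / (((r + 1) * Q0 : ℕ) : ℝ) with hz
  have hp : (1 : ℝ) ≤ (((r + 1) * Q0 : ℕ) : ℝ) := by
    exact_mod_cast Nat.one_le_iff_ne_zero.mpr (Nat.mul_ne_zero (by omega) (by omega))
  have hz0 : 0 < z := by positivity
  have hz1 : z ≤ 1 := by rw [hz, div_le_one (by linarith)]; exact hp
  have h1 : ((univ.filter (fun f : ∀ i, α i => (univ.filter (fun i => f i ≠ o i)).card ≤ j)).card : ℝ) * z ^ j ≤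
      ∑ f : ∀ i, α i, ∏ i, (if f i ≠ o i then z else 1) := by
    rw [← nsmul_eq_mul, ← sum_const]
    refine (sum_le_sum fun f hf => ?_).trans (sum_le_sum_of_subset_of_nonneg (filter_subset _ _)
      fun f _ _ => prod_nonneg fun i _ => by split_ifs <;> positivity)
    rw [prod_ite, prod_const_one, mul_one, prod_const]
    exact pow_le_pow_of_le_one hz0.le hz1 (mem_filter.mp hf).2
  rw [← Fintype.prod_sum (f := fun i (a : α i) => if a ≠ o i then z else (1:ℝ))] at h1
  have h2 : ∏ i, ∑ a : α i, (if a ≠ o i then z else (1:ℝ)) ≤ 3 := by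
    calc ∏ i, ∑ a : α i, (if a ≠ o i then z else (1:ℝ)) ≤ ∏ i : Fin r, Real.exp (1 / (r + 1 : ℝ)) := by
          refine prod_le_prod (fun i _ => sum_nonneg fun a _ => by split_ifs <;> positivity) fun i _ => ?_
          refine le_trans ?_ (Real.add_one_le_exp _)
          calc ∑ a : α i, (if a ≠ o i then z else (1:ℝ)) ≤ ∑ a : α i, ((if a = o i then 1 else 0) + z) := by
                refine sum_le_sum fun a _ => ?_
                by_cases h : a = o i <;> simp [h, hz0.le]
            _ = 1 + Fintype.card (α i) * z := by
                rw [sum_add_distrib]; simp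
            _ ≤ 1 + Q0 * z := by
                gcongr; exact_mod_cast hQ i
            _ = _ := by
                rw [hz]; push_cast
                have : (Q0 : ℝ) ≠ 0 := by positivity
                field_simp; ring
      _ = Real.exp (r * (1 / (r + 1 : ℝ))) := by
          rw [prod_const, card_univ, Fintype.card_fin, ← Real.exp_nat_mul]
      _ ≤ Real.exp 1 := by
          gcongr
          rw [mul_one_div, div_le_one (by positivity)]; linarith
      _ ≤ 3 := by linarith [Real.exp_one_lt_d9]
  have h3 := h1.trans h2
  rw [hz, one_div, inv_pow, ← div_eq_mul_inv, div_le_iff₀ (by positivity)] at h3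
  exact h3
end

section
open Finset

section
variable {r : ℕ} {n : Fin r → ℕ} [∀ i, NeZero (n i)]

def AT (n : Fin r → ℕ) (A : Finset ℕ) (T : Finset (Fin r)) (ω : ∀ i, ZMod (n i)) : Finset ℕ :=
  A.filter (fun x => ∀ i ∈ T, pt n x i = ω i)

noncomputable def coef (A : Finset ℕ) (N : ℕ) (T : Finset (Fin r)) (ω γ : ∀ i, ZMod (n i)) : ℂ :=
  ((∏ i ∈ T, n i : ℕ) : ℂ) / N * ∑ x ∈ AT n A T ω, ch (-γ) (pt n x)

def lev (n : Fin r → ℕ) [∀ i, NeZero (n i)] (T : Finset (Fin r)) (j : ℕ) : Finset (∀ i, ZMod (n i)) :=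
  univ.filter (fun γ => (sp γ).card = j ∧ Disjoint (sp γ) T)

theorem sum_sg_ch (U : Fin r → Bool) (y : ∀ i, ZMod (n i)) :
    ∑ θ : (∀ i, ZMod (n i)), (∏ i, sg (U i) (decide (θ i = 0))) * ch θ y =
      ∑ U' ∈ (univ.filter (fun i => U i = true)).powerset, (∏ i ∈ U', if y i = 0 then (n i : ℂ) else 0) *
        ∏ i ∈ (univ.filter (fun i => U i = true)) \ U', (-1 : ℂ) := by
  rw [← prod_add, prod_filter]
  simp only [ch, ← prod_mul_distrib]
  rw [← Fintype.prod_sum (f := fun i (t : ZMod (n i)) => sg (U i) (decide (t = 0)) * (ZMod.stdAddChar (t * y i) : ℂ))]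
  refine prod_congr rfl fun i _ => ?_
  by_cases hU : U i = true
  · rw [if_pos hU, hU]
    have : ∀ t : ZMod (n i), sg true (decide (t = 0)) * (ZMod.stdAddChar (t * y i) : ℂ) =
        ZMod.stdAddChar (y i * t) + (if t = 0 then -1 else 0) := by
      intro t
      by_cases h : t = 0 <;> simp [sg, h, mul_comm]
    simp_rw [this]
    rw [sum_add_distrib, char_ortho]; simp
  · rw [if_neg hU]
    have hU' : U i = false := by simpa using hU
    rw [hU', sum_eq_single 0]
    · simp [sg]
    · intro t _ ht; simp [sg, ht]
    · simp

theorem coset_id (A : Finset ℕ) (N : ℕ) (T : Finset (Fin r)) (ω β x : ∀ i, ZMod (n i)) (U : Fin r → Bool)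
    (hU : Disjoint (univ.filter (fun i => U i = true)) T) :
    ∑ θ : (∀ i, ZMod (n i)), (∏ i, sg (U i) (decide (θ i = 0))) * coef A N T ω (β + θ) * ch θ x =
      ∑ U' ∈ (univ.filter (fun i => U i = true)).powerset,
        (∏ i ∈ (univ.filter (fun i => U i = true)) \ U', (-1 : ℂ)) *
          coef A N (T ∪ U') (fun i => if i ∈ U' then x i else ω i) β := by
  set Us := univ.filter (fun i => U i = true) with hUs
  have e1 : ∀ θ : (∀ i, ZMod (n i)), (∏ i, sg (U i) (decide (θ i = 0))) * coef A N T ω (β + θ) * ch θ x =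
      ∑ y ∈ AT n A T ω, ((∏ i ∈ T, n i : ℕ) : ℂ) / N * ch (-β) (pt n y) *
        ((∏ i, sg (U i) (decide (θ i = 0))) * ch θ (x - pt n y)) := by
    intro θ
    rw [coef, ← mul_assoc, mul_sum, sum_mul]
    refine sum_congr rfl fun y _ => ?_
    rw [neg_add, ch_add_left, sub_eq_add_neg, ch_add_right, ch_neg_swap θ]; ring
  simp_rw [e1]
  rw [sum_comm]
  simp_rw [← mul_sum, sum_sg_ch, mul_sum]
  rw [sum_comm]
  refine sum_congr rfl fun U' hU' => ?_
  rw [mem_powerset] at hU'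
  have hd : Disjoint T U' := (hU.mono_left hU').symm
  rw [coef, prod_union hd, ← mul_assoc, mul_sum]
  have hAT : AT n A (T ∪ U') (fun i => if i ∈ U' then x i else ω i) =
      (AT n A T ω).filter (fun y => ∀ i ∈ U', (x - pt n y) i = 0) := by
    ext y
    simp only [AT, mem_filter, and_assoc, mem_union, Pi.sub_apply, sub_eq_zero]
    refine and_congr_right fun _ => ⟨fun h => ⟨fun i hi => ?_, fun i hi => ?_⟩, fun h i hi => ?_⟩
    · have := h i (Or.inl hi)
      rwa [if_neg (disjoint_left.mp hd hi)] at this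
    · have := h i (Or.inr hi)
      rw [if_pos hi] at this; exact this.symm
    · by_cases hi' : i ∈ U'
      · rw [if_pos hi']; exact (h.2 i hi').symm
      · rw [if_neg hi']; exact h.1 i (hi.resolve_right hi')
  rw [hAT, sum_filter]
  refine sum_congr rfl fun y _ => ?_
  split_ifs with h
  · rw [prod_congr rfl fun i hi => if_pos (h i hi)]
    push_cast; ring
  · push Not at h
    obtain ⟨i, hi, hne⟩ := h
    rw [prod_eq_zero hi (if_neg hne)]; simp

theorem coset_bound (A : Finset ℕ) (N : ℕ) (T : Finset (Fin r)) (ω β x : ∀ i, ZMod (n i)) (U : Fin r → Bool)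
    (hU : Disjoint (univ.filter (fun i => U i = true)) T) :
    ‖∑ θ : (∀ i, ZMod (n i)), (∏ i, sg (U i) (decide (θ i = 0))) * coef A N T ω (β + θ) * ch θ x‖ ^ 2 ≤
      2 ^ (univ.filter (fun i => U i = true)).card * ∑ U' ∈ (univ.filter (fun i => U i = true)).powerset,
          ‖coef A N (T ∪ U') (fun i => if i ∈ U' then x i else ω i) β‖ ^ 2 := by
  rw [coset_id A N T ω β x U hU]
  have h1 : ‖∑ U' ∈ (univ.filter (fun i => U i = true)).powerset,
        (∏ i ∈ (univ.filter (fun i => U i = true)) \ U', (-1 : ℂ)) *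
          coef A N (T ∪ U') (fun i => if i ∈ U' then x i else ω i) β‖ ≤
      ∑ U' ∈ (univ.filter (fun i => U i = true)).powerset,
          ‖coef A N (T ∪ U') (fun i => if i ∈ U' then x i else ω i) β‖ := by
    refine (norm_sum_le _ _).trans (sum_le_sum fun U' _ => ?_)
    rw [norm_mul, norm_prod]; simp
  refine (pow_le_pow_left₀ (norm_nonneg _) h1 2).trans ?_
  refine sq_sum_le_card_mul_sum_sq.trans_eq ?_
  rw [card_powerset]; push_cast; rfl

/-- weights: support facts -/
theorem wt_prod (B : ℝ) (U : Fin r → Bool) (β : ∀ i, ZMod (n i)) :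
    (∏ i, wt B (U i) (decide (β i = 0))) =
      if Disjoint (sp β) (univ.filter (fun i => U i = true)) then B ^ (sp β).card else 0 := by
  split_ifs with h
  · have : ∀ i, wt B (U i) (decide (β i = 0)) = if β i ≠ 0 then B else 1 := by
      intro i
      by_cases hb : β i = 0
      · simp [wt, hb]
      · have : U i = false := by
          by_contra hc
          exact disjoint_left.mp h (by simp [sp, hb] : i ∈ sp β) (by simpa using hc)
        simp [wt, hb, this]
    simp_rw [this]
    rw [prod_ite]; simp [sp]
  · rw [not_disjoint_iff] at h
    obtain ⟨i, h1, h2⟩ := h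
    simp only [sp, mem_filter, mem_univ, true_and] at h1 h2
    exact prod_eq_zero (mem_univ i) (by simp [wt, h1, h2])

theorem sg_prod (U : Fin r → Bool) (θ : ∀ i, ZMod (n i)) (h : (∏ i, sg (U i) (decide (θ i = 0))) ≠ 0) :
    sp θ = univ.filter (fun i => U i = true) := by
  ext i
  have := prod_ne_zero_iff.mp h i (mem_univ i)
  simp only [sp, mem_filter, mem_univ, true_and]
  by_cases h1 : θ i = 0
  · cases hu : U i <;> simp_all [sg]
  · cases hu : U i <;> simp_all [sg]

theorem sp_add_disj (β θ : ∀ i, ZMod (n i)) (h : Disjoint (sp β) (sp θ)) : sp (β + θ) = sp β ∪ sp θ := by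
  refine (sp_add β θ).antisymm fun i hi => ?_
  simp only [sp, mem_filter, mem_univ, true_and, mem_union, Pi.add_apply] at hi ⊢
  rw [disjoint_left] at h
  have := @h i
  simp only [sp, mem_filter, mem_univ, true_and, not_not] at this
  rcases hi with hi | hi
  · rw [this hi]; simpa
  · by_cases hb : β i = 0
    · simpa [hb]
    · exact absurd (this hb) hi

noncomputable def Vu (B : ℝ) (c : (∀ i, ZMod (n i)) → ℂ) (U : Fin r → Bool) (x : ∀ i, ZMod (n i)) : ℝ :=
  ∑ β : (∀ i, ZMod (n i)), (∏ i, wt B (U i) (decide (β i = 0))) *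
        ‖∑ θ : (∀ i, ZMod (n i)), (∏ i, sg (U i) (decide (θ i = 0))) * c (β + θ) * ch θ x‖ ^ 2

theorem HC1 (m : ℕ) (hm : 1 ≤ m) (c : (∀ i, ZMod (n i)) → ℂ) :
    ∑ x, (‖∑ γ, c γ * ch γ x‖ ^ 2) ^ m ≤
    ∑ U : Fin r → Bool, ((50:ℝ) ^ m) ^ (univ.filter (fun i => U i = true)).card *
      ∑ x, (Vu (50 ^ m) c U x) ^ m := by
  have := HC m hm r n Unit (fun _ => 1) (fun _ => zero_le_one) (fun _ => c)
  simp only [univ_unique, sum_singleton, one_mul] at this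
  refine this.trans_eq (sum_congr rfl fun U _ => ?_)
  rw [prod_ite]
  simp [Vu]

/-- truncated coefficient family -/
noncomputable def cT (A : Finset ℕ) (N : ℕ) (T : Finset (Fin r)) (ω : ∀ i, ZMod (n i)) (j : ℕ) (γ : ∀ i, ZMod (n i)) : ℂ :=
  if γ ∈ lev n T j then coef A N T ω γ else 0

theorem Vu_eq (B : ℝ) (A : Finset ℕ) (N : ℕ) (T : Finset (Fin r)) (ω : ∀ i, ZMod (n i)) (j : ℕ)
    (U : Fin r → Bool) (x : ∀ i, ZMod (n i)) :
    Vu B (cT A N T ω j) U x = if (univ.filter (fun i => U i = true)).card ≤ j ∧ Disjoint (univ.filter (fun i => U i = true)) T then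
      ∑ β ∈ lev n (T ∪ univ.filter (fun i => U i = true)) (j - (univ.filter (fun i => U i = true)).card),
        B ^ (j - (univ.filter (fun i => U i = true)).card) *
        ‖∑ θ : (∀ i, ZMod (n i)), (∏ i, sg (U i) (decide (θ i = 0))) * coef A N T ω (β + θ) * ch θ x‖ ^ 2 else 0 := by
  set Us := univ.filter (fun i => U i = true) with hUs
  have key : ∀ β : (∀ i, ZMod (n i)), Disjoint (sp β) Us →
      ∑ θ : (∀ i, ZMod (n i)), (∏ i, sg (U i) (decide (θ i = 0))) * cT A N T ω j (β + θ) * ch θ x =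
      if (sp β).card + Us.card = j ∧ Disjoint (sp β) T ∧ Disjoint Us T then
        ∑ θ : (∀ i, ZMod (n i)), (∏ i, sg (U i) (decide (θ i = 0))) * coef A N T ω (β + θ) * ch θ x else 0 := by
    intro β hβ
    have h1 : ∀ θ : (∀ i, ZMod (n i)), (∏ i, sg (U i) (decide (θ i = 0))) * cT A N T ω j (β + θ) * ch θ x =
      if (sp β).card + Us.card = j ∧ Disjoint (sp β) T ∧ Disjoint Us T then
        (∏ i, sg (U i) (decide (θ i = 0))) * coef A N T ω (β + θ) * ch θ x else 0 := by
      intro θ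
      by_cases h0 : (∏ i, sg (U i) (decide (θ i = 0))) = 0
      · rw [h0]; simp
      · have h2 := sg_prod U θ h0
        rw [← hUs] at h2
        have h3 := sp_add_disj β θ (by rw [h2]; exact hβ)
        have h4 : (β + θ ∈ lev n T j) ↔ ((sp β).card + Us.card = j ∧ Disjoint (sp β) T ∧ Disjoint Us T) := by
          simp only [lev, mem_filter, mem_univ, true_and, h3, h2, disjoint_union_left]
          rw [card_union_of_disjoint hβ]
        simp only [cT, h4]
        split_ifs <;> simp
    simp_rw [h1]
    split_ifs <;> simp
  unfold Vu
  simp_rw [wt_prod]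
  rw [← hUs]
  have h5 : ∀ β : (∀ i, ZMod (n i)), (if Disjoint (sp β) Us then B ^ (sp β).card else 0) *
      ‖∑ θ : (∀ i, ZMod (n i)), (∏ i, sg (U i) (decide (θ i = 0))) * cT A N T ω j (β + θ) * ch θ x‖ ^ 2 =
      if Disjoint (sp β) Us ∧ (sp β).card + Us.card = j ∧ Disjoint (sp β) T ∧ Disjoint Us T then
       B ^ (j - Us.card) * ‖∑ θ : (∀ i, ZMod (n i)), (∏ i, sg (U i) (decide (θ i = 0))) * coef A N T ω (β + θ) * ch θ x‖ ^ 2 else 0 := by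
    intro β
    by_cases hd : Disjoint (sp β) Us
    · rw [key β hd]
      by_cases hc : (sp β).card + Us.card = j ∧ Disjoint (sp β) T ∧ Disjoint Us T
      · rw [if_pos hd, if_pos hc, if_pos ⟨hd, hc⟩, show (sp β).card = j - Us.card by omega]
      · rw [if_neg hc, if_neg (fun h : Disjoint (sp β) Us ∧ _ => hc h.2)]; simp
    · rw [if_neg hd, zero_mul]
      exact (if_neg (fun h : Disjoint (sp β) Us ∧ _ => hd h.1)).symm
  simp_rw [h5]
  rw [← sum_filter]
  split_ifs with hc
  · refine sum_congr ?_ fun _ _ => rfl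
    ext β
    simp only [lev, mem_filter, mem_univ, true_and, disjoint_union_right]
    constructor
    · rintro ⟨a, b, c, d⟩; exact ⟨by omega, c, a⟩
    · rintro ⟨a, b, c⟩; exact ⟨c, by omega, b, hc.2⟩
  · rw [filter_false_of_mem, sum_empty]
    rintro β _ ⟨a, b, c, d⟩
    exact hc ⟨by omega, d⟩

end
end

section
open Finset

section
variable {r : ℕ} {n : Fin r → ℕ} [∀ i, NeZero (n i)]

def Lprop (n : Fin r → ℕ) [∀ i, NeZero (n i)] (A : Finset ℕ) (N J : ℕ) (σ K : ℝ) (j : ℕ) : Prop :=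
  ∀ (T : Finset (Fin r)) (ω : ∀ i, ZMod (n i)), T.card + j ≤ J →
    ∑ γ ∈ lev n T j, ‖coef A N T ω γ‖ ^ 2 ≤ 4 * σ ^ 2 * K ^ j

theorem Vu_le (B : ℝ) (hB : 1 ≤ B) (K : ℝ) (hK : 1 ≤ K) (A : Finset ℕ) (N J : ℕ) (σ : ℝ) (T : Finset (Fin r)) (ω : ∀ i, ZMod (n i)) (j : ℕ)
    (hTj : T.card + j ≤ J) (ih : ∀ j' < j, Lprop n A N J σ K j')
    (U : Fin r → Bool) (x : ∀ i, ZMod (n i)) :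
    Vu B (cT A N T ω j) U x ≤ if U = (fun _ => false) then B ^ j * ∑ γ ∈ lev n T j, ‖coef A N T ω γ‖ ^ 2
      else if (univ.filter (fun i => U i = true)).card ≤ j then (4 * B) ^ j * (4 * σ ^ 2 * K ^ (j - 1)) else 0 := by
  rw [Vu_eq]
  split_ifs with h1 h2 h3 h3 h2 h3
  · subst h2
    simp only [Bool.false_eq_true, filter_false, card_empty, tsub_zero, union_empty]
    rw [mul_sum]
    refine sum_le_sum fun β _ => ?_
    have := coset_bound A N T ω β x (fun _ => false) (by simp)
    simp only [Bool.false_eq_true, filter_false, card_empty, pow_zero, one_mul, powerset_empty, sum_singleton,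
      union_empty, notMem_empty, if_false] at this
    gcongr
  · set Us := univ.filter (fun i => U i = true) with hUs
    have hne : 1 ≤ Us.card := by
      rw [Nat.one_le_iff_ne_zero, Ne, card_eq_zero]
      intro h0
      apply h2
      funext i
      by_contra hc
      have : i ∈ Us := by simp [hUs]; simpa using hc
      rw [h0] at this; simp at this
    calc _ ≤ ∑ β ∈ lev n (T ∪ Us) (j - Us.card), B ^ (j - Us.card) * (2 ^ Us.card * ∑ U' ∈ Us.powerset,
          ‖coef A N (T ∪ U') (fun i => if i ∈ U' then x i else ω i) β‖ ^ 2) := by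
          refine sum_le_sum fun β _ => ?_
          gcongr
          exact coset_bound A N T ω β x U h1.2
      _ = B ^ (j - Us.card) * 2 ^ Us.card * ∑ U' ∈ Us.powerset, ∑ β ∈ lev n (T ∪ Us) (j - Us.card),
          ‖coef A N (T ∪ U') (fun i => if i ∈ U' then x i else ω i) β‖ ^ 2 := by
          rw [sum_comm, mul_sum]
          refine sum_congr rfl fun β _ => ?_
          ring
      _ ≤ B ^ (j - Us.card) * 2 ^ Us.card * ∑ U' ∈ Us.powerset, (4 * σ ^ 2 * K ^ (j - Us.card)) := by
          gcongr with U' hU'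
          rw [mem_powerset] at hU'
          refine le_trans ?_ (ih (j - Us.card) (by omega) (T ∪ U') (fun i => if i ∈ U' then x i else ω i) ?_)
          · refine sum_le_sum_of_subset_of_nonneg (fun β hβ => ?_) fun _ _ _ => by positivity
            simp only [lev, mem_filter, mem_univ, true_and] at hβ ⊢
            exact ⟨hβ.1, hβ.2.mono_right (union_subset_union_right hU')⟩
          · have := card_union_le T U'
            have := card_le_card hU'
            omega
      _ = B ^ (j - Us.card) * 4 ^ Us.card * (4 * σ ^ 2 * K ^ (j - Us.card)) := by
          rw [sum_const, card_powerset, nsmul_eq_mul]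
          have : (4:ℝ) ^ Us.card = 2 ^ Us.card * 2 ^ Us.card := by rw [← mul_pow]; norm_num
          rw [this]; push_cast; ring
      _ ≤ B ^ j * 4 ^ j * (4 * σ ^ 2 * K ^ (j - 1)) := by
          have g1 : B ^ (j - Us.card) ≤ B ^ j := pow_le_pow_right₀ hB (by omega)
          have g2 : (4:ℝ) ^ Us.card ≤ 4 ^ j := pow_le_pow_right₀ (by norm_num) h3
          have g3 : K ^ (j - Us.card) ≤ K ^ (j - 1) := pow_le_pow_right₀ hK (by omega)
          gcongr
      _ = _ := by rw [mul_pow]; ring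
  · exact absurd h1.1 h3
  all_goals positivity

theorem card_lev (Q0 X : ℕ) (hQ1 : 1 ≤ Q0) (hQ : ∀ i, n i ≤ Q0) (hX : (r + 1) * Q0 ≤ X) (T : Finset (Fin r)) (j : ℕ) :
    ((lev n T j).card : ℝ) ≤ 3 * X ^ j := by
  have h1 := cnt_sp (α := fun i => ZMod (n i)) (fun _ => 0) Q0 hQ1 (fun i => by rw [ZMod.card]; exact hQ i) j
  have h2 : lev n T j ⊆ univ.filter (fun f : ∀ i, ZMod (n i) => (univ.filter (fun i => f i ≠ 0)).card ≤ j) := by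
    intro γ hγ
    simp only [lev, mem_filter, mem_univ, true_and] at hγ ⊢
    exact hγ.1.le
  calc ((lev n T j).card : ℝ) ≤ _ := by exact_mod_cast card_le_card h2
    _ ≤ _ := h1
    _ ≤ _ := by gcongr

theorem card_U (Q0 X : ℕ) (hQ1 : 2 ≤ Q0) (hX : (r + 1) * Q0 ≤ X) (j : ℕ) :
    ((univ.filter (fun U : Fin r → Bool => (univ.filter (fun i => U i = true)).card ≤ j)).card : ℝ) ≤ 3 * X ^ j := by
  have h1 := cnt_sp (α := fun _ : Fin r => Bool) (fun _ => false) Q0 (by omega) (fun i => by simpa using hQ1) j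
  simp only [ne_eq, Bool.not_eq_false] at h1
  refine h1.trans ?_
  gcongr

theorem F_moment (m : ℕ) (hm : 1 ≤ m) (Q0 X : ℕ) (hQ1 : 2 ≤ Q0) (hX : (r + 1) * Q0 ≤ X)
    (K : ℝ) (hK : 1 ≤ K) (A : Finset ℕ) (N J : ℕ) (σ : ℝ) (T : Finset (Fin r)) (ω : ∀ i, ZMod (n i)) (j : ℕ)
    (hTj : T.card + j ≤ J) (ih : ∀ j' < j, Lprop n A N J σ K j') :
    ∑ x, (‖∑ γ, cT A N T ω j γ * ch γ x‖ ^ 2) ^ m ≤ (∏ i, n i : ℕ) *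
      (((50 ^ m) ^ j * ∑ γ ∈ lev n T j, ‖coef A N T ω γ‖ ^ 2) ^ m +
        3 * X ^ j * (50 ^ m) ^ j * ((4 * 50 ^ m) ^ j * (4 * σ ^ 2 * K ^ (j - 1))) ^ m) := by
  set V := ∑ γ ∈ lev n T j, ‖coef A N T ω γ‖ ^ 2 with hV
  have hV0 : 0 ≤ V := sum_nonneg fun _ _ => by positivity
  set B : ℝ := 50 ^ m with hB
  have hB1 : 1 ≤ B := one_le_pow₀ (by norm_num)
  set Z := (4 * B) ^ j * (4 * σ ^ 2 * K ^ (j - 1)) with hZ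
  have hZ0 : 0 ≤ Z := by positivity
  have hcard : (Fintype.card (∀ i, ZMod (n i)) : ℝ) = (∏ i, n i : ℕ) := by
    rw [Fintype.card_pi]; simp [ZMod.card]
  refine (HC1 m hm _).trans ?_
  have h1 : ∀ U : Fin r → Bool, B ^ (univ.filter (fun i => U i = true)).card * ∑ x, (Vu B (cT A N T ω j) U x) ^ m ≤
      (if U = (fun _ => false) then (∏ i, n i : ℕ) * (B ^ j * V) ^ m else 0) +
      (if (univ.filter (fun i => U i = true)).card ≤ j then B ^ j * ((∏ i, n i : ℕ) * Z ^ m) else 0) := by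
    intro U
    have hnn : ∀ x, 0 ≤ Vu B (cT A N T ω j) U x := by
      intro x
      unfold Vu
      refine sum_nonneg fun β _ => mul_nonneg (prod_nonneg fun i _ => ?_) (by positivity)
      unfold wt; split_ifs <;> linarith
    have hle := fun x => pow_le_pow_left₀ (hnn x) (Vu_le B hB1 K hK A N J σ T ω j hTj ih U x) m
    have h2 := sum_le_sum (s := univ) fun x (_ : x ∈ univ) => hle x
    rw [sum_const, card_univ, nsmul_eq_mul, hcard] at h2
    by_cases hU : U = (fun _ => false)
    · rw [if_pos hU]
      refine le_add_of_le_of_nonneg ?_ (by split_ifs <;> positivity)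
      rw [if_pos hU] at h2
      subst hU
      simpa using h2
    · rw [if_neg hU, zero_add]
      rw [if_neg hU] at h2
      split_ifs at h2 ⊢ with hj
      · have g1 := pow_le_pow_right₀ hB1 hj
        have g2 : 0 ≤ ∑ x, Vu B (cT A N T ω j) U x ^ m := sum_nonneg fun x _ => pow_nonneg (hnn x) m
        gcongr
      · rw [zero_pow (by omega), mul_zero] at h2
        exact mul_nonpos_of_nonneg_of_nonpos (by positivity) h2
  refine (sum_le_sum fun U _ => h1 U).trans ?_
  rw [sum_add_distrib, sum_ite_eq' univ, if_pos (mem_univ _), ← sum_filter, sum_const, nsmul_eq_mul, mul_add]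
  refine add_le_add le_rfl ?_
  calc _ ≤ 3 * X ^ j * (B ^ j * ((∏ i, n i : ℕ) * Z ^ m)) := by
        have g1 := card_U (r := r) Q0 X hQ1 hX j
        gcongr
    _ = _ := by ring

theorem F_transfer (hco : ∀ i j, i ≠ j → (n i).Coprime (n j)) (m : ℕ) (Q0 : ℕ) (hQ1 : 1 ≤ Q0) (hQ : ∀ i, n i ≤ Q0)
    (c : (∀ i, ZMod (n i)) → ℂ) (j : ℕ) (R : ℝ) (hR : 0 ≤ R) (hc : ∀ γ, c γ ≠ 0 → (sp γ).card ≤ j) (hcR : ∑ γ, ‖c γ‖ ≤ R)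
    (N : ℕ) (E : ℝ) (hE : ∑ x, (‖∑ γ, c γ * ch γ x‖ ^ 2) ^ m ≤ (∏ i, n i : ℕ) * E) :
    ∑ x ∈ range N, (‖∑ γ, c γ * ch γ (pt n x)‖ ^ 2) ^ m ≤ N * E + (R * R) ^ m * Q0 ^ ((j + j) * m) := by
  have hTP : TP j R (fun x => ∑ γ, c γ * ch γ x) := ⟨c, fun _ => rfl, hc, hcR⟩
  have h1 := ((hTP.mul hR hTP.conj).pow (by positivity) m).transfer hco hQ hQ1 N
  have e1 : ∀ x : (∀ i, ZMod (n i)), ((∑ γ, c γ * ch γ x) * (starRingEnd ℂ) (∑ γ, c γ * ch γ x)) ^ m =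
      (((‖∑ γ, c γ * ch γ x‖ ^ 2) ^ m : ℝ) : ℂ) := by
    intro x
    rw [Complex.mul_conj']; push_cast; rfl
  simp only [e1] at h1
  have hpn : (0:ℝ) < (∏ i, n i : ℕ) := by
    exact_mod_cast (prod_pos fun i _ => Nat.pos_of_neZero (n i))
  have e2 : ∀ a b : ℝ, (((a : ℝ) : ℂ) - N * ((∏ i, n i : ℕ) : ℂ)⁻¹ * ((b : ℝ) : ℂ)) =
      ((a - N * ((∏ i, n i : ℕ) : ℝ)⁻¹ * b : ℝ) : ℂ) := by intro a b; push_cast; rfl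
  rw [← Complex.ofReal_sum, ← Complex.ofReal_sum, e2, Complex.norm_real, Real.norm_eq_abs] at h1
  have h2 := (abs_le.mp h1).2
  have h3 : N * ((∏ i, n i : ℕ) : ℝ)⁻¹ * ∑ x, (‖∑ γ, c γ * ch γ x‖ ^ 2) ^ m ≤ N * E := by
    rw [mul_assoc]
    gcongr
    rw [inv_mul_le_iff₀ hpn]; exact hE
  linarith

theorem final_ineq (m j J : ℕ) (hm : 1 ≤ m) (hj : 1 ≤ j) (hjJ : j ≤ J) (X B K σ v e : ℝ) (hX : 1 ≤ X) (hB : 1 ≤ B)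
    (hσ : 0 < σ) (hK1 : 4 * B ≤ K) (hKm : 5 * X ^ (2 * J) * B ^ J * (4 * B) ^ m ≤ 2 * σ * K ^ m) (he : e ≤ 1)
    (hv : K ^ j < v)
    (h : v ^ m * v ^ m * (2 * σ) ≤ X ^ J * ((B ^ j * v) ^ m + 3 * X ^ j * B ^ j * ((4 * B) ^ j * K ^ (j - 1)) ^ m + e)) :
    False := by
  have hB4 : 1 ≤ 4 * B := by linarith
  have hK0 : 1 ≤ K := by linarith
  have hKj : 1 ≤ K ^ j := one_le_pow₀ hK0
  have hv1 : 1 < v := by linarith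
  have hvm : 1 ≤ v ^ m := one_le_pow₀ hv1.le
  have a1 : (B ^ j * v) ^ m ≤ ((4 * B) ^ j) ^ m * v ^ m := by
    rw [mul_pow]; gcongr; linarith
  have a2 : ((4 * B) ^ j * K ^ (j - 1)) ^ m ≤ ((4 * B) ^ j) ^ m * v ^ m := by
    rw [mul_pow]; gcongr
    exact (pow_le_pow_right₀ hK0 (by omega)).trans hv.le
  have a3 : e ≤ ((4 * B) ^ j) ^ m * v ^ m := he.trans
    (one_le_mul_of_one_le_of_one_le (one_le_pow₀ (one_le_pow₀ hB4)) hvm)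
  have hXB : 1 ≤ X ^ J * B ^ J := one_le_mul_of_one_le_of_one_le (one_le_pow₀ hX) (one_le_pow₀ hB)
  set W := ((4 * B) ^ j) ^ m * v ^ m with hW
  have hW0 : 0 < W := by positivity
  have b1 : X ^ J * ((B ^ j * v) ^ m + 3 * X ^ j * B ^ j * ((4 * B) ^ j * K ^ (j - 1)) ^ m + e) ≤
      X ^ J * (5 * (X ^ J * B ^ J) * W) := by
    gcongr
    have : 3 * X ^ j * B ^ j * ((4 * B) ^ j * K ^ (j - 1)) ^ m ≤ 3 * (X ^ J * B ^ J) * W := by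
      have g1 := pow_le_pow_right₀ hX hjJ
      have g2 := pow_le_pow_right₀ hB hjJ
      rw [mul_assoc 3]; gcongr
    nlinarith
  have b2 := h.trans b1
  have b3 : v ^ m * (2 * σ) ≤ 5 * X ^ (2 * J) * B ^ J * ((4 * B) ^ j) ^ m := by
    have h0 : 0 < v ^ m := by positivity
    refine le_of_mul_le_mul_left ?_ h0
    calc v ^ m * (v ^ m * (2 * σ)) = v ^ m * v ^ m * (2 * σ) := by ring
      _ ≤ _ := b2
      _ = _ := by rw [hW, two_mul, pow_add]; ring
  have b4 : (K ^ j) ^ m < v ^ m := by gcongr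
  have b5 : 5 * X ^ (2 * J) * B ^ J * ((4 * B) ^ j) ^ m ≤ 2 * σ * (K ^ j) ^ m := by
    obtain ⟨l, rfl⟩ : ∃ l, j = l + 1 := ⟨j - 1, by omega⟩
    calc 5 * X ^ (2 * J) * B ^ J * ((4 * B) ^ (l + 1)) ^ m = 5 * X ^ (2 * J) * B ^ J * (4 * B) ^ m * ((4 * B) ^ l) ^ m := by
          rw [pow_succ, mul_pow]; ring
      _ ≤ 2 * σ * K ^ m * (K ^ l) ^ m := by gcongr
      _ = _ := by rw [pow_succ, mul_pow]; ring
  nlinarith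

theorem levelJ (hco : ∀ i j, i ≠ j → (n i).Coprime (n j)) (m : ℕ) (hm : 1 ≤ m) (Q0 X J : ℕ) (hQ1 : 2 ≤ Q0)
    (hQ : ∀ i, n i ≤ Q0) (hX : (r + 1) * Q0 ≤ X) (K σ : ℝ) (hσ : 0 < σ) (A : Finset ℕ) (N : ℕ) (hN0 : 0 < N)
    (hA : A ⊆ range N)
    (hglob : ∀ (T : Finset (Fin r)) (ω : ∀ i, ZMod (n i)), T.card ≤ J →
      ((AT n A T ω).card : ℝ) * (∏ i ∈ T, n i : ℕ) ≤ 2 * σ * N)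
    (hK1 : 4 * 50 ^ m ≤ K) (hKm : 5 * (X:ℝ) ^ (2 * J) * (50 ^ m) ^ J * (4 * 50 ^ m) ^ m ≤ 2 * σ * K ^ m)
    (hN : (9:ℝ) ^ m * X ^ (4 * J * m) ≤ N) (j : ℕ) : Lprop n A N J σ K j := by
  have hN0' : (0:ℝ) < N := by exact_mod_cast hN0
  have hB1 : (1:ℝ) ≤ 50 ^ m := one_le_pow₀ (by norm_num)
  have hK0 : 1 ≤ K := by linarith
  have hQX : Q0 ≤ X := le_trans (Nat.le_mul_of_pos_left Q0 (by omega)) hX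
  have hX1 : (1:ℝ) ≤ X := by exact_mod_cast (by omega : 1 ≤ X)
  have hcoef : ∀ (T : Finset (Fin r)) (ω γ : ∀ i, ZMod (n i)), T.card ≤ J → ‖coef A N T ω γ‖ ≤ 2 * σ := by
    intro T ω γ hT
    rw [coef, norm_mul]
    have h1 : ‖∑ x ∈ AT n A T ω, ch (-γ) (pt n x)‖ ≤ (AT n A T ω).card := by
      refine (norm_sum_le _ _).trans ?_
      simp [ch_norm]
    have h2 := hglob T ω hT
    rw [norm_div, Complex.norm_natCast, Complex.norm_natCast]
    calc _ ≤ ((∏ i ∈ T, n i : ℕ) : ℝ) / N * (AT n A T ω).card := by gcongr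
      _ = ((AT n A T ω).card : ℝ) * (∏ i ∈ T, n i : ℕ) / N := by ring
      _ ≤ _ := by rw [div_le_iff₀ hN0']; exact h2
  induction j using Nat.strong_induction_on with
  | _ j ih =>
  intro T ω hTj
  rcases Nat.eq_zero_or_pos j with hj | hj
  · subst hj
    have h1 : lev n T 0 ⊆ {0} := by
      intro γ hγ
      simp only [lev, mem_filter, mem_univ, true_and, card_eq_zero] at hγ
      rw [mem_singleton]
      funext i
      by_contra hc
      have : i ∈ sp γ := by simp [sp]; exact hc
      rw [hγ.1] at this; simp at this
    refine (sum_le_sum_of_subset_of_nonneg h1 fun _ _ _ => by positivity).trans ?_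
    rw [sum_singleton, pow_zero, mul_one]
    calc _ ≤ (2 * σ) ^ 2 := by gcongr; exact hcoef T ω 0 (by omega)
      _ = _ := by ring
  by_contra hcon
  push Not at hcon
  set V := ∑ γ ∈ lev n T j, ‖coef A N T ω γ‖ ^ 2 with hV
  set c := cT A N T ω j with hc
  have hVc : (V : ℂ) = ((∏ i ∈ T, n i : ℕ) : ℂ) / N * ∑ x ∈ AT n A T ω, ∑ γ, c γ * ch γ (pt n x) := by
    rw [sum_comm, mul_sum, hV]
    push_cast
    rw [← sum_filter_add_sum_filter_not univ (fun γ => γ ∈ lev n T j), filter_mem_eq_inter, univ_inter]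
    rw [sum_eq_zero (s := filter (fun γ => γ ∉ lev n T j) univ) (fun γ hγ => by
      simp only [mem_filter, mem_univ, true_and] at hγ
      simp [hc, cT, hγ]), add_zero]
    refine sum_congr rfl fun γ hγ => ?_
    rw [← Complex.mul_conj']
    have : c γ = coef A N T ω γ := by simp [hc, cT, hγ]
    rw [this, ← mul_sum]
    conv_lhs => rw [coef.eq_def (γ := γ)]
    rw [coef.eq_def]
    simp only [map_mul, map_div₀, map_natCast, map_sum, ch_conj, neg_neg]
    push_cast
    ring
  have hV0 : 0 ≤ V := sum_nonneg fun _ _ => by positivity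
  set S := AT n A T ω with hS
  set qT : ℕ := ∏ i ∈ T, n i with hqT
  have hVle : V ≤ qT / N * ∑ x ∈ S, ‖∑ γ, c γ * ch γ (pt n x)‖ := by
    have h1 : ‖(V : ℂ)‖ = V := by rw [Complex.norm_real, Real.norm_eq_abs, abs_of_nonneg hV0]
    rw [← h1, hVc, norm_mul, norm_div, Complex.norm_natCast, Complex.norm_natCast]
    gcongr
    exact norm_sum_le _ _
  have hScard := hglob T ω (by omega)
  rw [← hS, ← hqT] at hScard
  have hqT0 : (0:ℝ) < qT := by exact_mod_cast prod_pos fun i _ => Nat.pos_of_neZero (n i)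
  -- power mean
  have hpm : (∑ x ∈ S, ‖∑ γ, c γ * ch γ (pt n x)‖) ^ (2 * m) ≤ (S.card : ℝ) ^ (2 * m - 1) *
      ∑ x ∈ range N, (‖∑ γ, c γ * ch γ (pt n x)‖ ^ 2) ^ m := by
    obtain ⟨l, hl⟩ : ∃ l, 2 * m = l + 1 := ⟨2 * m - 1, by omega⟩
    have h2 : (∑ x ∈ S, ‖∑ γ, c γ * ch γ (pt n x)‖) ^ (l + 1) ≤ (S.card : ℝ) ^ l *
        ∑ x ∈ S, ‖∑ γ, c γ * ch γ (pt n x)‖ ^ (l + 1) := by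
      rcases S.eq_empty_or_nonempty with h0 | h0
      · rw [h0]; simp
      · have := pow_sum_div_card_le_sum_pow (s := S) (f := fun x => ‖∑ γ, c γ * ch γ (pt n x)‖) (fun _ _ => norm_nonneg _) l
        rw [div_le_iff₀ (by have := h0.card_pos; positivity)] at this
        rw [mul_comm]; exact this
    simp_rw [← pow_mul]
    rw [hl, Nat.add_sub_cancel]
    refine h2.trans ?_
    gcongr
    exact (filter_subset _ _).trans hA
  -- moment
  have hmom := F_moment m hm Q0 X hQ1 hX K hK0 A N J σ T ω j hTj ih
  rw [← hV, ← hc] at hmom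
  have hcs : ∀ γ, c γ ≠ 0 → (sp γ).card ≤ j := by
    intro γ hγ
    have : γ ∈ lev n T j := by by_contra h0; exact hγ (by simp [hc, cT, h0])
    simp only [lev, mem_filter] at this
    exact this.2.1.le
  have hcR : ∑ γ, ‖c γ‖ ≤ 3 * X ^ j * (2 * σ) := by
    have : ∀ γ, ‖c γ‖ ≤ if γ ∈ lev n T j then 2 * σ else 0 := by
      intro γ
      simp only [hc, cT]
      split_ifs
      · exact hcoef T ω γ (by omega)
      · simp
    refine (sum_le_sum fun γ _ => this γ).trans ?_
    rw [← sum_filter, filter_mem_eq_inter, univ_inter, sum_const, nsmul_eq_mul]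
    gcongr
    exact card_lev Q0 X (by omega) hQ hX T j
  have htr := F_transfer hco m Q0 (by omega) hQ c j _ (by positivity) hcs hcR N _ hmom
  set M := ∑ x ∈ range N, (‖∑ γ, c γ * ch γ (pt n x)‖ ^ 2) ^ m with hM
  have hM0 : 0 ≤ M := sum_nonneg fun _ _ => by positivity
  have hmain : V ^ (2 * m) * (2 * σ) ≤ qT * (2 * σ) ^ (2 * m) * (M / N) := by
    obtain ⟨l, hl⟩ : ∃ l, 2 * m = l + 1 := ⟨2 * m - 1, by omega⟩
    have hSc : (S.card : ℝ) ≤ 2 * σ * N / qT := by rw [le_div_iff₀ hqT0]; exact hScard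
    calc V ^ (2 * m) * (2 * σ) ≤ (qT / N * ∑ x ∈ S, ‖∑ γ, c γ * ch γ (pt n x)‖) ^ (2 * m) * (2 * σ) := by gcongr
      _ = (qT / N) ^ (2 * m) * (∑ x ∈ S, ‖∑ γ, c γ * ch γ (pt n x)‖) ^ (2 * m) * (2 * σ) := by rw [mul_pow]
      _ ≤ (qT / N) ^ (2 * m) * ((2 * σ * N / qT) ^ (2 * m - 1) * M) * (2 * σ) := by
          gcongr
          refine hpm.trans ?_
          gcongr
      _ = qT * (2 * σ) ^ (2 * m) * (M / N) := by
          rw [hl, Nat.add_sub_cancel, div_pow, div_pow, mul_pow]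
          field_simp
          ring
  set v := V / (4 * σ ^ 2) with hv
  have hVv : V = 4 * σ ^ 2 * v := by rw [hv]; field_simp
  refine final_ineq m j J hm hj (by omega) X (50 ^ m) K σ v ((9:ℝ) ^ m * X ^ (4 * J * m) / N) hX1 hB1 hσ hK1 hKm
    (by rw [div_le_one hN0']; exact hN) ?_ ?_
  · rw [hv, lt_div_iff₀ (by positivity)]; linarith
  · have hqTX : (qT : ℝ) ≤ X ^ J := by
      have : qT ≤ X ^ J := by
        refine (prod_le_pow_card T n X fun i _ => (hQ i).trans hQX).trans (Nat.pow_le_pow_right (by omega) (by omega))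
      exact_mod_cast this
    have hMN : M / N ≤ (4 * σ ^ 2) ^ m * (((50 ^ m) ^ j * v) ^ m + 3 * X ^ j * (50 ^ m) ^ j * ((4 * 50 ^ m) ^ j * K ^ (j - 1)) ^ m +
        (9:ℝ) ^ m * X ^ (4 * J * m) / N) := by
      rw [div_le_iff₀ hN0']
      refine htr.trans ?_
      have h5 : (3 * (X:ℝ) ^ j * (2 * σ) * (3 * X ^ j * (2 * σ))) ^ m * Q0 ^ ((j + j) * m) ≤ (4 * σ ^ 2) ^ m * ((9:ℝ) ^ m * X ^ (4 * J * m)) := by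
        calc _ ≤ (3 * (X:ℝ) ^ j * (2 * σ) * (3 * X ^ j * (2 * σ))) ^ m * X ^ ((j + j) * m) := by gcongr
          _ = (4 * σ ^ 2) ^ m * (9 ^ m * X ^ (4 * j * m)) := by
              have : 3 * (X:ℝ) ^ j * (2 * σ) * (3 * X ^ j * (2 * σ)) = (4 * σ ^ 2) * 9 * X ^ (j + j) := by ring
              rw [this, mul_pow, mul_pow, ← pow_mul, show 4 * j * m = (j + j) * m + (j + j) * m by ring, pow_add]; ring
          _ ≤ _ := by
              have g1 : (X:ℝ) ^ (4 * j * m) ≤ X ^ (4 * J * m) :=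
                pow_le_pow_right₀ hX1 (Nat.mul_le_mul_right _ (by omega))
              gcongr
      refine (add_le_add_right h5 _).trans (le_of_eq ?_)
      rw [hVv]
      have e1 : (50 ^ m) ^ j * (4 * σ ^ 2 * v) = 4 * σ ^ 2 * ((50 ^ m) ^ j * v) := by ring
      have e2 : (4 * 50 ^ m) ^ j * (4 * σ ^ 2 * K ^ (j - 1)) = 4 * σ ^ 2 * ((4 * 50 ^ m) ^ j * K ^ (j - 1)) := by ring
      rw [e1, e2, mul_pow (4 * σ ^ 2), mul_pow (4 * σ ^ 2)]
      field_simp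
    set R := ((50 ^ m) ^ j * v) ^ m + 3 * X ^ j * (50 ^ m) ^ j * ((4 * 50 ^ m) ^ j * K ^ (j - 1)) ^ m +
        (9:ℝ) ^ m * X ^ (4 * J * m) / N with hR
    have hv0 : 0 ≤ v := by positivity
    have hR0 : 0 ≤ R := by positivity
    have hs : (0:ℝ) < (4 * σ ^ 2) ^ m * (4 * σ ^ 2) ^ m := by positivity
    refine le_of_mul_le_mul_left ?_ hs
    calc (4 * σ ^ 2) ^ m * (4 * σ ^ 2) ^ m * (v ^ m * v ^ m * (2 * σ)) = V ^ (2 * m) * (2 * σ) := by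
          rw [hVv, two_mul m, pow_add, mul_pow (4 * σ ^ 2)]; ring
      _ ≤ _ := hmain
      _ ≤ X ^ J * (2 * σ) ^ (2 * m) * ((4 * σ ^ 2) ^ m * R) := by gcongr
      _ = _ := by
          rw [pow_mul, show (2 * σ) ^ 2 = 4 * σ ^ 2 by ring]; ring

end
end

section
open Finset

theorem e_eq_one {x : ℝ} (h : e x = 1) : ∃ m : ℤ, x = m := by
  have h1 := e_sub_one_ge x
  rw [h, sub_self, norm_zero] at h1
  refine ⟨round x, ?_⟩
  have : |x - round x| = 0 := le_antisymm (by linarith) (abs_nonneg _)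
  linarith [abs_eq_zero.mp this]

theorem e_ortho (M : ℕ) (hM : 0 < M) (m : ℤ) :
    ∑ r ∈ range M, e ((m : ℝ) * ((r : ℝ) / M)) = if (M : ℤ) ∣ m then (M : ℂ) else 0 := by
  have hM' : (M : ℝ) ≠ 0 := by positivity
  have h1 : ∀ r ∈ range M, e ((m : ℝ) * ((r : ℝ) / M)) = e ((m : ℝ) / M) ^ r := by
    intro r _
    rw [← e_nat_mul]; congr 1; ring
  rw [sum_congr rfl h1]
  split_ifs with h
  · obtain ⟨c, rfl⟩ := h
    have : e (((M * c : ℤ) : ℝ) / M) = 1 := by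
      rw [← e_int c]; congr 1; push_cast; field_simp
    rw [this]; simp
  · have hne : e ((m : ℝ) / M) ≠ 1 := by
      intro h0
      obtain ⟨c, hc⟩ := e_eq_one h0
      apply h
      refine ⟨c, ?_⟩
      rw [div_eq_iff hM'] at hc
      have : (m : ℝ) = ((M * c : ℤ) : ℝ) := by push_cast; linarith
      exact_mod_cast this
    rw [geom_sum_eq hne, ← e_nat_mul, mul_div_cancel₀ _ hM', e_int, sub_self, zero_div]

theorem dft_corr (M : ℕ) (hM : 0 < M) (s : Finset ℕ) (f : ℕ → ℂ) (h : ℤ) :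
    ∑ r ∈ range M, ((‖∑ x ∈ s, f x * e (x * ((r : ℝ) / M))‖ ^ 2 : ℝ) : ℂ) * e (h * ((r : ℝ) / M)) =
      M * ∑ x ∈ s, ∑ y ∈ s, f x * (starRingEnd ℂ) (f y) * (if (M : ℤ) ∣ x - y + h then 1 else 0) := by
  have h1 : ∀ r ∈ range M, ((‖∑ x ∈ s, f x * e (x * ((r : ℝ) / M))‖ ^ 2 : ℝ) : ℂ) * e (h * ((r : ℝ) / M)) =
      ∑ x ∈ s, ∑ y ∈ s, f x * (starRingEnd ℂ) (f y) * e (((x - y + h : ℤ) : ℝ) * ((r : ℝ) / M)) := by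
    intro r _
    push_cast
    rw [← Complex.mul_conj', map_sum, sum_mul_sum, sum_mul]
    refine sum_congr rfl fun x _ => ?_
    rw [sum_mul]
    refine sum_congr rfl fun y _ => ?_
    rw [map_mul, add_mul, sub_mul, e_add, e_sub]; ring
  rw [sum_congr rfl h1, sum_comm, mul_sum]
  refine sum_congr rfl fun x _ => ?_
  rw [sum_comm, mul_sum]
  refine sum_congr rfl fun y _ => ?_
  rw [← mul_sum, e_ortho M hM]
  split_ifs <;> ring

theorem dft_parseval (M : ℕ) (hM : 0 < M) (s : Finset ℕ) (hs : s ⊆ range M) (f : ℕ → ℂ) :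
    ∑ r ∈ range M, ‖∑ x ∈ s, f x * e (x * ((r : ℝ) / M))‖ ^ 2 = M * ∑ x ∈ s, ‖f x‖ ^ 2 := by
  have h1 := dft_corr M hM s f 0
  simp only [Int.cast_zero, zero_mul, e_zero, mul_one, add_zero] at h1
  have h2 : ∀ x ∈ s, ∑ y ∈ s, f x * (starRingEnd ℂ) (f y) * (if (M : ℤ) ∣ x - y then 1 else 0) = ((‖f x‖ ^ 2 : ℝ) : ℂ) := by
    intro x hx
    rw [sum_eq_single x]
    · simp [Complex.mul_conj']
    · intro y hy hyx
      rw [if_neg, mul_zero]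
      intro hd
      have a1 := mem_range.mp (hs hx)
      have a2 := mem_range.mp (hs hy)
      have := Int.eq_zero_of_abs_lt_dvd hd (by rw [abs_lt]; constructor <;> omega)
      omega
    · intro h; exact absurd hx h
  rw [sum_congr rfl h2] at h1
  exact_mod_cast h1

/-- The counting step. -/
theorem count_step (N N1 n1 k : ℕ) (hN : 0 < N) (hN1 : N1 ≤ N) (hn1 : 0 < n1) (A : Finset ℕ) (hA : A ⊆ Ioc N1 (N1 + N))
    (σ : ℝ) (hσ0 : 0 < σ) (hσ : σ * N = A.card) (hh : ℕ → ℤ) (hb : ∀ n < n1, |(hh n : ℝ)| ≤ σ * N / 8)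
    (hfree : ∀ a ∈ A, ∀ b ∈ A, a ≠ b → ∀ n, (a : ℤ) - b ≠ hh n)
    (hz : ((range n1).filter (fun n => hh n = 0)).card ≤ k) (hk : 8 * k ≤ σ * n1) :
    3 / 8 * ((3 * N : ℕ) : ℝ) * σ * A.card ≤ ∑ r ∈ (range (3 * N)).filter (fun r : ℕ => σ / 4 * n1 ≤
        ‖∑ n ∈ range n1, e (hh n * ((r : ℝ) / (3 * N : ℕ)))‖),
      ‖∑ x ∈ Ioc N1 (N1 + N), (((if x ∈ A then 1 else 0) - σ : ℝ) : ℂ) * e (x * ((r : ℝ) / (3 * N : ℕ)))‖ ^ 2 *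
        (‖∑ n ∈ range n1, e (hh n * ((r : ℝ) / (3 * N : ℕ)))‖ / n1) := by
  set M := 3 * N with hM
  have hM0 : 0 < M := by omega
  set I := Ioc N1 (N1 + N) with hI
  set g : ℕ → ℝ := fun x => (if x ∈ A then 1 else 0) - σ with hg
  set F : ℕ → ℝ := fun r => ‖∑ x ∈ I, (g x : ℂ) * e (x * ((r : ℝ) / M))‖ ^ 2 with hF
  set S : ℕ → ℂ := fun r => ∑ n ∈ range n1, e (hh n * ((r : ℝ) / M)) with hS
  have hF0 : ∀ r, 0 ≤ F r := fun r => by positivity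
  have hAN : A.card ≤ N := by have := card_le_card hA; simpa [hI] using this
  have hNr : (0:ℝ) < N := by exact_mod_cast hN
  have hn1r : (0:ℝ) < n1 := by exact_mod_cast hn1
  have hσ1 : σ ≤ 1 := by
    have : (A.card : ℝ) ≤ N := by exact_mod_cast hAN
    rw [← hσ] at this
    exact le_of_mul_le_mul_right (by linarith) hNr
  have hcI : (I.card : ℝ) = N := by simp [hI]
  have hAI : ∑ x ∈ I, (if x ∈ A then (1:ℝ) else 0) = A.card := by
    rw [← sum_filter, filter_mem_eq_inter, inter_eq_right.mpr hA]; simp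
  -- Parseval
  have hpar : ∑ r ∈ range M, F r ≤ M * A.card := by
    have h1 := dft_parseval M hM0 I (fun x hx => by simp [hI] at hx ⊢; omega) (fun x => (g x : ℂ))
    rw [hF, h1]
    gcongr
    have h2 : ∀ x ∈ I, ‖((g x : ℝ) : ℂ)‖ ^ 2 = (1 - 2 * σ) * (if x ∈ A then (1:ℝ) else 0) + σ ^ 2 := by
      intro x _
      rw [Complex.norm_real, Real.norm_eq_abs, sq_abs, hg]
      dsimp only
      split_ifs <;> ring
    rw [sum_congr rfl h2, sum_add_distrib, ← mul_sum, hAI, sum_const, nsmul_eq_mul, hcI, ← hσ]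
    have : 0 ≤ σ * N * σ := by positivity
    nlinarith
  -- correlation
  have hcorr : ∀ n < n1, ((∑ r ∈ range M, (F r : ℂ) * e (hh n * ((r : ℝ) / M)))) =
      ((M * ∑ x ∈ I, ∑ y ∈ I, g x * g y * (if (y : ℤ) = x + hh n then 1 else 0) : ℝ) : ℂ) := by
    intro n hn
    have h1 := dft_corr M hM0 I (fun x => (g x : ℂ)) (hh n)
    rw [hF]
    dsimp only
    rw [h1]
    push_cast
    congr 1
    refine sum_congr rfl fun x hx => sum_congr rfl fun y hy => ?_
    rw [Complex.conj_ofReal]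
    congr 1
    have hx' := mem_Ioc.mp hx
    have hy' := mem_Ioc.mp hy
    have hbn := hb n hn
    have hb2 : |hh n| ≤ N := by
      have : |(hh n : ℝ)| ≤ N := by nlinarith
      exact_mod_cast this
    rw [abs_le] at hb2
    have hiff : ((3 * N : ℕ) : ℤ) ∣ x - y + hh n ↔ (y : ℤ) = x + hh n := by
      refine ⟨fun hd => ?_, fun he => ?_⟩
      · have := Int.eq_zero_of_abs_lt_dvd hd (by rw [abs_lt]; constructor <;> omega)
        omega
      · rw [he]; ring_nf; exact dvd_zero _
    by_cases hq : (y : ℤ) = x + hh n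
    · rw [if_pos (hiff.mpr hq), if_pos hq, Complex.ofReal_one]
    · rw [if_neg (fun h => hq (hiff.mp h)), if_neg hq, Complex.ofReal_zero]
  have hT : ∀ n < n1, ∑ x ∈ I, ∑ y ∈ I, g x * g y * (if (y : ℤ) = x + hh n then (1:ℝ) else 0) ≤
      (if hh n = 0 then (A.card : ℝ) else 0) - 3 / 4 * σ * A.card := by
    intro n hn
    set P : ℕ → ℕ → ℝ := fun x y => if (y : ℤ) = x + hh n then (1:ℝ) else 0 with hP
    set a : ℕ → ℝ := fun x => if x ∈ A then (1:ℝ) else 0 with ha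
    have ex : ∑ x ∈ I, ∑ y ∈ I, g x * g y * P x y = ∑ x ∈ I, ∑ y ∈ I, a x * a y * P x y
        - σ * ∑ x ∈ I, a x * ∑ y ∈ I, P x y - σ * ∑ y ∈ I, a y * ∑ x ∈ I, P x y + σ ^ 2 * ∑ x ∈ I, ∑ y ∈ I, P x y := by
      have e1 : ∑ y ∈ I, a y * ∑ x ∈ I, P x y = ∑ x ∈ I, ∑ y ∈ I, a y * P x y := by
        simp_rw [mul_sum]; rw [sum_comm]
      rw [e1]
      simp_rw [mul_sum]
      rw [← sum_sub_distrib, ← sum_sub_distrib, ← sum_add_distrib]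
      refine sum_congr rfl fun x _ => ?_
      rw [← sum_sub_distrib, ← sum_sub_distrib, ← sum_add_distrib]
      refine sum_congr rfl fun y _ => ?_
      simp only [hg, ha]; ring
    have t1 : ∑ x ∈ I, ∑ y ∈ I, a x * a y * P x y ≤ if hh n = 0 then (A.card : ℝ) else 0 := by
      have : ∀ x ∈ I, ∑ y ∈ I, a x * a y * P x y ≤ if hh n = 0 then a x else 0 := by
        intro x hx
        by_cases h0 : hh n = 0
        · rw [if_pos h0, sum_eq_single x]
          · simp only [ha, hP, h0]; split_ifs <;> simp
          · intro y _ hy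
            simp only [hP, h0]; rw [if_neg (by omega), mul_zero]
          · intro h; exact absurd hx h
        · rw [if_neg h0]
          refine sum_nonpos fun y _ => ?_
          simp only [ha, hP]
          split_ifs with h1 h2 h3 <;> try simp
          have := hfree y h2 x h1 (by omega) n
          omega
      refine (sum_le_sum this).trans ?_
      split_ifs
      · exact hAI.le
      · simp
    have t2 : ∀ Z : ℕ → ℕ → ℝ, (∃ s : ℤ, (s = hh n ∨ s = -hh n) ∧ ∀ x y, Z x y = if (y : ℤ) = x + s then (1:ℝ) else 0) →
        7 / 8 * (A.card : ℝ) ≤ ∑ x ∈ I, a x * ∑ y ∈ I, Z x y := by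
      rintro Z ⟨s, hs, hZ⟩
      have hsb : |(s : ℝ)| ≤ σ * N / 8 := by
        rcases hs with rfl | rfl
        · exact hb n hn
        · push_cast; rw [abs_neg]; exact hb n hn
      set out := I.filter (fun x : ℕ => ¬ ∃ y ∈ I, (y : ℤ) = x + s) with hout
      have c1 : ∀ x ∈ I, a x - (if ¬ ∃ y ∈ I, (y : ℤ) = x + s then 1 else 0) ≤ a x * ∑ y ∈ I, Z x y := by
        intro x hx
        by_cases hy : ∃ y ∈ I, (y : ℤ) = x + s
        · rw [if_neg (by simpa using hy), sub_zero]
          obtain ⟨y, hyI, hys⟩ := hy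
          have : 1 ≤ ∑ y ∈ I, Z x y := by
            refine le_trans ?_ (single_le_sum (fun z _ => by rw [hZ]; split_ifs <;> norm_num) hyI)
            rw [hZ, if_pos hys]
          have ha0 : 0 ≤ a x := by simp only [ha]; split_ifs <;> norm_num
          nlinarith
        · rw [if_pos hy]
          have ha1 : a x ≤ 1 := by simp only [ha]; split_ifs <;> norm_num
          have : 0 ≤ a x * ∑ y ∈ I, Z x y := mul_nonneg (by simp only [ha]; split_ifs <;> norm_num)
            (sum_nonneg fun z _ => by rw [hZ]; split_ifs <;> norm_num)
          linarith
      refine le_trans ?_ (sum_le_sum c1)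
      rw [sum_sub_distrib, hAI, ← sum_filter, sum_const, nsmul_eq_mul, mul_one]
      have c2 : (out.card : ℝ) ≤ σ * N / 8 := by
        refine le_trans ?_ hsb
        have h2 : out ⊆ (if 0 ≤ s then Ioc (N1 + N - s.natAbs) (N1 + N) else Ioc N1 (N1 + s.natAbs)) := by
          intro x hx
          simp only [hout, mem_filter, hI, mem_Ioc, not_exists, not_and] at hx
          split_ifs with h0 <;> rw [mem_Ioc] <;> by_contra hcon
          · have := hx.2 (x + s).toNat (by omega)
            omega
          · have := hx.2 (x + s).toNat (by omega)
            omega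
        have h3 := card_le_card h2
        have h4 : out.card ≤ s.natAbs := by
          refine h3.trans ?_
          split_ifs <;> simp <;> omega
        calc (out.card : ℝ) ≤ (s.natAbs : ℝ) := by exact_mod_cast h4
          _ = |(s : ℝ)| := by rw [Nat.cast_natAbs]; push_cast; rfl
      linarith
    have t3 := t2 P ⟨hh n, Or.inl rfl, fun x y => rfl⟩
    have t4 := t2 (fun x y => P y x) ⟨-hh n, Or.inr rfl, fun x y => if_congr (by omega) rfl rfl⟩
    have t5 : ∑ x ∈ I, ∑ y ∈ I, P x y ≤ N := by
      rw [← hcI]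
      have : ∀ x ∈ I, ∑ y ∈ I, P x y ≤ 1 := by
        intro x _
        simp only [hP]
        rw [← sum_filter, sum_const, nsmul_eq_mul, mul_one]
        have : (I.filter (fun y : ℕ => (y : ℤ) = x + hh n)).card ≤ 1 := by
          rw [card_le_one]
          intro u hu v hv
          simp only [mem_filter] at hu hv
          omega
        exact_mod_cast this
      refine (sum_le_sum this).trans ?_
      simp
    rw [ex]
    have t6 : σ ^ 2 * ∑ x ∈ I, ∑ y ∈ I, P x y ≤ σ * A.card := by
      rw [← hσ]; nlinarith [sq_nonneg σ]
    nlinarith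
  -- combine
  have hsum : ∑ r ∈ range M, (F r : ℂ) * S r =
      ((M * ∑ n ∈ range n1, ∑ x ∈ I, ∑ y ∈ I, g x * g y * (if (y : ℤ) = x + hh n then (1:ℝ) else 0) : ℝ) : ℂ) := by
    simp only [hS]
    simp_rw [mul_sum]
    rw [sum_comm, sum_congr rfl fun n hn => hcorr n (mem_range.mp hn)]
    rw [← Complex.ofReal_sum]
    simp_rw [mul_sum]
  have hTT : ∑ n ∈ range n1, ∑ x ∈ I, ∑ y ∈ I, g x * g y * (if (y : ℤ) = x + hh n then (1:ℝ) else 0) ≤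
      -(5 / 8 * σ * n1 * A.card) := by
    refine (sum_le_sum fun n hn => hT n (mem_range.mp hn)).trans ?_
    rw [sum_sub_distrib, ← sum_filter, sum_const, sum_const, nsmul_eq_mul, nsmul_eq_mul, card_range]
    have : (((range n1).filter (fun n => hh n = 0)).card : ℝ) ≤ k := by exact_mod_cast hz
    have hA0 : (0:ℝ) ≤ A.card := by positivity
    nlinarith
  have hlow : 5 / 8 * M * σ * n1 * A.card ≤ ∑ r ∈ range M, F r * ‖S r‖ := by
    have h1 : ‖∑ r ∈ range M, (F r : ℂ) * S r‖ ≤ ∑ r ∈ range M, F r * ‖S r‖ := by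
      refine (norm_sum_le _ _).trans (le_of_eq (sum_congr rfl fun r _ => ?_))
      rw [norm_mul, Complex.norm_real, Real.norm_eq_abs, abs_of_nonneg (hF0 r)]
    refine le_trans ?_ h1
    rw [hsum, Complex.norm_real, Real.norm_eq_abs]
    refine le_trans ?_ (neg_le_abs _)
    have hMr : (0:ℝ) < M := by exact_mod_cast hM0
    nlinarith
  have hsplit := sum_filter_add_sum_filter_not (range M) (fun r => σ / 4 * n1 ≤ ‖S r‖) (fun r => F r * ‖S r‖)
  have hminor : ∑ r ∈ (range M).filter (fun r => ¬ σ / 4 * n1 ≤ ‖S r‖), F r * ‖S r‖ ≤ σ / 4 * n1 * (M * A.card) := by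
    calc _ ≤ ∑ r ∈ (range M).filter (fun r => ¬ σ / 4 * n1 ≤ ‖S r‖), F r * (σ / 4 * n1) := by
          refine sum_le_sum fun r hr => ?_
          have := (mem_filter.mp hr).2
          exact mul_le_mul_of_nonneg_left (by linarith) (hF0 r)
      _ ≤ ∑ r ∈ range M, F r * (σ / 4 * n1) :=
          sum_le_sum_of_subset_of_nonneg (filter_subset _ _) fun r _ _ => mul_nonneg (hF0 r) (by positivity)
      _ = σ / 4 * n1 * ∑ r ∈ range M, F r := by rw [← sum_mul]; ring
      _ ≤ _ := by gcongr
  have hfin : ∑ r ∈ (range M).filter (fun r => σ / 4 * n1 ≤ ‖S r‖), F r * (‖S r‖ / n1) =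
      (∑ r ∈ (range M).filter (fun r => σ / 4 * n1 ≤ ‖S r‖), F r * ‖S r‖) / n1 := by
    rw [sum_div]; exact sum_congr rfl fun r _ => by ring
  change _ ≤ ∑ r ∈ (range M).filter (fun r => σ / 4 * n1 ≤ ‖S r‖), F r * (‖S r‖ / n1)
  rw [hfin, le_div_iff₀ hn1r]
  nlinarith
end

section
open Finset

theorem arc_window (M N N1 : ℕ) (hN1 : 0 < N1) (hM : N1 + N ≤ M) (g : ℕ → ℂ) (hg : ∀ x, x ∉ Ioc N1 (N1 + N) → g x = 0)
    (R : Finset ℕ) (hR : R ⊆ range M) (ψ : ℂ)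
    (hα : ∀ r ∈ R, ∃ α : ℝ, e α = ψ ∧ |(r : ℝ) / M - α| * (16 * N1) ≤ 1) :
    ∑ r ∈ R, ‖∑ x ∈ Ioc N1 (N1 + N), g x * e (x * ((r : ℝ) / M))‖ ^ 2 ≤
      4 * M / (N1 : ℝ) ^ 2 * ∑ t ∈ range (N1 + N), ‖∑ s ∈ range N1, g (t + 1 + s) * ψ ^ s‖ ^ 2 := by
  have hN1r : (0:ℝ) < N1 := by exact_mod_cast hN1
  have hM0 : 0 < M := by omega
  rcases R.eq_empty_or_nonempty with rfl | ⟨r0, hr0⟩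
  · rw [sum_empty]; positivity
  have hψ : ‖ψ‖ = 1 := by
    obtain ⟨α, h, _⟩ := hα r0 hr0
    rw [← h, e_norm]
  set G : ℕ → ℂ := fun t => ∑ s ∈ range N1, g (t + 1 + s) * ψ ^ (t + 1 + s) with hG
  set f : ℕ → ℂ := fun t => (starRingEnd ℂ) (ψ ^ t) * G t with hf
  have hfn : ∀ t, ‖f t‖ = ‖∑ s ∈ range N1, g (t + 1 + s) * ψ ^ s‖ := by
    intro t
    have : G t = ψ ^ (t + 1) * ∑ s ∈ range N1, g (t + 1 + s) * ψ ^ s := by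
      rw [hG, mul_sum]; exact sum_congr rfl fun s _ => by rw [pow_add ψ (t + 1)]; ring
    simp only [hf]
    rw [this]; simp [hψ]
  have hpar := dft_parseval M hM0 (range (N1 + N)) (by intro x; simp; omega) f
  simp_rw [hfn] at hpar
  have key : ∀ r ∈ R, ‖∑ x ∈ Ioc N1 (N1 + N), g x * e (x * ((r : ℝ) / M))‖ ^ 2 * ((N1 : ℝ) ^ 2 / 4) ≤
      ‖∑ t ∈ range (N1 + N), f t * e (t * ((r : ℝ) / M))‖ ^ 2 := by
    intro r hr
    obtain ⟨α, hαψ, hαr⟩ := hα r hr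
    set β := (r : ℝ) / M - α with hβ
    have hpow : ∀ x : ℕ, ψ ^ x = e (x * α) := fun x => by rw [e_nat_mul, hαψ]
    have e1 : ∑ t ∈ range (N1 + N), f t * e (t * ((r : ℝ) / M)) =
        ∑ t ∈ range (N1 + N), ∑ s ∈ range N1, g (t + 1 + s) * ψ ^ (t + 1 + s) * e (t * β) := by
      refine sum_congr rfl fun t _ => ?_
      have : e (t * ((r : ℝ) / M)) * (starRingEnd ℂ) (ψ ^ t) = e (t * β) := by
        rw [hβ, mul_sub, e_sub, hpow]
      rw [← sum_mul, ← this]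
      simp only [hf]; ring
    have e2 : ∀ s ∈ range N1, ∑ t ∈ range (N1 + N), g (t + 1 + s) * ψ ^ (t + 1 + s) * e (t * β) =
        (∑ x ∈ Ioc N1 (N1 + N), g x * e (x * ((r : ℝ) / M))) * e (-((1 + s : ℝ) * β)) := by
      intro s hs
      have hs' := mem_range.mp hs
      have h1 : ∑ t ∈ range (N1 + N), g (t + 1 + s) * ψ ^ (t + 1 + s) * e (t * β) =
          ∑ x ∈ Ico (1 + s) (1 + s + (N1 + N)), g x * ψ ^ x * e ((x - (1 + s) : ℝ) * β) := by
        rw [sum_Ico_eq_sum_range, Nat.add_sub_cancel_left]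
        refine sum_congr rfl fun t _ => ?_
        rw [show t + 1 + s = 1 + s + t by ring]
        push_cast
        congr 2; ring
      rw [h1, sum_mul]
      symm
      have h2 : ∀ x ∈ Ioc N1 (N1 + N), g x * e (x * ((r : ℝ) / M)) * e (-((1 + s : ℝ) * β)) =
          g x * ψ ^ x * e ((x - (1 + s) : ℝ) * β) := by
        intro x _
        rw [hpow, mul_assoc, ← e_add, mul_assoc, ← e_add]
        congr 2
        rw [hβ]; ring
      rw [sum_congr rfl h2]
      refine sum_subset (fun x hx => ?_) fun x _ hx => ?_
      · rw [mem_Ioc] at hx; rw [mem_Ico]; omega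
      · rw [hg x hx]; ring
    rw [e1, sum_comm, sum_congr rfl e2, ← mul_sum, norm_mul, mul_pow]
    gcongr
    have hD : ‖∑ s ∈ range N1, e (-((1 + s : ℝ) * β)) - N1‖ ≤ N1 / 2 := by
      have : ∑ s ∈ range N1, e (-((1 + s : ℝ) * β)) - N1 = ∑ s ∈ range N1, (e (-((1 + s : ℝ) * β)) - 1) := by
        rw [sum_sub_distrib]; simp
      rw [this]
      refine (norm_sum_le _ _).trans ?_
      have h3 : ∀ s ∈ range N1, ‖e (-((1 + s : ℝ) * β)) - 1‖ ≤ 1 / 2 := by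
        intro s hs
        have hs' : (1 + s : ℝ) ≤ N1 := by
          have := mem_range.mp hs
          have : 1 + s ≤ N1 := by omega
          exact_mod_cast this
        refine (e_sub_one_le _).trans ?_
        rw [abs_neg, abs_mul, abs_of_nonneg (by positivity : (0:ℝ) ≤ 1 + s)]
        have h4 : (1 + s : ℝ) * |β| ≤ 1 / 16 := by
          have : (1 + s : ℝ) * |β| ≤ N1 * |β| := by gcongr
          linarith
        have h5 := Real.pi_le_four
        have h6 := Real.pi_pos
        nlinarith [abs_nonneg β]
      refine (sum_le_sum h3).trans ?_
      rw [sum_const, card_range, nsmul_eq_mul]; linarith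
    have h7 : (N1 : ℝ) / 2 ≤ ‖∑ s ∈ range N1, e (-((1 + s : ℝ) * β))‖ := by
      have := norm_sub_norm_le (N1 : ℂ) (∑ s ∈ range N1, e (-((1 + s : ℝ) * β)))
      rw [norm_sub_rev, Complex.norm_natCast] at this
      linarith
    nlinarith
  have h8 : (∑ r ∈ R, ‖∑ x ∈ Ioc N1 (N1 + N), g x * e (x * ((r : ℝ) / M))‖ ^ 2) * ((N1 : ℝ) ^ 2 / 4) ≤
      M * ∑ t ∈ range (N1 + N), ‖∑ s ∈ range N1, g (t + 1 + s) * ψ ^ s‖ ^ 2 := by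
    rw [← hpar, sum_mul]
    refine (sum_le_sum key).trans ?_
    exact sum_le_sum_of_subset_of_nonneg hR fun _ _ _ => by positivity
  rw [← le_div_iff₀ (by positivity)] at h8
  refine h8.trans (le_of_eq ?_)
  field_simp
end

section
open Finset

theorem window_parseval (W N2 : ℕ) (hW : 0 < W) (G : ℕ → ℂ) :
    ∑ b ∈ range W, ‖∑ s ∈ range (W * N2), G s * e ((b : ℝ) / W) ^ s‖ ^ 2 =
      W * ∑ u ∈ range W, ‖∑ z ∈ range N2, G (u + W * z)‖ ^ 2 := by
  have hW' : (W : ℝ) ≠ 0 := by positivity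
  rw [← dft_parseval W hW (range W) subset_rfl (fun u => ∑ z ∈ range N2, G (u + W * z))]
  refine sum_congr rfl fun b _ => ?_
  congr 2
  rw [sum_range_mul_split]
  refine sum_congr rfl fun u _ => ?_
  rw [sum_mul]
  refine sum_congr rfl fun z _ => ?_
  have : e ((b : ℝ) / W) ^ W = 1 := by
    rw [← e_nat_mul, mul_div_cancel₀ _ hW']; exact_mod_cast e_int b
  rw [pow_add, pow_mul, this, one_pow, mul_one, e_nat_mul]

section
variable {r : ℕ} {n : Fin r → ℕ} [∀ i, NeZero (n i)]

theorem lev_set (A : Finset ℕ) (N J : ℕ) (σ K : ℝ) (j : ℕ) (hN : 0 < N) (hj : j ≤ J) (h : Lprop n A N J σ K j) :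
    ∑ γ ∈ lev n ∅ j, ‖∑ z ∈ A, ch (-γ) (pt n z)‖ ^ 2 ≤ (N : ℝ) ^ 2 * (4 * σ ^ 2 * K ^ j) := by
  have hN' : (0:ℝ) < N := by exact_mod_cast hN
  have h1 := h ∅ 0 (by simpa using hj)
  have h2 : ∀ γ ∈ lev n ∅ j, ‖∑ z ∈ A, ch (-γ) (pt n z)‖ ^ 2 = (N : ℝ) ^ 2 * ‖coef A N ∅ 0 γ‖ ^ 2 := by
    intro γ _
    rw [coef, norm_mul, norm_div, Complex.norm_natCast, Complex.norm_natCast]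
    have : AT n A ∅ 0 = A := by simp [AT]
    rw [this]
    simp; field_simp
  rw [sum_congr rfl h2, ← mul_sum]
  gcongr

theorem win_j (W N2 J : ℕ) (hW : 0 < W) (hN2 : 0 < N2) (hcop : ∀ i, W.Coprime (n i)) (σ K : ℝ) (j : ℕ) (hj : j ≤ J) (A I : Finset ℕ)
    (hA : ∀ s, Lprop n ((range N2).filter (fun z => s + W * z ∈ A)) N2 J σ K j)
    (hI : ∀ s, Lprop n ((range N2).filter (fun z => s + W * z ∈ I)) N2 J 1 K j) (t : ℕ) :
    ∑ γ ∈ lev n ∅ j, ∑ b ∈ range W, ‖∑ s ∈ range (W * N2), (((if t + 1 + s ∈ A then 1 else 0) -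
      σ * (if t + 1 + s ∈ I then 1 else 0) : ℝ) : ℂ) * (e ((b : ℝ) / W) * ch γ (pt n 1)) ^ s‖ ^ 2 ≤
      16 * σ ^ 2 * ((W : ℝ) * N2) ^ 2 * K ^ j := by
  set g : ℕ → ℝ := fun x => (if x ∈ A then 1 else 0) - σ * (if x ∈ I then 1 else 0) with hg
  have h1 : ∀ γ : (∀ i, ZMod (n i)), ∑ b ∈ range W, ‖∑ s ∈ range (W * N2), (g (t + 1 + s) : ℂ) * (e ((b : ℝ) / W) * ch γ (pt n 1)) ^ s‖ ^ 2 =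
      W * ∑ u ∈ range W, ‖∑ z ∈ range N2, (g (t + 1 + u + W * z) : ℂ) * ch γ (pt n (W * z))‖ ^ 2 := by
    intro γ
    have := window_parseval W N2 hW (fun s => (g (t + 1 + s) : ℂ) * ch γ (pt n 1) ^ s)
    refine Eq.trans (sum_congr rfl fun b _ => ?_) (this.trans ?_)
    · congr 2
      refine sum_congr rfl fun s _ => ?_
      rw [mul_pow]; ring
    · congr 1
      refine sum_congr rfl fun u _ => ?_
      have h2 : ∑ z ∈ range N2, (g (t + 1 + (u + W * z)) : ℂ) * ch γ (pt n 1) ^ (u + W * z) =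
          ch γ (pt n 1) ^ u * ∑ z ∈ range N2, (g (t + 1 + u + W * z) : ℂ) * ch γ (pt n (W * z)) := by
        rw [mul_sum]
        refine sum_congr rfl fun z _ => ?_
        rw [ch_pt γ (W * z), pow_add, ← add_assoc]; ring
      rw [h2, norm_mul, norm_pow, ch_norm, one_pow, one_mul]
  change ∑ γ ∈ lev n ∅ j, ∑ b ∈ range W, ‖∑ s ∈ range (W * N2), (g (t + 1 + s) : ℂ) * (e ((b : ℝ) / W) * ch γ (pt n 1)) ^ s‖ ^ 2 ≤ _
  simp_rw [h1]
  rw [← mul_sum, sum_comm]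
  have h3 : ∀ u ∈ range W, ∑ γ ∈ lev n ∅ j, ‖∑ z ∈ range N2, (g (t + 1 + u + W * z) : ℂ) * ch γ (pt n (W * z))‖ ^ 2 ≤
      16 * σ ^ 2 * N2 ^ 2 * K ^ j := by
    intro u _
    set Φ : (∀ i, ZMod (n i)) → ℝ := fun γ => ‖∑ z ∈ range N2, (g (t + 1 + u + W * z) : ℂ) * ch (-γ) (pt n z)‖ ^ 2 with hΦ
    set m : (∀ i, ZMod (n i)) → (∀ i, ZMod (n i)) := fun γ i => -((W : ZMod (n i)) * γ i) with hm
    have hu : ∀ i, IsUnit (W : ZMod (n i)) := fun i => (ZMod.isUnit_iff_coprime W (n i)).mpr (hcop i)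
    have hinj : Function.Injective m := by
      intro a b hab
      funext i
      have := congrFun hab i
      simp only [hm, neg_inj] at this
      exact (hu i).mul_left_cancel this
    have hmem : ∀ γ ∈ lev n ∅ j, m γ ∈ lev n ∅ j := by
      intro γ hγ
      have : sp (m γ) = sp γ := by
        ext i
        simp only [sp, hm, mem_filter, mem_univ, true_and, ne_eq, neg_eq_zero, (hu i).mul_right_eq_zero]
      simp only [lev, mem_filter, mem_univ, true_and, this] at hγ ⊢
      exact hγ
    have h4 : ∀ γ ∈ lev n ∅ j, ‖∑ z ∈ range N2, (g (t + 1 + u + W * z) : ℂ) * ch γ (pt n (W * z))‖ ^ 2 = Φ (m γ) := by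
      intro γ _
      simp only [hΦ]
      congr 2
      refine sum_congr rfl fun z _ => ?_
      congr 1
      unfold ch
      refine prod_congr rfl fun i _ => ?_
      congr 1
      simp only [pt, hm, Pi.neg_apply]
      push_cast; ring
    rw [sum_congr rfl h4, ← sum_image (f := Φ) (fun a _ b _ h => hinj h)]
    have h5 : ∑ γ ∈ (lev n ∅ j).image m, Φ γ ≤ ∑ γ ∈ lev n ∅ j, Φ γ :=
      sum_le_sum_of_subset_of_nonneg (fun x hx => by
        obtain ⟨y, hy, rfl⟩ := mem_image.mp hx
        exact hmem y hy) fun _ _ _ => by positivity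
    refine h5.trans ?_
    have a1 := lev_set _ N2 J σ K j hN2 hj (hA (t + 1 + u))
    have a2 := lev_set _ N2 J 1 K j hN2 hj (hI (t + 1 + u))
    have h6 : ∀ γ ∈ lev n ∅ j, Φ γ ≤ 2 * ‖∑ z ∈ (range N2).filter (fun z => t + 1 + u + W * z ∈ A), ch (-γ) (pt n z)‖ ^ 2 +
        2 * σ ^ 2 * ‖∑ z ∈ (range N2).filter (fun z => t + 1 + u + W * z ∈ I), ch (-γ) (pt n z)‖ ^ 2 := by
      intro γ _
      set S1 := ∑ z ∈ (range N2).filter (fun z => t + 1 + u + W * z ∈ A), ch (-γ) (pt n z) with hS1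
      set S2 := ∑ z ∈ (range N2).filter (fun z => t + 1 + u + W * z ∈ I), ch (-γ) (pt n z) with hS2
      have : ∑ z ∈ range N2, (g (t + 1 + u + W * z) : ℂ) * ch (-γ) (pt n z) = S1 - σ * S2 := by
        rw [hS1, hS2, sum_filter, sum_filter, mul_sum, ← sum_sub_distrib]
        refine sum_congr rfl fun z _ => ?_
        simp only [hg]
        split_ifs <;> push_cast <;> ring
      simp only [hΦ]
      rw [this]
      have h7 : ‖S1 - σ * S2‖ ≤ ‖S1‖ + |σ| * ‖S2‖ := by
        refine (norm_sub_le _ _).trans ?_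
        rw [norm_mul, Complex.norm_real, Real.norm_eq_abs]
      calc ‖S1 - σ * S2‖ ^ 2 ≤ (‖S1‖ + |σ| * ‖S2‖) ^ 2 := by gcongr
        _ ≤ 2 * ‖S1‖ ^ 2 + 2 * (|σ| * ‖S2‖) ^ 2 := by nlinarith [sq_nonneg (‖S1‖ - |σ| * ‖S2‖)]
        _ = _ := by rw [mul_pow, sq_abs]; ring
    refine (sum_le_sum h6).trans ?_
    rw [sum_add_distrib, ← mul_sum, ← mul_sum]
    have hs := sq_nonneg σ
    nlinarith
  calc _ ≤ (W : ℝ) * ∑ u ∈ range W, (16 * σ ^ 2 * N2 ^ 2 * K ^ j) := by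
        gcongr with u hu; exact h3 u hu
    _ = _ := by rw [sum_const, card_range, nsmul_eq_mul]; ring
end

theorem win_0 (W N2 N : ℕ) (hW : 0 < W) (σ : ℝ) (hσ0 : 0 < σ) (A : Finset ℕ) (hN1 : W * N2 ≤ N)
    (hA : A ⊆ Ioc (W * N2) (W * N2 + N)) (hσ : σ * N = A.card)
    (hG : ∀ s, (((range N2).filter (fun z => s + W * z ∈ A)).card : ℝ) ≤ 1.01 * σ * N2) :
    ∑ t ∈ range (W * N2 + N), ∑ b ∈ range W, ‖∑ s ∈ range (W * N2), (((if t + 1 + s ∈ A then 1 else 0) -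
      σ * (if t + 1 + s ∈ Ioc (W * N2) (W * N2 + N) then 1 else 0) : ℝ) : ℂ) * e ((b : ℝ) / W) ^ s‖ ^ 2 ≤
      4 * σ ^ 2 * ((W : ℝ) * N2) ^ 2 * (0.01 * N + 5 * ((W : ℝ) * N2)) := by
  set N1 := W * N2 with hN1d
  set I := Ioc N1 (N1 + N) with hI
  set g : ℕ → ℝ := fun x => (if x ∈ A then 1 else 0) - σ * (if x ∈ I then 1 else 0) with hg
  set s : ℕ → ℕ → ℝ := fun t u => ∑ z ∈ range N2, g (t + 1 + u + W * z) with hs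
  set B := σ * N2 with hB
  have hB0 : 0 ≤ B := by positivity
  have h1 : ∀ t, ∑ b ∈ range W, ‖∑ s ∈ range N1, (g (t + 1 + s) : ℂ) * e ((b : ℝ) / W) ^ s‖ ^ 2 =
      W * ∑ u ∈ range W, (s t u) ^ 2 := by
    intro t
    rw [window_parseval W N2 hW (fun s => (g (t + 1 + s) : ℂ))]
    congr 1
    refine sum_congr rfl fun u _ => ?_
    rw [← Complex.ofReal_sum, Complex.norm_real, Real.norm_eq_abs, sq_abs]
    simp only [hs, add_assoc]
  change ∑ t ∈ range (N1 + N), ∑ b ∈ range W, ‖∑ s ∈ range N1, (g (t + 1 + s) : ℂ) * e ((b : ℝ) / W) ^ s‖ ^ 2 ≤ _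
  simp_rw [h1]
  rw [← mul_sum]
  have hseq : ∀ t u, s t u = ((range N2).filter (fun z => t + 1 + u + W * z ∈ A)).card -
      σ * ((range N2).filter (fun z => t + 1 + u + W * z ∈ I)).card := by
    intro t u
    simp only [hs, hg]
    rw [sum_sub_distrib, ← mul_sum, ← sum_filter, ← sum_filter]
    simp
  set c : ℕ → ℝ := fun t => if N1 ≤ t ∧ t ≤ N then 0.01 * B else 2 * B with hc
  have hsq : ∀ t, ∀ u ∈ range W, (s t u) ^ 2 ≤ 2 * B * (2 * c t - s t u) := by
    intro t u hu
    have hu' := mem_range.mp hu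
    have b1 := hG (t + 1 + u)
    have b2 : (((range N2).filter (fun z => t + 1 + u + W * z ∈ I)).card : ℝ) ≤ N2 := by
      have := card_filter_le (range N2) (fun z => t + 1 + u + W * z ∈ I)
      rw [card_range] at this
      exact_mod_cast this
    have hlow : -B ≤ s t u := by
      rw [hseq, hB]
      have : σ * (((range N2).filter (fun z => t + 1 + u + W * z ∈ I)).card : ℝ) ≤ σ * N2 := by gcongr
      have : (0:ℝ) ≤ ((range N2).filter (fun z => t + 1 + u + W * z ∈ A)).card := by positivity
      linarith
    have hup : s t u ≤ c t := by
      rw [hseq]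
      simp only [hc]
      split_ifs with hint
      · have : (range N2).filter (fun z => t + 1 + u + W * z ∈ I) = range N2 := by
          rw [filter_true_of_mem]
          intro z hz
          have hz' := mem_range.mp hz
          have : u + W * z < N1 := by
            calc u + W * z < W + W * z := by omega
              _ = W * (z + 1) := by ring
              _ ≤ N1 := Nat.mul_le_mul_left _ (by omega)
          rw [hI, mem_Ioc]; omega
        rw [this, card_range]
        linarith
      · have : (0:ℝ) ≤ σ * ((range N2).filter (fun z => t + 1 + u + W * z ∈ I)).card := by positivity
        linarith
    have hc0 : 0 ≤ c t := by simp only [hc]; split_ifs <;> linarith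
    have hc2 : c t ≤ 2 * B := by simp only [hc]; split_ifs <;> linarith
    rcases le_total 0 (s t u) with h0 | h0
    · nlinarith
    · nlinarith
  have hz : ∑ t ∈ range (N1 + N), ∑ u ∈ range W, s t u = 0 := by
    have e1 : ∀ t ∈ range (N1 + N), ∑ u ∈ range W, s t u = ∑ v ∈ range N1, g (t + 1 + v) := by
      intro t _
      rw [hN1d, sum_range_mul_split]
      simp only [hs, add_assoc]
    rw [sum_congr rfl e1, sum_comm]
    refine sum_eq_zero fun v hv => ?_
    have hv' := mem_range.mp hv
    have e2 : ∑ t ∈ range (N1 + N), g (t + 1 + v) = ∑ x ∈ Ico (1 + v) (1 + v + (N1 + N)), g x := by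
      rw [sum_Ico_eq_sum_range, Nat.add_sub_cancel_left]
      refine sum_congr rfl fun t _ => ?_
      congr 1; ring
    rw [e2]
    have e3 : ∑ x ∈ I, g x = ∑ x ∈ Ico (1 + v) (1 + v + (N1 + N)), g x := by
      refine sum_subset (fun x hx => ?_) fun x _ hx => ?_
      · rw [hI, mem_Ioc] at hx; rw [mem_Ico]; omega
      · have : x ∉ A := fun h => hx (hA h)
        simp [hg, hx, this]
    rw [← e3]
    simp only [hg]
    rw [sum_sub_distrib, ← mul_sum, ← sum_filter, ← sum_filter, filter_mem_eq_inter, inter_eq_right.mpr hA,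
      filter_mem_eq_inter, inter_self]
    simp [hI, hσ]
  have hcs : ∑ t ∈ range (N1 + N), c t ≤ B * (0.01 * N + 5 * N1) := by
    have : ∀ t ∈ range (N1 + N), c t ≤ 0.01 * B + (if ¬ (N1 ≤ t ∧ t ≤ N) then 2 * B else 0) := by
      intro t _
      simp only [hc]
      split_ifs <;> first | linarith | tauto
    refine (sum_le_sum this).trans ?_
    rw [sum_add_distrib, ← sum_filter, sum_const, sum_const, nsmul_eq_mul, nsmul_eq_mul, card_range]
    have hcard : ((range (N1 + N)).filter (fun t => ¬ (N1 ≤ t ∧ t ≤ N))).card ≤ 2 * N1 := by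
      have : (range (N1 + N)).filter (fun t => ¬ (N1 ≤ t ∧ t ≤ N)) ⊆ range N1 ∪ Ico N (N1 + N) := by
        intro t ht
        simp only [mem_filter, mem_range, mem_union, mem_Ico] at ht ⊢
        omega
      refine (card_le_card this).trans ((card_union_le _ _).trans ?_)
      simp; omega
    have hcard' : (((range (N1 + N)).filter (fun t => ¬ (N1 ≤ t ∧ t ≤ N))).card : ℝ) ≤ 2 * N1 := by exact_mod_cast hcard
    have : (0:ℝ) ≤ N1 * B := by positivity
    push_cast
    nlinarith
  have hfin : ∑ t ∈ range (N1 + N), ∑ u ∈ range W, (s t u) ^ 2 ≤ 4 * B * W * (B * (0.01 * N + 5 * N1)) := by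
    calc _ ≤ ∑ t ∈ range (N1 + N), ∑ u ∈ range W, 2 * B * (2 * c t - s t u) :=
          sum_le_sum fun t _ => sum_le_sum fun u hu => hsq t u hu
      _ = 4 * B * W * ∑ t ∈ range (N1 + N), c t - 2 * B * ∑ t ∈ range (N1 + N), ∑ u ∈ range W, s t u := by
          rw [mul_sum, mul_sum, ← sum_sub_distrib]
          refine sum_congr rfl fun t _ => ?_
          rw [← mul_sum, sum_sub_distrib, sum_const, card_range, nsmul_eq_mul]; ring
      _ ≤ _ := by rw [hz, mul_zero, sub_zero]; gcongr
  calc _ ≤ (W : ℝ) * (4 * B * W * (B * (0.01 * N + 5 * N1))) := by gcongr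
    _ = _ := by rw [hB, hN1d]; push_cast; ring
end

section
open Finset

section
variable {r : ℕ} {n : Fin r → ℕ} [∀ i, NeZero (n i)]

theorem freq (hco : ∀ i j, i ≠ j → (n i).Coprime (n j)) (p : Fin r → ℕ) (hp : ∀ i, (p i).Prime) (l : Fin r → ℕ)
    (hn : ∀ i, n i = p i ^ l i) (hinj : Function.Injective p) (W : ℕ) (hW : 0 < W) (hcop : ∀ i, W.Coprime (n i)) (q : ℕ) (hq : 1 ≤ q)
    (hqd : q ∣ W * ∏ i, n i) (a : ℤ) : ∃ b < W, ∃ γ : (∀ i, ZMod (n i)),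
      e ((a : ℝ) / q) = e ((b : ℝ) / W) * ch γ (pt n 1) ∧ (∏ i ∈ sp γ, p i) ∣ q := by
  set P := ∏ i, n i with hP
  have hP0 : 0 < P := prod_pos fun i _ => Nat.pos_of_neZero (n i)
  have hWr : (W : ℝ) ≠ 0 := by positivity
  have hPr : (P : ℝ) ≠ 0 := by positivity
  have hqr : (q : ℝ) ≠ 0 := by positivity
  have hWP : W.Coprime P := Nat.Coprime.prod_right fun i _ => hcop i
  obtain ⟨u, v, huv⟩ := Nat.isCoprime_iff_coprime.mpr hWP
  obtain ⟨c0, hc0⟩ := hqd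
  set c : ℤ := a * c0 with hc
  have e1 : (a : ℝ) / q = ((c * u : ℤ) : ℝ) / P + ((c * v : ℤ) : ℝ) / W := by
    have h1 : (W : ℝ) * P = q * c0 := by exact_mod_cast hc0
    have h2 : (u : ℝ) * W + v * P = 1 := by exact_mod_cast huv
    rw [div_add_div _ _ hPr hWr, div_eq_div_iff hqr (by positivity), hc]
    push_cast
    calc (a : ℝ) * (P * W) = a * (W * P) * (u * W + v * P) := by rw [h2]; ring
      _ = a * (q * c0) * (u * W + v * P) := by rw [h1]
      _ = _ := by ring
  set b : ℕ := ((c * v) % W).toNat with hb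
  have hbW : ((b : ℕ) : ℤ) = (c * v) % W := Int.toNat_of_nonneg (Int.emod_nonneg _ (by omega))
  have hblt : b < W := by
    have := Int.emod_lt_of_pos (c * v) (by omega : (0:ℤ) < W)
    omega
  have e2 : e (((c * v : ℤ) : ℝ) / W) = e ((b : ℝ) / W) := by
    have := e_div_congr (a := c * v) (b := b) (q := W) hW (by rw [hbW]; exact Int.dvd_self_sub_emod)
    simpa using this
  set Pi : Fin r → ℕ := fun i => ∏ j ∈ univ.erase i, n j with hPi
  have hPiP : ∀ i, Pi i * n i = P := fun i => prod_erase_mul _ _ (mem_univ i)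
  have hx : ∀ i, ∃ x y : ℤ, x * Pi i + y * n i = 1 := fun i => by
    have : (Pi i).Coprime (n i) := Nat.Coprime.prod_left fun j hj => hco j i (ne_of_mem_erase hj)
    obtain ⟨x, y, h⟩ := Nat.isCoprime_iff_coprime.mpr this
    exact ⟨x, y, h⟩
  choose x y hxy using hx
  set m : Fin r → ℤ := fun i => c * u * x i with hm
  have hdv : (P : ℤ) ∣ (∑ i, m i * Pi i) - c * u := by
    rw [hP]; push_cast
    refine Finset.prod_dvd_of_coprime (fun i _ j _ hij => Nat.isCoprime_iff_coprime.mpr (hco i j hij)) fun i _ => ?_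
    rw [← add_sum_erase _ _ (mem_univ i), add_sub_right_comm]
    refine dvd_add ⟨-(c * u * y i), ?_⟩ (dvd_sum fun j hj => ?_)
    · simp only [hm]; linear_combination (c * u) * hxy i
    · refine Dvd.dvd.mul_left ?_ _
      exact_mod_cast dvd_prod_of_mem n (mem_erase.mpr ⟨(ne_of_mem_erase hj).symm, mem_univ i⟩)
  have e3 : e (((c * u : ℤ) : ℝ) / P) = ch (n := n) (fun i => (m i : ZMod (n i))) (pt n 1) := by
    rw [← e_div_congr hP0 hdv]
    have h1 : ∀ i, ((m i * Pi i : ℤ) : ℝ) / P = (m i : ℝ) / n i := by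
      intro i
      have h0 : (n i : ℝ) ≠ 0 := by exact_mod_cast NeZero.ne (n i)
      have : (Pi i : ℝ) * n i = P := by exact_mod_cast hPiP i
      rw [div_eq_div_iff hPr h0, ← this]; push_cast; ring
    have h2 : ((∑ i, m i * Pi i : ℤ) : ℝ) / P = ∑ i, (m i : ℝ) / n i := by
      push_cast
      rw [sum_div]
      refine sum_congr rfl fun i _ => ?_
      rw [← h1 i]; push_cast; rfl
    rw [h2]
    have h3 : ∀ s : Finset (Fin r), e (∑ i ∈ s, (m i : ℝ) / n i) = ∏ i ∈ s, e ((m i : ℝ) / n i) := by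
      intro s
      induction s using Finset.induction_on with
      | empty => simp [e_zero]
      | insert i s hi ih => rw [sum_insert hi, prod_insert hi, e_add, ih]
    rw [h3]
    unfold ch
    refine prod_congr rfl fun i _ => ?_
    simp only [pt, Nat.cast_one, mul_one]
    rw [ZMod.stdAddChar_coe, e]
    congr 1; push_cast; ring
  refine ⟨b, hblt, fun i => (m i : ZMod (n i)), ?_, ?_⟩
  · rw [e1, e_add, e2, e3, mul_comm]
  · refine Finset.prod_dvd_of_isRelPrime (fun i _ j _ hij => ?_) fun i hi => ?_
    · exact (Nat.coprime_iff_isRelPrime.mp ((Nat.coprime_primes (hp i) (hp j)).mpr fun h => hij (hinj h)))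
    · by_contra hnd
      simp only [sp, mem_filter, mem_univ, true_and] at hi
      apply hi
      rw [ZMod.intCast_zmod_eq_zero_iff_dvd]
      have h1 : (n i).Coprime q := by
        rw [hn]; exact Nat.Coprime.pow_left _ ((Nat.Prime.coprime_iff_not_dvd (hp i)).mpr hnd)
      have h2 : n i ∣ q * c0 := by
        rw [← hc0]; exact Dvd.dvd.mul_left (dvd_prod_of_mem n (mem_univ i)) _
      have h3 : (n i : ℤ) ∣ c0 := by exact_mod_cast h1.dvd_of_dvd_mul_left h2
      simp only [hm, hc]
      exact Dvd.dvd.mul_right (Dvd.dvd.mul_right (Dvd.dvd.mul_left h3 _) _) _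
end
end

section
open Finset

section
variable {r : ℕ} {n : Fin r → ℕ} [∀ i, NeZero (n i)]

theorem core (N W N2 n1 k J Q0 C0 : ℕ) (hN : 0 < N) (hW : 0 < W) (hN2 : 0 < N2) (hn1 : 0 < n1) (hC0 : 1 ≤ C0) (A : Finset ℕ)
    (hA : A ⊆ Ioc (W * N2) (W * N2 + N)) (hN1 : 1000 * (W * N2) ≤ N)
    (σ : ℝ) (hσ0 : 0 < σ) (hσ : σ * N = A.card) (hh : ℕ → ℤ) (hb : ∀ n < n1, |(hh n : ℝ)| ≤ σ * N / 8)
    (hfree : ∀ a ∈ A, ∀ b ∈ A, a ≠ b → ∀ n, (a : ℤ) - b ≠ hh n)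
    (hz : ((range n1).filter (fun n => hh n = 0)).card ≤ k) (hk : 8 * k ≤ σ * n1)
    (hmaj : ∀ r < 3 * N, σ / 4 * n1 ≤ ‖∑ n ∈ range n1, e (hh n * ((r : ℝ) / (3 * N : ℕ)))‖ →
      ∃ q : ℕ, 1 ≤ q ∧ q ≤ Q0 ∧ (q : ℝ) ≤ (C0 / (‖∑ n ∈ range n1, e (hh n * ((r : ℝ) / (3 * N : ℕ)))‖ / n1)) ^ C0 ∧
        ∃ a : ℤ, |(r : ℝ) / (3 * N : ℕ) - a / q| * (16 * (W * N2 : ℕ)) ≤ 1)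
    (hG : ∀ s, (((range N2).filter (fun z => s + W * z ∈ A)).card : ℝ) ≤ 1.01 * σ * N2)
    (K : ℝ) (hK : 0 ≤ K)
    (hLA : ∀ s j, Lprop n ((range N2).filter (fun z => s + W * z ∈ A)) N2 J σ K j)
    (hLI : ∀ s j, Lprop n ((range N2).filter (fun z => s + W * z ∈ Ioc (W * N2) (W * N2 + N))) N2 J 1 K j)
    (hco : ∀ i j, i ≠ j → (n i).Coprime (n j)) (p : Fin r → ℕ) (hp : ∀ i, (p i).Prime) (l : Fin r → ℕ)
    (hn : ∀ i, n i = p i ^ l i) (hinj : Function.Injective p) (hcop : ∀ i, W.Coprime (n i))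
    (hqd : ∀ q, 1 ≤ q → q ≤ Q0 → q ∣ W * ∏ i, n i)
    (Y : ℝ) (hY : 1 ≤ Y) (hYp : ∀ i, Y ^ C0 ≤ p i) (hYJ : (Q0 : ℝ) < (Y ^ C0) ^ (J + 1)) (hYK : 8000 * C0 * K ≤ Y) : False := by
  set N1 := W * N2 with hN1d
  have hN10 : 0 < N1 := Nat.mul_pos hW hN2
  set I := Ioc N1 (N1 + N) with hI
  set M := 3 * N with hM
  set S : ℕ → ℝ := fun r => ‖∑ n ∈ range n1, e (hh n * ((r : ℝ) / M))‖ with hS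
  set g : ℕ → ℂ := fun x => (((if x ∈ A then 1 else 0) - σ * (if x ∈ I then 1 else 0) : ℝ) : ℂ) with hg
  set F : ℕ → ℝ := fun r => ‖∑ x ∈ I, g x * e (x * ((r : ℝ) / M))‖ ^ 2 with hF
  have hF0 : ∀ r, 0 ≤ F r := fun r => by positivity
  have hn1r : (0:ℝ) < n1 := by exact_mod_cast hn1
  have hNr : (0:ℝ) < N := by exact_mod_cast hN
  have hN1r : (0:ℝ) < N1 := by exact_mod_cast hN10
  have hN1le : 1000 * (N1 : ℝ) ≤ N := by exact_mod_cast hN1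
  have hC0r : (1:ℝ) ≤ C0 := by exact_mod_cast hC0
  have hY0 : 0 < Y := by linarith
  set Maj := (range M).filter (fun r => σ / 4 * n1 ≤ S r) with hMaj
  have hcs : 3 / 8 * (M : ℝ) * σ * A.card ≤ ∑ r ∈ Maj, F r * (S r / n1) := by
    have := count_step N N1 n1 k hN (by omega) hn1 A hA σ hσ0 hσ hh hb hfree hz hk
    refine this.trans (le_of_eq (sum_congr rfl fun r _ => ?_))
    simp only [hF, hS]
    congr 3
    refine sum_congr rfl fun x hx => ?_
    simp only [hg]
    rw [if_pos hx, mul_one]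
  set w : ℕ → ℝ := fun j => if j = 0 then 1 else C0 / Y ^ j with hw
  have hw0 : ∀ j, 0 ≤ w j := fun j => by simp only [hw]; split_ifs <;> positivity
  have hdec : ∀ r, ∃ (b : ℕ) (γ : ∀ i, ZMod (n i)), r ∈ Maj → b < W ∧ (sp γ).card ≤ J ∧ S r / n1 ≤ w (sp γ).card ∧
      ∃ α : ℝ, e α = e ((b : ℝ) / W) * ch γ (pt n 1) ∧ |(r : ℝ) / M - α| * (16 * N1) ≤ 1 := by
    intro r
    by_cases hr : r ∈ Maj
    swap
    · exact ⟨0, 0, fun h => absurd h hr⟩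
    rw [hMaj, mem_filter, mem_range] at hr
    obtain ⟨q, hq1, hqQ, hqC, a, ha⟩ := hmaj r hr.1 hr.2
    obtain ⟨b, hbW, γ, he, hdvd⟩ := freq hco p hp l hn hinj W hW hcop q hq1 (hqd q hq1 hqQ) a
    have hSpos : 0 < S r := lt_of_lt_of_le (by positivity) hr.2
    have hpw : (Y ^ C0) ^ (sp γ).card ≤ q := by
      have h1 : ∏ i ∈ sp γ, p i ≤ q := Nat.le_of_dvd hq1 hdvd
      calc (Y ^ C0) ^ (sp γ).card = ∏ i ∈ sp γ, Y ^ C0 := by rw [prod_const]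
        _ ≤ ∏ i ∈ sp γ, (p i : ℝ) := prod_le_prod (fun _ _ => by positivity) fun i _ => hYp i
        _ = ((∏ i ∈ sp γ, p i : ℕ) : ℝ) := by push_cast; rfl
        _ ≤ q := by exact_mod_cast h1
    have hY1 : 1 ≤ Y ^ C0 := one_le_pow₀ hY
    refine ⟨b, γ, fun _ => ⟨hbW, ?_, ?_, (a : ℝ) / q, he, ha⟩⟩
    · by_contra hcon
      have h2 : (Y ^ C0) ^ (J + 1) ≤ (Y ^ C0) ^ (sp γ).card := pow_le_pow_right₀ hY1 (by omega)
      have h3 : (q : ℝ) ≤ Q0 := by exact_mod_cast hqQ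
      linarith
    · simp only [hw]
      split_ifs with h0
      · rw [div_le_one hn1r]
        simp only [hS]
        refine (norm_sum_le _ _).trans ?_
        simp [e_norm]
      · have h4 : (Y ^ (sp γ).card) ^ C0 ≤ (C0 / (S r / n1)) ^ C0 := by
          rw [← pow_mul, mul_comm, pow_mul]; exact hpw.trans hqC
        have h5 := le_of_pow_le_pow_left₀ (by omega) (by positivity) h4
        rw [le_div_iff₀ (by positivity)] at h5
        rw [le_div_iff₀ (by positivity)]; linarith
  choose b γ hbγ using hdec
  set G : (∀ i, ZMod (n i)) → ℕ → ℕ → ℝ := fun γ b t =>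
    ‖∑ s ∈ range N1, g (t + 1 + s) * (e ((b : ℝ) / W) * ch γ (pt n 1)) ^ s‖ ^ 2 with hGd
  have hfib : ∑ r ∈ Maj, F r * (S r / n1) ≤ ∑ j ∈ range (J + 1), w j * (4 * M / (N1 : ℝ) ^ 2 *
      ∑ t ∈ range (N1 + N), ∑ γ ∈ lev n ∅ j, ∑ b ∈ range W, G γ b t) := by
    calc ∑ r ∈ Maj, F r * (S r / n1) ≤ ∑ r ∈ Maj, F r * w (sp (γ r)).card :=
          sum_le_sum fun r hr => mul_le_mul_of_nonneg_left (hbγ r hr).2.2.1 (hF0 r)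
      _ = ∑ j ∈ range (J + 1), ∑ r ∈ Maj.filter (fun r => (sp (γ r)).card = j), F r * w (sp (γ r)).card :=
          (sum_fiberwise_of_maps_to (fun r hr => mem_range.mpr (by have := (hbγ r hr).2.1; omega)) _).symm
      _ ≤ _ := by
          refine sum_le_sum fun j _ => ?_
          have s1 : ∑ r ∈ Maj.filter (fun r => (sp (γ r)).card = j), F r * w (sp (γ r)).card =
              w j * ∑ r ∈ Maj.filter (fun r => (sp (γ r)).card = j), F r := by
            rw [mul_sum]
            refine sum_congr rfl fun r hr => ?_
            rw [(mem_filter.mp hr).2]; ring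
          rw [s1]
          refine mul_le_mul_of_nonneg_left ?_ (hw0 j)
          rw [← sum_fiberwise_of_maps_to (g := γ) (t := lev n ∅ j) (fun r hr => by
            simp only [lev, mem_filter, mem_univ, true_and]; exact ⟨(mem_filter.mp hr).2, by simp⟩)]
          rw [sum_comm, mul_sum]
          refine sum_le_sum fun γ0 _ => ?_
          rw [← sum_fiberwise_of_maps_to (g := b) (t := range W) (fun r hr => mem_range.mpr
            (hbγ r (mem_filter.mp (mem_filter.mp hr).1).1).1)]
          rw [sum_comm, mul_sum]
          refine sum_le_sum fun b0 _ => ?_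
          refine arc_window M N N1 hN10 (by omega) g (fun x hx => ?_) _ (fun r hr => ?_) _ (fun r hr => ?_)
          · have : x ∉ A := fun h => hx (hA h)
            simp only [hg]; rw [if_neg this, if_neg hx]; simp
          · simp only [mem_filter] at hr
            exact (mem_filter.mp hr.1.1.1).1
          · simp only [mem_filter] at hr
            have := (hbγ r hr.1.1.1).2.2.2
            rw [hr.1.2, hr.2] at this
            exact this
  have hX0 : ∑ t ∈ range (N1 + N), ∑ γ ∈ lev n ∅ 0, ∑ b ∈ range W, G γ b t ≤
      4 * σ ^ 2 * (N1 : ℝ) ^ 2 * (0.01 * N + 5 * N1) := by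
    have hl0 : lev n ∅ 0 = {0} := by
      ext γ
      simp only [lev, mem_filter, mem_univ, true_and, card_eq_zero, mem_singleton, sp, filter_eq_empty_iff, ne_eq, not_not,
        disjoint_empty_right, and_true]
      exact ⟨fun h => funext fun i => h trivial, fun h i _ => by rw [h]; rfl⟩
    have := win_0 W N2 N hW σ hσ0 A (by omega) hA hσ hG
    rw [hl0]
    simp only [sum_singleton, hGd, ch_zero_left, mul_one]
    have hc : (N1 : ℝ) = (W : ℝ) * N2 := by rw [hN1d, Nat.cast_mul]
    rw [hc]; exact this
  have hXj : ∀ j ≤ J, ∑ t ∈ range (N1 + N), ∑ γ ∈ lev n ∅ j, ∑ b ∈ range W, G γ b t ≤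
      2 * N * (16 * σ ^ 2 * (N1 : ℝ) ^ 2 * K ^ j) := by
    intro j hj
    have h1 : ∀ t ∈ range (N1 + N), ∑ γ ∈ lev n ∅ j, ∑ b ∈ range W, G γ b t ≤ 16 * σ ^ 2 * (N1 : ℝ) ^ 2 * K ^ j := by
      intro t _
      have := win_j W N2 J hW hN2 hcop σ K j hj A I (fun s => hLA s j) (fun s => hLI s j) t
      rw [hN1d, Nat.cast_mul]; exact this
    refine (sum_le_sum h1).trans ?_
    rw [sum_const, card_range, nsmul_eq_mul]
    gcongr
    push_cast; linarith
  rw [sum_range_succ'] at hfib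
  set x := K / Y with hx
  have hx0 : 0 ≤ x := by positivity
  have hx1 : 8000 * C0 * x ≤ 1 := by
    rw [hx, ← mul_div_assoc, div_le_one hY0]; exact hYK
  have hx2 : x ≤ 1 / 8000 := by nlinarith
  have hterm : ∀ i ∈ range J, w (i + 1) * (4 * M / (N1 : ℝ) ^ 2 *
      ∑ t ∈ range (N1 + N), ∑ γ ∈ lev n ∅ (i + 1), ∑ b ∈ range W, G γ b t) ≤ 384 * C0 * (N : ℝ) ^ 2 * σ ^ 2 * x * x ^ i := by
    intro i hi
    have h2 := hXj (i + 1) (by have := mem_range.mp hi; omega)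
    calc _ ≤ w (i + 1) * (4 * M / (N1 : ℝ) ^ 2 * (2 * N * (16 * σ ^ 2 * (N1 : ℝ) ^ 2 * K ^ (i + 1)))) :=
          mul_le_mul_of_nonneg_left (mul_le_mul_of_nonneg_left h2 (by positivity)) (hw0 _)
      _ = _ := by
          simp only [hw, if_neg (Nat.succ_ne_zero i), hx, hM]
          push_cast
          rw [div_pow]
          field_simp
          ring
  have hgeo : ∑ i ∈ range J, x ^ i ≤ 2 := by
    have := mul_neg_geom_sum x J
    have h3 : 0 ≤ x ^ J := by positivity
    have h4 : 0 ≤ ∑ i ∈ range J, x ^ i := sum_nonneg fun _ _ => by positivity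
    nlinarith
  have hs1 := sum_le_sum hterm
  rw [← mul_sum] at hs1
  have hs2 : 384 * C0 * (N : ℝ) ^ 2 * σ ^ 2 * x * ∑ i ∈ range J, x ^ i ≤ 0.1 * ((N : ℝ) ^ 2 * σ ^ 2) := by
    calc _ ≤ 384 * C0 * (N : ℝ) ^ 2 * σ ^ 2 * x * 2 := by gcongr
      _ = 768 * (C0 * x) * ((N : ℝ) ^ 2 * σ ^ 2) := by ring
      _ ≤ 0.1 * ((N : ℝ) ^ 2 * σ ^ 2) := by gcongr; linarith
  have hs3 : w 0 * (4 * M / (N1 : ℝ) ^ 2 * ∑ t ∈ range (N1 + N), ∑ γ ∈ lev n ∅ 0, ∑ b ∈ range W, G γ b t) ≤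
      0.72 * ((N : ℝ) ^ 2 * σ ^ 2) := by
    calc _ ≤ 1 * (4 * M / (N1 : ℝ) ^ 2 * (4 * σ ^ 2 * (N1 : ℝ) ^ 2 * (0.01 * N + 5 * N1))) := by
          simp only [hw, if_true]
          gcongr
      _ ≤ 1 * (4 * M / (N1 : ℝ) ^ 2 * (4 * σ ^ 2 * (N1 : ℝ) ^ 2 * (0.015 * N))) := by gcongr; linarith
      _ = _ := by rw [hM]; push_cast; field_simp; ring
  have hfin := hcs.trans hfib
  rw [← hσ, hM] at hfin
  push_cast at hfin
  have hpos : 0 < (N : ℝ) ^ 2 * σ ^ 2 := by positivity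
  push_cast at hs1 hs3
  simp only [hM] at hs1 hs3
  push_cast at hs1 hs3
  nlinarith
end
end

section
open Finset

theorem primes_setup (yy Q0 : ℕ) (hQ : 2 ≤ Q0) : ∃ (r : ℕ) (p : Fin r → ℕ) (W : ℕ), (∀ i, (p i).Prime) ∧ (∀ i, yy < p i) ∧
    Function.Injective p ∧ r ≤ Q0 ∧ 0 < W ∧ W ≤ Q0 ^ yy ∧ (∀ i, W.Coprime (p i ^ Nat.log (p i) Q0)) ∧
    ∀ q, 1 ≤ q → q ≤ Q0 → q ∣ W * ∏ i, p i ^ Nat.log (p i) Q0 := by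
  set T := (Ioc yy Q0).filter Nat.Prime with hT
  set S := (Icc 1 yy).filter Nat.Prime with hS
  set f : ℕ → ℕ := fun p => p ^ Nat.log p Q0 with hf
  have hmem : ∀ i : Fin T.card, ((T.equivFin.symm i : T) : ℕ) ∈ T := fun i => (T.equivFin.symm i).2
  have hm2 : ∀ i : Fin T.card, yy < ((T.equivFin.symm i : T) : ℕ) ∧ ((T.equivFin.symm i : T) : ℕ).Prime := fun i => by
    have := mem_filter.mp (hmem i)
    exact ⟨(mem_Ioc.mp this.1).1, this.2⟩
  have hSm : ∀ p ∈ S, 1 ≤ p ∧ p ≤ yy ∧ p.Prime := fun p hp => by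
    rw [hS, mem_filter, mem_Icc] at hp; exact ⟨hp.1.1, hp.1.2, hp.2⟩
  have hprod : ∏ i : Fin T.card, f ((T.equivFin.symm i : T) : ℕ) = ∏ p ∈ T, f p := by
    rw [← prod_coe_sort T f]
    exact Equiv.prod_comp T.equivFin.symm (fun x : T => f x)
  refine ⟨T.card, fun i => ((T.equivFin.symm i : T) : ℕ), ∏ p ∈ S, f p, fun i => (hm2 i).2, fun i => (hm2 i).1, ?_, ?_, ?_, ?_, ?_, ?_⟩
  · exact Subtype.val_injective.comp T.equivFin.symm.injective
  · refine (card_filter_le _ _).trans ?_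
    simp
  · exact prod_pos fun p hp => pow_pos (hSm p hp).1 _
  · calc ∏ p ∈ S, f p ≤ ∏ p ∈ S, Q0 := prod_le_prod' fun p _ => Nat.pow_log_le_self p (by omega)
      _ = Q0 ^ S.card := by rw [prod_const]
      _ ≤ Q0 ^ yy := Nat.pow_le_pow_right (by omega) ((card_filter_le _ _).trans (by simp))
  · intro i
    refine Nat.Coprime.prod_left fun p hp => Nat.Coprime.pow _ _ ?_
    refine (Nat.coprime_primes (hSm p hp).2.2 (hm2 i).2).mpr ?_
    have := (hSm p hp).2.1
    have := (hm2 i).1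
    omega
  · intro q hq hqQ
    rw [hprod, ← prod_union (disjoint_left.mpr fun p h1 h2 => by
      have a := (hSm p h1).2.1
      rw [hT, mem_filter, mem_Ioc] at h2
      omega)]
    have hqf : ∏ p ∈ q.primeFactors, p ^ q.factorization p = q := Nat.prod_factorization_pow_eq_self (by omega)
    rw [← hqf]
    refine (prod_dvd_prod_of_dvd _ f fun p hp => ?_).trans (prod_dvd_prod_of_subset _ _ _ fun p hp => ?_)
    · have hp' := Nat.prime_of_mem_primeFactors hp
      refine pow_dvd_pow _ ((Nat.le_log_iff_pow_le hp'.one_lt (by omega)).mpr ?_)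
      exact (Nat.le_of_dvd hq (Nat.ordProj_dvd q p)).trans hqQ
    · have hp' := Nat.prime_of_mem_primeFactors hp
      have h1 : p ≤ Q0 := (Nat.le_of_dvd hq (Nat.dvd_of_mem_primeFactors hp)).trans hqQ
      have h2 := hp'.one_lt
      simp only [mem_union, hS, hT, mem_filter, mem_Icc, mem_Ioc]
      by_cases h : p ≤ yy
      · exact Or.inl ⟨⟨by omega, h⟩, hp'⟩
      · exact Or.inr ⟨⟨by omega, h1⟩, hp'⟩

theorem AT_prog {r : ℕ} {n : Fin r → ℕ} [∀ i, NeZero (n i)] (hco : ∀ i j, i ≠ j → (n i).Coprime (n j))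
    (P : ℕ → Prop) [DecidablePred P] (N2 : ℕ) (T : Finset (Fin r)) (ω : ∀ i, ZMod (n i)) :
    ∃ z0 : ℕ, (AT n ((range N2).filter P) T ω).card ≤
      ((range (N2 / (∏ i ∈ T, n i) + 1)).filter (fun w => P (z0 + (∏ i ∈ T, n i) * w))).card := by
  set q := ∏ i ∈ T, n i with hq
  have hq0 : 0 < q := prod_pos fun i _ => Nat.pos_of_ne_zero (NeZero.ne (n i))
  rcases (AT n ((range N2).filter P) T ω).eq_empty_or_nonempty with h | ⟨x0, hx0⟩
  · exact ⟨0, by rw [h]; simp⟩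
  have hm : ∀ x ∈ AT n ((range N2).filter P) T ω, x < N2 ∧ P x ∧ x % q = x0 % q := by
    intro x hx
    simp only [AT, mem_filter, mem_range] at hx hx0
    refine ⟨hx.1.1, hx.1.2, ?_⟩
    have key : ((q : ℕ) : ℤ) ∣ (x : ℤ) - x0 := by
      rw [hq, Nat.cast_prod]
      refine prod_dvd_of_coprime (fun i _ j _ hij => (Nat.isCoprime_iff_coprime.mpr (hco i j hij))) fun i hi => ?_
      have h1 := hx.2 i hi
      rw [← hx0.2 i hi] at h1
      rw [← ZMod.intCast_zmod_eq_zero_iff_dvd]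
      simp only [pt] at h1
      push_cast
      rw [h1, sub_self]
    have h2 : (x : ℤ) % q = x0 % q := (Int.emod_eq_emod_iff_emod_sub_eq_zero).mpr (Int.emod_eq_zero_of_dvd key)
    exact_mod_cast h2
  refine ⟨x0 % q, card_le_card_of_injOn (fun x => x / q) ?_ ?_⟩
  · intro x hx
    obtain ⟨h1, h2, h3⟩ := hm x hx
    rw [mem_coe, mem_filter, mem_range]
    refine ⟨Nat.lt_succ_of_le (Nat.div_le_div_right h1.le), ?_⟩
    rw [← h3, Nat.mod_add_div]; exact h2
  · intro x hx y hy hxy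
    have hx3 := (hm x hx).2.2
    have hy3 := (hm y hy).2.2
    simp only at hxy
    rw [← Nat.mod_add_div x q, ← Nat.mod_add_div y q, hx3, hy3, hxy]
end

section
open Finset

theorem n1_exists {k : ℕ} {lam : ℕ → ℕ} {H : ℕ → Polynomial ℤ} {b G Ch : ℕ} (hHD : HD k lam H b G Ch)
    (d : ℕ) (hd : 0 < d) (M : ℝ) (hM : 0 ≤ M) : 1 ≤ Ch ∧ 1 ≤ d ^ k / lam d ∧
    ((H d) ≠ 0) ∧ ∃ n1 : ℕ, (∀ n < n1, |(((H d).eval ((n + 1 : ℕ) : ℤ) : ℤ) : ℝ)| ≤ M / 8) ∧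
      M < 8 * (k + 1) * Ch * ((d ^ k / lam d : ℕ) : ℝ) * ((n1 : ℝ) + 1) ^ k := by
  have hed : 1 ≤ d ^ k / lam d := Nat.div_pos (Nat.le_of_dvd (by positivity) (hHD.lam_dvd d hd)) (hHD.lam_pos d hd)
  set ed := d ^ k / lam d with hedd
  have hk := hHD.hk
  have hb := hHD.hb
  have hlead : (H d).coeff k = b * (ed : ℤ) := hHD.lead d hd
  have hCh : 1 ≤ Ch := by
    have h1 : |(H d).coeff k| ≤ Ch * (ed : ℤ) := hHD.bound d hd k
    by_contra h0
    have h2 : Ch = 0 := by omega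
    rw [h2, hlead] at h1
    have h3 : (0:ℤ) < b * ed := by positivity
    rw [abs_of_pos h3] at h1
    simp at h1; omega
  refine ⟨hCh, hed, ?_, ?_⟩
  · intro h0
    rw [h0] at hlead
    have h3 : (0:ℤ) < b * ed := by positivity
    simp at hlead; omega
  have hedr : (1:ℝ) ≤ ed := by exact_mod_cast hed
  have hChr : (1:ℝ) ≤ Ch := by exact_mod_cast hCh
  have hex : ∃ n1 : ℕ, M < 8 * (k + 1) * Ch * (ed : ℝ) * ((n1 : ℝ) + 1) ^ k := by
    obtain ⟨n1, hn1⟩ := exists_nat_gt M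
    refine ⟨n1, hn1.trans_le ?_⟩
    have h1 : (n1 : ℝ) + 1 ≤ ((n1 : ℝ) + 1) ^ k := le_self_pow₀ (by linarith [Nat.cast_nonneg (α := ℝ) n1]) (by omega)
    have h2 : (1:ℝ) ≤ 8 * (k + 1) * Ch * (ed : ℝ) := by
      have : (1:ℝ) ≤ 8 * (k + 1) := by linarith [Nat.cast_nonneg (α := ℝ) k]
      exact one_le_mul_of_one_le_of_one_le (one_le_mul_of_one_le_of_one_le this hChr) hedr
    nlinarith
  classical
  refine ⟨Nat.find hex, fun n hn => ?_, Nat.find_spec hex⟩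
  have h1 : 8 * (k + 1) * Ch * (ed : ℝ) * ((n : ℝ) + 1) ^ k ≤ M := not_lt.mp (Nat.find_min hex hn)
  have h2 : |(H d).eval ((n + 1 : ℕ) : ℤ)| ≤ (k + 1) * (Ch * (ed : ℤ)) * ((n + 1 : ℕ) : ℤ) ^ k := by
    have h3 := eval_bound (H d) k k (hHD.deg d hd) le_rfl ((n + 1 : ℕ) : ℤ) (n + 1) (by omega) (by rw [Nat.abs_cast])
    refine h3.trans (mul_le_mul_of_nonneg_right ?_ (by positivity))
    refine (sum_le_sum fun j _ => hHD.bound d hd j).trans (le_of_eq ?_)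
    rw [sum_const, card_range, nsmul_eq_mul]; push_cast; rfl
  have h4 : |(((H d).eval ((n + 1 : ℕ) : ℤ) : ℤ) : ℝ)| ≤ (k + 1) * (Ch * (ed : ℝ)) * ((n : ℝ) + 1) ^ k := by
    rw [← Int.cast_abs]
    exact_mod_cast h2
  linarith

def cnt (A : Finset ℤ) (s : ℤ) (τ n : ℕ) : ℕ := ((range n).filter (fun w : ℕ => s + τ * w ∈ A)).card

set_option maxHeartbeats 1000000 in
theorem core2 {k : ℕ} {lam : ℕ → ℕ} {H : ℕ → Polynomial ℤ} {b G Ch : ℕ} (hHD : HD k lam H b G Ch) :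
    ∃ C0 c1 : ℕ, 1 ≤ C0 ∧ ∀ (N d Q0 E yy J m : ℕ) (σ Y K : ℝ) (A : Finset ℤ), 0 < N → 0 < d → 0 < σ → σ ≤ 1 →
    A ⊆ Icc 1 (N : ℤ) → σ * N = A.card →
    (∀ a ∈ A, ∀ b ∈ A, a ≠ b → ∀ n : ℕ, 0 < n → a - b ≠ (H d).eval (n : ℤ)) →
    (∀ (s : ℤ) (τ n : ℕ), 1 ≤ τ → τ ≤ 2 * E * Q0 ^ (yy + J) → N ≤ 2 * E * Q0 ^ (yy + J) * n → n ≤ N →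
      (cnt A s τ n : ℝ) ≤ 1.01 * σ * n) →
    2 ≤ Q0 → (4 * C0 / σ) ^ C0 ≤ Q0 → 8 * k ≤ σ * Q0 → c1 * (2 * Q0) ^ k * (d : ℝ) ^ (k * (k + 1)) ≤ σ * N →
    c1 * Q0 ≤ σ * E → 1000 ≤ E → 2 * E * Q0 ^ yy * (9 ^ m * (2 * Q0 ^ 2) ^ (4 * J * m)) ≤ N →
    1 ≤ Y → Y ^ C0 ≤ yy + 1 → (Q0 : ℝ) < (Y ^ C0) ^ (J + 1) → 8000 * C0 * K ≤ Y → 1 ≤ m → 1 ≤ J → 4 * 50 ^ m ≤ K →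
    5 * (2 * (Q0 : ℝ) ^ 2) ^ (2 * J) * (50 ^ m) ^ J * (4 * 50 ^ m) ^ m ≤ 2 * σ * K ^ m → False := by
  obtain ⟨C0, hC0, hweyl⟩ := weylHD hHD
  refine ⟨C0, 2 ^ k * (8 * (k + 1) * Ch) * 16, hC0, ?_⟩
  intro N d Q0 E yy J m σ Y K A hN hd hσ0 hσ1 hA hσ hfree hG hQ2 hQC hQk hNd hE hE1 hNbig hY hYy hYJ hYK hm hJ hK1 hKm
  obtain ⟨hCh, hed, hH0, n1, hn1b, hn1l⟩ := n1_exists hHD d hd (σ * N) (by positivity)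
  obtain ⟨r, p, W, hp, hyp, hinj, hrQ, hW, hWQ, hcop, hqd⟩ := primes_setup yy Q0 hQ2
  set n : Fin r → ℕ := fun i => p i ^ Nat.log (p i) Q0 with hn
  have : ∀ i, NeZero (n i) := fun i => ⟨pow_ne_zero _ (hp i).ne_zero⟩
  have hco : ∀ i j, i ≠ j → (n i).Coprime (n j) := fun i j hij =>
    Nat.Coprime.pow _ _ ((Nat.coprime_primes (hp i) (hp j)).mpr fun h => hij (hinj h))
  have hnQ : ∀ i, n i ≤ Q0 := fun i => Nat.pow_log_le_self _ (by omega)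
  set B := 9 ^ m * (2 * Q0 ^ 2) ^ (4 * J * m) with hB
  set N2 := N / (W * E) with hN2d
  have hWE : 0 < W * E := Nat.mul_pos hW (by omega)
  have hBN2 : B ≤ N2 := by
    rw [hN2d, Nat.le_div_iff_mul_le hWE]
    calc B * (W * E) ≤ B * (Q0 ^ yy * E) := by gcongr
      _ ≤ 2 * E * Q0 ^ yy * B := by nlinarith [Nat.zero_le (B * (Q0 ^ yy * E))]
      _ ≤ N := hNbig
  have hQJ : 2 * Q0 ^ J ≤ N2 := by
    refine le_trans ?_ hBN2
    rw [hB]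
    have h1 : 2 ≤ 9 ^ m := le_trans (by norm_num) (Nat.pow_le_pow_right (by norm_num) hm)
    refine Nat.mul_le_mul h1 ?_
    calc Q0 ^ J ≤ (2 * Q0 ^ 2) ^ J := Nat.pow_le_pow_left (by nlinarith) _
      _ ≤ _ := Nat.pow_le_pow_right (by nlinarith) (by nlinarith)
  have hN20 : 0 < N2 := by have : 0 < Q0 ^ J := pow_pos (by omega) _; omega
  have hN2u : W * E * N2 ≤ N := Nat.mul_div_le N (W * E)
  have hN2l : N ≤ 2 * (W * E) * N2 := by
    have := Nat.lt_mul_div_succ N hWE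
    rw [← hN2d] at this
    nlinarith
  set Z := 2 * E * Q0 ^ (yy + J) with hZ
  have hZt : ∀ q, q ≤ Q0 ^ J → W * q ≤ Z := fun q hq => by
    rw [hZ, pow_add]
    calc W * q ≤ Q0 ^ yy * Q0 ^ J := Nat.mul_le_mul hWQ hq
      _ ≤ _ := Nat.le_mul_of_pos_left _ (by omega)
  have hZn : ∀ q w, q ≤ Q0 ^ J → N2 ≤ q * w → N ≤ Z * w := fun q w hq hw => by
    calc N ≤ 2 * (W * E) * N2 := hN2l
      _ ≤ 2 * (Q0 ^ yy * E) * (Q0 ^ J * w) := by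
          refine Nat.mul_le_mul (by gcongr) (hw.trans (by gcongr))
      _ = Z * w := by rw [hZ, pow_add]; ring
  have hNr : (0:ℝ) < N := by exact_mod_cast hN
  have hN2r : (0:ℝ) < N2 := by exact_mod_cast hN20
  set N1 := W * N2 with hN1
  -- shifted set
  set A' : Finset ℕ := A.image (fun a : ℤ => (a + (N1 : ℤ)).toNat) with hA'
  have hAm : ∀ a ∈ A, 1 ≤ a ∧ a ≤ N := fun a ha => mem_Icc.mp (hA ha)
  have hmem : ∀ x : ℕ, x ∈ A' ↔ (x : ℤ) - N1 ∈ A := by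
    intro x
    rw [hA', mem_image]
    constructor
    · rintro ⟨a, ha, rfl⟩
      have := hAm a ha
      rw [Int.toNat_of_nonneg (by omega)]
      simpa using ha
    · intro h
      exact ⟨_, h, by simp⟩
  have hcard : A'.card = A.card := by
    refine card_image_of_injOn fun a ha b hb hab => ?_
    have h1 := hAm a ha
    have h2 := hAm b hb
    have h3 : (a + (N1 : ℤ)).toNat = (b + (N1 : ℤ)).toNat := hab
    omega
  have hfilt : ∀ s q w : ℕ, (((range w).filter (fun z => s + q * z ∈ A')).card : ℝ) = cnt A ((s : ℤ) - N1) q w := by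
    intro s q w
    rw [cnt]
    congr 2
    refine filter_congr fun z _ => ?_
    rw [hmem]
    push_cast
    rw [show (s : ℤ) + q * z - N1 = s - N1 + q * z by ring]
  have hTQ : ∀ T : Finset (Fin r), T.card ≤ J → 0 < ∏ i ∈ T, n i ∧ ∏ i ∈ T, n i ≤ Q0 ^ J := fun T hT =>
    ⟨prod_pos fun i _ => Nat.pos_of_ne_zero (NeZero.ne (n i)),
     (prod_le_pow_card _ _ _ fun i _ => hnQ i).trans (Nat.pow_le_pow_right (by omega) hT)⟩
  have hX : (r + 1) * Q0 ≤ 2 * Q0 ^ 2 := by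
    calc (r + 1) * Q0 ≤ (2 * Q0) * Q0 := Nat.mul_le_mul_right _ (by omega)
      _ = _ := by ring
  have hNB : (9:ℝ) ^ m * ((2 * Q0 ^ 2 : ℕ) : ℝ) ^ (4 * J * m) ≤ N2 := by exact_mod_cast hBN2
  have hK0 : (1:ℝ) ≤ K := le_trans (by have : (1:ℝ) ≤ 50 ^ m := one_le_pow₀ (by norm_num)
                                       linarith) hK1
  have hdivb : ∀ q : ℕ, 0 < q → N2 ≤ q * (N2 / q + 1) ∧ q * (N2 / q + 1) ≤ N2 + q := fun q hq =>
    ⟨by have := Nat.lt_mul_div_succ N2 hq; omega, by have := Nat.mul_div_le N2 q; rw [mul_add]; omega⟩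
  have hLA : ∀ s j, Lprop n ((range N2).filter (fun z => s + W * z ∈ A')) N2 J σ K j := by
    intro s j
    refine levelJ hco m hm Q0 (2 * Q0 ^ 2) J hQ2 hnQ hX K σ hσ0 _ N2 hN20 (filter_subset _ _) ?_ hK1 (by push_cast; exact hKm) hNB j
    intro T ω hT
    obtain ⟨hq0, hqQ⟩ := hTQ T hT
    obtain ⟨z0, hz0⟩ := AT_prog hco (fun z => s + W * z ∈ A') N2 T ω
    set q := ∏ i ∈ T, n i with hq
    obtain ⟨d1, d2⟩ := hdivb q hq0
    have hc : (cnt A (((s + W * z0 : ℕ) : ℤ) - N1) (W * q) (N2 / q + 1) : ℝ) ≤ 1.01 * σ * (N2 / q + 1 : ℕ) := by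
      refine hG _ _ _ (Nat.mul_pos hW hq0) (hZt q hqQ) (hZn q _ hqQ d1) ?_
      have h1 : N2 / q ≤ N2 := Nat.div_le_self _ _
      have h2 : N2 + 1 ≤ W * E * N2 := by
        have : 1000 ≤ W * E := le_trans hE1 (Nat.le_mul_of_pos_left E hW)
        nlinarith
      omega
    rw [← hfilt] at hc
    have h3 : (((range (N2 / q + 1)).filter (fun w => s + W * (z0 + q * w) ∈ A')).card : ℝ) ≤ 1.01 * σ * (N2 / q + 1 : ℕ) := by
      convert hc using 5
      ring
    have h4 : ((AT n ((range N2).filter (fun z => s + W * z ∈ A')) T ω).card : ℝ) ≤ 1.01 * σ * (N2 / q + 1 : ℕ) :=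
      le_trans (by exact_mod_cast hz0) h3
    have h5 : (q : ℝ) * ((N2 / q + 1 : ℕ) : ℝ) ≤ 1.5 * N2 := by
      have a1 : ((q * (N2 / q + 1) : ℕ) : ℝ) ≤ ((N2 + q : ℕ) : ℝ) := by exact_mod_cast d2
      have a2 : ((2 * q : ℕ) : ℝ) ≤ N2 := by exact_mod_cast (by omega : 2 * q ≤ N2)
      rw [Nat.cast_mul] at a1
      push_cast at a1 a2 ⊢
      linarith
    calc _ ≤ 1.01 * σ * (N2 / q + 1 : ℕ) * (q : ℝ) := by gcongr
      _ = 1.01 * σ * ((q : ℝ) * ((N2 / q + 1 : ℕ) : ℝ)) := by ring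
      _ ≤ 1.01 * σ * (1.5 * N2) := by gcongr
      _ ≤ 2 * σ * N2 := by nlinarith [mul_pos hσ0 hN2r]
  have hLI : ∀ s j, Lprop n ((range N2).filter (fun z => s + W * z ∈ Ioc N1 (N1 + N))) N2 J 1 K j := by
    intro s j
    refine levelJ hco m hm Q0 (2 * Q0 ^ 2) J hQ2 hnQ hX K 1 one_pos _ N2 hN20 (filter_subset _ _) ?_ hK1 ?_ hNB j
    · intro T ω hT
      obtain ⟨hq0, hqQ⟩ := hTQ T hT
      obtain ⟨z0, hz0⟩ := AT_prog hco (fun z => s + W * z ∈ Ioc N1 (N1 + N)) N2 T ω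
      set q := ∏ i ∈ T, n i with hq
      obtain ⟨d1, d2⟩ := hdivb q hq0
      have h6 := hz0.trans ((card_filter_le _ _).trans (by rw [card_range]))
      have h7 : (AT n ((range N2).filter (fun z => s + W * z ∈ Ioc N1 (N1 + N))) T ω).card * q ≤ 2 * N2 := by
        calc _ ≤ (N2 / q + 1) * q := Nat.mul_le_mul_right _ h6
          _ ≤ 2 * N2 := by rw [mul_comm]; omega
      rw [mul_one]
      exact_mod_cast h7
    · push_cast
      refine hKm.trans ?_
      have : (0:ℝ) < K ^ m := by positivity
      nlinarith
  -- major arcs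
  set ed := d ^ k / lam d with hedd
  have hedr : (1:ℝ) ≤ ed := by exact_mod_cast hed
  have hQ2r : (2:ℝ) ≤ Q0 := by exact_mod_cast hQ2
  have hk := hHD.hk
  have hn1Q : (Q0 : ℝ) * ed ≤ n1 := by
    by_contra hcon
    push Not at hcon
    have e1 : (n1 : ℝ) + 1 ≤ 2 * Q0 * ed := by nlinarith
    have e2 : ((n1 : ℝ) + 1) ^ k ≤ (2 * Q0 * ed) ^ k := by gcongr
    have e3 : (ed : ℝ) ≤ (d : ℝ) ^ k := by exact_mod_cast Nat.div_le_self _ _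
    have e4 : (ed : ℝ) * (2 * Q0 * ed) ^ k ≤ (2 * Q0) ^ k * (d : ℝ) ^ (k * (k + 1)) := by
      calc (ed : ℝ) * (2 * Q0 * ed) ^ k = (2 * Q0) ^ k * (ed : ℝ) ^ (k + 1) := by rw [mul_pow, pow_succ]; ring
        _ ≤ (2 * Q0) ^ k * ((d : ℝ) ^ k) ^ (k + 1) := by gcongr
        _ = _ := by rw [← pow_mul]
    have e5 : (1:ℝ) ≤ 2 ^ k := one_le_pow₀ (by norm_num)
    push_cast at hNd
    have : σ * N < σ * N := calc
      σ * N < 8 * (k + 1) * Ch * (ed : ℝ) * ((n1 : ℝ) + 1) ^ k := hn1l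
      _ ≤ 8 * (k + 1) * Ch * (ed : ℝ) * (2 * Q0 * ed) ^ k := by gcongr
      _ = 8 * (k + 1) * Ch * ((ed : ℝ) * (2 * Q0 * ed) ^ k) := by ring
      _ ≤ 8 * (k + 1) * Ch * ((2 * Q0) ^ k * (d : ℝ) ^ (k * (k + 1))) := by gcongr
      _ ≤ 2 ^ k * 16 * (8 * (k + 1) * Ch * ((2 * Q0) ^ k * (d : ℝ) ^ (k * (k + 1)))) :=
          le_mul_of_one_le_left (by positivity) (by linarith)
      _ = 2 ^ k * (8 * (k + 1) * Ch) * 16 * (2 * Q0) ^ k * (d : ℝ) ^ (k * (k + 1)) := by ring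
      _ ≤ σ * N := hNd
    exact lt_irrefl _ this
  have hn1r : (2:ℝ) ≤ n1 := le_trans (by nlinarith) hn1Q
  have hn10 : 0 < n1 := by
    rcases Nat.eq_zero_or_pos n1 with h | h
    · rw [h] at hn1r; norm_num at hn1r
    · exact h
  have hmain : 16 * (N1 : ℝ) * Q0 ≤ ed * (n1 : ℝ) ^ k := by
    have f1 : ((n1 : ℝ) + 1) ^ k ≤ 2 ^ k * (n1 : ℝ) ^ k := by
      rw [← mul_pow]; gcongr; linarith
    have f2 : σ * N ≤ 8 * (k + 1) * Ch * (ed : ℝ) * (2 ^ k * (n1 : ℝ) ^ k) :=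
      hn1l.le.trans (by gcongr)
    have f3 : (E : ℝ) * N1 ≤ N := by
      have : E * N1 ≤ N := by rw [hN1]; calc E * (W * N2) = W * E * N2 := by ring
          _ ≤ N := hN2u
      exact_mod_cast this
    push_cast at hE
    have f4 : (8 * (k + 1) * Ch * 2 ^ k) * (16 * (N1 : ℝ) * Q0) ≤ (8 * (k + 1) * Ch * 2 ^ k) * (ed * (n1 : ℝ) ^ k) := by
      calc _ = (2 ^ k * (8 * (k + 1) * Ch) * 16 * Q0) * (N1 : ℝ) := by ring
        _ ≤ σ * E * N1 := by gcongr
        _ = σ * (E * N1) := by ring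
        _ ≤ σ * N := by gcongr
        _ ≤ _ := f2
        _ = _ := by ring
    have hChr : (1:ℝ) ≤ Ch := by exact_mod_cast hCh
    exact le_of_mul_le_mul_left f4 (by positivity)
  have hC0r : (1:ℝ) ≤ C0 := by exact_mod_cast hC0
  refine core (n := n) N W N2 n1 k J Q0 C0 hN hW hN20 hn10 hC0 A' ?_ ?_ σ hσ0 (by rw [hcard]; exact hσ)
    (fun n => (H d).eval ((n + 1 : ℕ) : ℤ)) hn1b ?_ ?_ ?_ ?_ ?_ K (by linarith) hLA hLI hco p hp _ (fun i => rfl) hinj hcop hqd Y hY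
    ?_ hYJ hYK
  · intro x hx
    have := hAm _ ((hmem x).mp hx)
    rw [mem_Ioc]; omega
  · calc 1000 * (W * N2) ≤ E * (W * N2) := by gcongr
      _ = W * E * N2 := by ring
      _ ≤ N := hN2u
  · intro a ha b hb hab n h
    refine hfree _ ((hmem a).mp ha) _ ((hmem b).mp hb) (fun h' => hab (by omega)) (n + 1) (by omega) ?_
    rw [← h]; ring
  · have h1 : ((range n1).filter (fun n => (H d).eval ((n + 1 : ℕ) : ℤ) = 0)).card ≤ (H d).roots.toFinset.card := by
      refine card_le_card_of_injOn (fun n => ((n + 1 : ℕ) : ℤ)) (fun x hx => ?_) (fun x _ y _ hxy => ?_)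
      · simp only [mem_coe, mem_filter] at hx
        rw [mem_coe, Multiset.mem_toFinset, Polynomial.mem_roots hH0]
        exact hx.2
      · simp only at hxy; omega
    exact h1.trans ((Multiset.toFinset_card_le _).trans ((Polynomial.card_roots' _).trans (hHD.deg d hd)))
  · refine hQk.trans ?_
    have : (Q0 : ℝ) ≤ Q0 * ed := le_mul_of_one_le_right (by linarith) hedr
    exact mul_le_mul_of_nonneg_left (this.trans hn1Q) hσ0.le
  · intro r _ hr
    set S := ‖∑ n ∈ range n1, e (((H d).eval ((n + 1 : ℕ) : ℤ) : ℤ) * ((r : ℝ) / (3 * N : ℕ)))‖ with hS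
    have hn1p : (0:ℝ) < n1 := by linarith
    have hτl : σ / 4 ≤ S / n1 := by rw [le_div_iff₀ hn1p]; exact hr
    have hτ0 : 0 < S / n1 := lt_of_lt_of_le (by positivity) hτl
    have hτ1 : S / n1 ≤ 1 := by
      rw [div_le_one hn1p]
      refine (norm_sum_le _ _).trans ?_
      simp [e_norm]
    have hQb : (C0 / (S / n1)) ^ C0 ≤ (Q0 : ℝ) := by
      refine le_trans (pow_le_pow_left₀ (by positivity) ?_ _) hQC
      calc C0 / (S / n1) ≤ C0 / (σ / 4) := by gcongr
        _ = 4 * C0 / σ := by field_simp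
    obtain ⟨q, hq1, hqC, a, ha⟩ := hweyl d n1 (S / n1) ((r : ℝ) / (3 * N : ℕ)) hd hτ0 hτ1
      (le_trans (by gcongr) hn1Q) (by rw [div_mul_cancel₀ _ hn1p.ne'])
    have hqQ : (q : ℝ) ≤ Q0 := hqC.trans hQb
    refine ⟨q, hq1, by exact_mod_cast hqQ, hqC, a, ?_⟩
    have hden : (0:ℝ) < ed * (n1 : ℝ) ^ k := by positivity
    calc _ ≤ (C0 / (S / n1)) ^ C0 / (ed * (n1 : ℝ) ^ k) * (16 * (N1 : ℕ)) := by gcongr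
      _ ≤ Q0 / (ed * (n1 : ℝ) ^ k) * (16 * (N1 : ℕ)) := by gcongr
      _ = 16 * (N1 : ℝ) * Q0 / (ed * (n1 : ℝ) ^ k) := by ring
      _ ≤ 1 := by rw [div_le_one hden]; exact hmain
  · intro s
    rw [hfilt]
    refine hG _ _ _ hW (by simpa using hZt 1 (Nat.one_le_pow _ _ (by omega))) (hZn 1 N2 (Nat.one_le_pow _ _ (by omega)) (by omega)) ?_
    exact Nat.div_le_self _ _
  · intro i
    refine hYy.trans ?_
    exact_mod_cast hyp i
end

section
open Finset

theorem potential {k : ℕ} {lam : ℕ → ℕ} {H : ℕ → Polynomial ℤ} {b G Ch : ℕ} (hHD : HD k lam H b G Ch)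
    (N d Z : ℕ) (hN : 0 < N) (hd : 0 < d) (hZ : 1 ≤ Z) (A : Finset ℤ) (hA : A ⊆ Icc 1 (N : ℤ)) (hAc : 0 < A.card)
    (hfree : ∀ a ∈ A, ∀ b ∈ A, a ≠ b → ∀ n : ℕ, 0 < n → a - b ≠ (H d).eval (n : ℤ))
    (θ : ℝ) (hθ : 0 < θ) (hθZ : θ * ((k + 2) * Real.log Z) ≤ 1 / 1000) :
    ∃ (t N' : ℕ) (A' : Finset ℤ), 0 < t ∧ 0 < N' ∧ N' ≤ N ∧ A' ⊆ Icc 1 (N' : ℤ) ∧ 0 < A'.card ∧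
      (∀ a ∈ A', ∀ b ∈ A', a ≠ b → ∀ n : ℕ, 0 < n → a - b ≠ (H (d * t)).eval (n : ℤ)) ∧
      Real.log ((A.card : ℝ) / N) + θ * Real.log ((t : ℝ) * N / N') - 1 / 1000 ≤ Real.log ((A'.card : ℝ) / N') ∧
      (1000 * Z ^ (k + 1) ≤ N' → ∀ (s : ℤ) (τ n : ℕ), 1 ≤ τ → τ ≤ Z → N' ≤ Z * n → n ≤ N' →
        (cnt A' s τ n : ℝ) ≤ 1.01 * ((A'.card : ℝ) / N') * n) := by
  set P : ℕ → ℕ → Finset ℤ → Prop := fun t N' A' => 0 < t ∧ 0 < N' ∧ N' ≤ N ∧ A' ⊆ Icc 1 (N' : ℤ) ∧ 0 < A'.card ∧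
      (∀ a ∈ A', ∀ b ∈ A', a ≠ b → ∀ n : ℕ, 0 < n → a - b ≠ (H (d * t)).eval (n : ℤ)) with hP
  set f : ℕ → ℕ → Finset ℤ → ℝ := fun t N' A' => Real.log ((A'.card : ℝ) / N') - θ * Real.log ((t : ℝ) * N / N') with hf
  set S : Set ℝ := {x | ∃ t N' A', P t N' A' ∧ x = f t N' A'} with hS
  have hNr : (0:ℝ) < N := by exact_mod_cast hN
  have hP0 : P 1 N A := ⟨one_pos, hN, le_rfl, hA, hAc, by rw [mul_one]; exact hfree⟩
  have hbd : ∀ x ∈ S, x ≤ 0 := by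
    rintro x ⟨t, N', A', ⟨h1, h2, h3, h4, h5, h6⟩, rfl⟩
    have h1' : (1:ℝ) ≤ t := by exact_mod_cast h1
    have h2' : (0:ℝ) < N' := by exact_mod_cast h2
    have h3' : (N' : ℝ) ≤ N := by exact_mod_cast h3
    have h7 : (A'.card : ℝ) ≤ N' := by
      have := card_le_card h4
      rw [Int.card_Icc] at this
      exact_mod_cast (by omega : A'.card ≤ N')
    have h8 : Real.log ((A'.card : ℝ) / N') ≤ 0 := Real.log_nonpos (by positivity) (by rw [div_le_one h2']; exact h7)
    have h9 : 0 ≤ Real.log ((t : ℝ) * N / N') := Real.log_nonneg (by rw [le_div_iff₀ h2']; nlinarith)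
    simp only [hf]
    nlinarith
  have hbdd : BddAbove S := ⟨0, hbd⟩
  have hne : S.Nonempty := ⟨_, 1, N, A, hP0, rfl⟩
  obtain ⟨t, N', A', hPt, hsup, h0⟩ : ∃ t N' A', P t N' A' ∧ sSup S - 1 / 1000 < f t N' A' ∧ f 1 N A ≤ f t N' A' + 1 / 1000 := by
    obtain ⟨x, ⟨t, N', A', h1, rfl⟩, h2⟩ := exists_lt_of_lt_csSup hne (by linarith : sSup S - 1 / 1000 < sSup S)
    have := le_csSup hbdd ⟨1, N, A, hP0, rfl⟩
    exact ⟨t, N', A', h1, h2, by linarith⟩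
  obtain ⟨ht, hN', hN'N, hA', hA'c, hfree'⟩ := hPt
  have htr : (0:ℝ) < t := by exact_mod_cast ht
  have hN'r : (0:ℝ) < N' := by exact_mod_cast hN'
  have hZr : (1:ℝ) ≤ Z := by exact_mod_cast hZ
  have hA'r : (0:ℝ) < A'.card := by exact_mod_cast hA'c
  set σ := (A'.card : ℝ) / N' with hσ
  have hσ0 : 0 < σ := by positivity
  refine ⟨t, N', A', ht, hN', hN'N, hA', hA'c, hfree', ?_, ?_⟩
  · simp only [hf, Nat.cast_one, one_mul, div_self hNr.ne', Real.log_one, mul_zero, sub_zero] at h0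
    linarith
  intro hbig
  have hGl : ∀ (s : ℤ) (τ n : ℕ), 1 ≤ τ → τ ≤ Z → 1 ≤ n → n ≤ N' → N' ≤ Z ^ (k + 1) * n →
      (cnt A' s (lam τ) n : ℝ) ≤ 1.003 * σ * n := by
    intro s τ n hτ hτZ hn hnN hNn
    have hnr : (0:ℝ) < n := by exact_mod_cast hn
    have hτr : (1:ℝ) ≤ τ := by exact_mod_cast hτ
    rcases Nat.eq_zero_or_pos (cnt A' s (lam τ) n) with hc | hc
    · rw [hc]; push_cast; positivity
    set A2 : Finset ℤ := ((range n).filter (fun w : ℕ => s + lam τ * w ∈ A')).image (fun w : ℕ => (w : ℤ) + 1) with hA2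
    have hA2c : A2.card = cnt A' s (lam τ) n := card_image_of_injective _ fun a b hab => by
      have h' : (a : ℤ) + 1 = b + 1 := hab
      omega
    have hA2m : ∀ x ∈ A2, 1 ≤ x ∧ x ≤ n ∧ s + lam τ * (x - 1) ∈ A' := by
      intro x hx
      rw [hA2, mem_image] at hx
      obtain ⟨w, hw, rfl⟩ := hx
      rw [mem_filter, mem_range] at hw
      refine ⟨by omega, by omega, by simpa using hw.2⟩
    have hlp := hHD.lam_pos τ hτ
    have hP2 : P (t * τ) n A2 := by
      refine ⟨Nat.mul_pos ht hτ, hn, hnN.trans hN'N, fun x hx => mem_Icc.mpr ⟨(hA2m x hx).1, (hA2m x hx).2.1⟩, by omega, ?_⟩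
      intro a ha b hb hab m hm heq
      obtain ⟨m', hm', hmm⟩ := hHD.sub (d * t) τ (Nat.mul_pos hd ht) hτ m hm
      rw [mul_assoc, ← heq] at hmm
      have hlp' : (0:ℤ) < lam τ := by exact_mod_cast hlp
      refine hfree' _ (hA2m a ha).2.2 _ (hA2m b hb).2.2 (fun h => hab ?_) m' hm' ?_
      · have h1 : (lam τ : ℤ) * (a - b) = 0 := by linear_combination h
        rcases mul_eq_zero.mp h1 with h2 | h2 <;> omega
      · rw [← hmm]; ring
    have hle := (le_csSup hbdd ⟨t * τ, n, A2, hP2, rfl⟩ : f (t * τ) n A2 ≤ sSup S)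
    have hlt : f (t * τ) n A2 < f t N' A' + 1 / 1000 := by linarith
    simp only [hf, hA2c] at hlt
    have hcr : (0:ℝ) < cnt A' s (lam τ) n := by exact_mod_cast hc
    have e1 : Real.log (((t * τ : ℕ) : ℝ) * N / n) = Real.log ((t : ℝ) * N / N') + Real.log (τ * N' / n) := by
      rw [← Real.log_mul (by positivity) (by positivity)]
      congr 1; push_cast; field_simp
    have e2 : Real.log (τ * N' / n) ≤ (k + 2) * Real.log Z := by
      have : (((k + 2 : ℕ) : ℝ)) * Real.log Z = Real.log ((Z : ℝ) ^ (k + 2)) := by rw [Real.log_pow]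
      push_cast at this
      rw [this]
      refine Real.log_le_log (by positivity) ?_
      rw [div_le_iff₀ hnr]
      have a1 : (τ : ℝ) ≤ Z := by exact_mod_cast hτZ
      have a2 : (N' : ℝ) ≤ (Z : ℝ) ^ (k + 1) * n := by exact_mod_cast hNn
      calc (τ : ℝ) * N' ≤ Z * ((Z : ℝ) ^ (k + 1) * n) := by gcongr
        _ = _ := by ring
    rw [e1] at hlt
    have e3 : θ * Real.log (τ * N' / n) ≤ 1 / 1000 := le_trans (mul_le_mul_of_nonneg_left e2 hθ.le) hθZ
    have e4 : Real.log ((cnt A' s (lam τ) n : ℝ) / n) ≤ Real.log (1.003 * σ) := by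
      rw [Real.log_mul (by norm_num) hσ0.ne']
      have e5 : (1:ℝ) / 500 ≤ Real.log 1.003 := by
        rw [Real.le_log_iff_exp_le (by norm_num)]
        have := Real.exp_bound_div_one_sub_of_interval (x := 1 / 500) (by norm_num) (by norm_num)
        refine this.trans ?_
        norm_num
      rw [mul_add] at hlt
      linarith
    have e6 := (Real.log_le_log_iff (by positivity) (by positivity)).mp e4
    rw [div_le_iff₀ hnr] at e6
    exact e6
  intro s τ n hτ hτZ hNn hnN
  obtain ⟨u, hu⟩ := hHD.dvd_lam τ hτ
  have hlp := hHD.lam_pos τ hτ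
  have hu0 : 0 < u := by rcases Nat.eq_zero_or_pos u with h | h; · rw [h] at hu; omega
                         · exact h
  have huZ : u ≤ Z ^ k := by
    have h1 : lam τ ≤ τ ^ k := Nat.le_of_dvd (pow_pos hτ k) (hHD.lam_dvd τ hτ)
    calc u ≤ τ * u := Nat.le_mul_of_pos_left _ hτ
      _ ≤ τ ^ k := by rw [← hu]; exact h1
      _ ≤ Z ^ k := Nat.pow_le_pow_left hτZ k
  have hn1000 : 1000 * u ≤ n := by
    have h1 : Z * (1000 * Z ^ k) ≤ Z * n := le_trans (by rw [pow_succ] at hbig; linarith) hNn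
    have h2 := Nat.le_of_mul_le_mul_left h1 hZ
    omega
  set n' := (n + u - 1) / u with hn'
  have hn'1 : 1 ≤ n' := by rw [hn', Nat.le_div_iff_mul_le hu0]; omega
  have hn'u : u * n' ≤ n + u - 1 := Nat.mul_div_le _ _
  have hn'l : n ≤ u * n' := by
    have := Nat.lt_mul_div_succ (n + u - 1) hu0
    rw [← hn', mul_add] at this
    omega
  have hn'n : n' ≤ n := by
    by_contra h
    have : u * (n + 1) ≤ u * n' := Nat.mul_le_mul_left _ (by omega)
    have h2 : 1 * n ≤ u * n := Nat.mul_le_mul_right _ hu0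
    rw [mul_add] at this
    omega
  have hsplit : cnt A' s τ n ≤ ∑ v ∈ range u, cnt A' (s + τ * v) (lam τ) n' := by
    rw [cnt, card_eq_sum_card_fiberwise (f := fun w => w % u) (t := range u) (fun w _ => mem_coe.mpr (mem_range.mpr (Nat.mod_lt w hu0)))]
    refine sum_le_sum fun v hv => ?_
    rw [cnt]
    refine card_le_card_of_injOn (fun w => w / u) (fun w hw => ?_) (fun x hx y hy hxy => ?_)
    · simp only [mem_coe, mem_filter, mem_range] at hw ⊢
      have hw2 := Nat.mod_add_div w u
      rw [hw.2] at hw2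
      refine ⟨(Nat.div_lt_iff_lt_mul hu0).mpr (by rw [mul_comm]; omega), ?_⟩
      have h3 : (w : ℤ) = v + u * (w / u : ℕ) := by exact_mod_cast hw2.symm
      have h4 := hw.1.2
      rw [h3] at h4
      rw [hu]
      convert h4 using 1
      push_cast
      ring
    · simp only [mem_coe, mem_filter] at hx hy
      rw [← Nat.mod_add_div x u, ← Nat.mod_add_div y u, hx.2, hy.2, show x / u = y / u from hxy]
  have hterm : ∀ v ∈ range u, (cnt A' (s + τ * v) (lam τ) n' : ℝ) ≤ 1.003 * σ * n' := fun v _ => by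
    refine hGl _ τ n' hτ hτZ hn'1 (hn'n.trans hnN) ?_
    calc N' ≤ Z * n := hNn
      _ ≤ Z * (Z ^ k * n') := Nat.mul_le_mul_left _ (hn'l.trans (Nat.mul_le_mul_right _ huZ))
      _ = _ := by ring
  have h5 : (u : ℝ) * n' ≤ 1.001 * n := by
    have a1 : ((1000 * (u * n') : ℕ) : ℝ) ≤ ((1001 * n : ℕ) : ℝ) := by exact_mod_cast (by omega)
    push_cast at a1
    linarith
  calc (cnt A' s τ n : ℝ) ≤ ∑ v ∈ range u, (cnt A' (s + τ * v) (lam τ) n' : ℝ) := by exact_mod_cast hsplit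
    _ ≤ ∑ v ∈ range u, 1.003 * σ * n' := sum_le_sum hterm
    _ = 1.003 * σ * (u * n') := by rw [sum_const, card_range, nsmul_eq_mul]; ring
    _ ≤ 1.003 * σ * (1.001 * n) := by gcongr
    _ ≤ 1.01 * σ * n := by nlinarith [mul_nonneg hσ0.le (Nat.cast_nonneg (α := ℝ) n)]
end

section
open Finset Real

theorem pw {v : ℝ} (hv : 1 ≤ v) {i j : ℕ} (h : i ≤ j) : v ^ i ≤ v ^ j := pow_le_pow_right₀ hv h

theorem le_exp_self (a : ℝ) : a ≤ exp a := by linarith [add_one_le_exp a]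

set_option maxHeartbeats 1000000 in
theorem params (k C0 c1 x : ℕ) (hC0 : 1 ≤ C0) (hx : 1000000 * ((k + 1) * C0 * (c1 + 1)) ≤ x) :
    ∃ (Q0 E yy J m : ℕ) (Y K : ℝ), (∀ σ : ℝ, exp (-(x : ℝ) ^ 14) ≤ σ → (4 * C0 / σ) ^ C0 ≤ Q0 ∧ 8 * k ≤ σ * Q0 ∧
      c1 * Q0 ≤ σ * E ∧ 5 * (2 * (Q0 : ℝ) ^ 2) ^ (2 * J) * (50 ^ m) ^ J * (4 * 50 ^ m) ^ m ≤ 2 * σ * K ^ m) ∧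
      2 ≤ Q0 ∧ 1000 ≤ E ∧ 1 ≤ Y ∧ Y ^ C0 ≤ yy + 1 ∧ (Q0 : ℝ) < (Y ^ C0) ^ (J + 1) ∧ 8000 * C0 * K ≤ Y ∧ 1 ≤ m ∧ 1 ≤ J ∧
      4 * 50 ^ m ≤ K ∧ (Q0 : ℝ) ≤ exp ((x : ℝ) ^ 15 + 1) ∧
      ((2 * E * Q0 ^ (yy + J) : ℕ) : ℝ) ≤ exp (exp ((x : ℝ) ^ 12 / 4) * (x : ℝ) ^ 16) ∧
      ((2 * E * Q0 ^ yy * (9 ^ m * (2 * Q0 ^ 2) ^ (4 * J * m)) : ℕ) : ℝ) ≤ exp (exp ((x : ℝ) ^ 12 / 4) * (x : ℝ) ^ 16) ∧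
      (x : ℝ) ^ 35 ≤ exp ((x : ℝ) ^ 12 / 4) := by
  set v : ℝ := (x : ℝ) with hv
  have hk0 : (0:ℝ) ≤ k := Nat.cast_nonneg k
  have hc0 : (0:ℝ) ≤ c1 := Nat.cast_nonneg c1
  have hC0r : (1:ℝ) ≤ C0 := by exact_mod_cast hC0
  have hxv : 1000000 * ((k + 1) * C0 * (c1 + 1)) ≤ v := by rw [hv]; exact_mod_cast hx
  have b1 : 1000000 * (C0 : ℝ) ≤ v := le_trans (by
    have : (1:ℝ) ≤ (k + 1) * (c1 + 1) := by nlinarith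
    nlinarith) hxv
  have b2 : 1000000 * ((k : ℝ) + 1) ≤ v := le_trans (by
    have : (1:ℝ) ≤ C0 * (c1 + 1) := by nlinarith
    nlinarith) hxv
  have b3 : 1000000 * ((c1 : ℝ) + 1) ≤ v := le_trans (by
    have : (1:ℝ) ≤ (k + 1) * C0 := by nlinarith
    nlinarith) hxv
  clear hxv
  have b0 : 1000000 ≤ v := by linarith
  have v1 : 1 ≤ v := by linarith
  have v0 : 0 < v := by linarith
  have st : ∀ i j : ℕ, j = i + 1 → 1000000 * v ^ i ≤ v ^ j := fun i j h => by
    rw [h, pow_succ']; exact mul_le_mul_of_nonneg_right b0 (by positivity)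
  have stC : ∀ i j : ℕ, j = i + 1 → 1000000 * C0 * v ^ i ≤ v ^ j := fun i j h => by
    rw [h, pow_succ']; exact mul_le_mul_of_nonneg_right b1 (by positivity)
  have p1 : ∀ i : ℕ, 1 ≤ v ^ i := fun i => one_le_pow₀ v1
  have vle : ∀ i : ℕ, 1 ≤ i → v ≤ v ^ i := fun i hi => le_self_pow₀ v1 (by omega)
  set U := exp (v ^ 12 / 4) with hU
  have hU35 : v ^ 35 ≤ U := by
    have := pow_div_factorial_le_exp (v ^ 12 / 4) (by positivity) 3
    refine le_trans ?_ this
    have h := st 35 36 rfl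
    rw [show Nat.factorial 3 = 6 by rfl, show ((v ^ 12 / 4) ^ 3 / ((6:ℕ):ℝ)) = v ^ 36 / 384 by push_cast; ring]
    have := p1 35
    linarith
  have hU0 : 0 < U := exp_pos _
  set Q0 := ⌈exp (v ^ 15)⌉₊ with hQ0
  set E := ⌈exp (v ^ 16)⌉₊ with hE
  have ceilb : ∀ a : ℝ, 0 ≤ a → ((⌈exp a⌉₊ : ℕ) : ℝ) ≤ exp (a + 1) := fun a ha => by
    have h1 := (Nat.ceil_lt_add_one (exp_pos a).le).le
    have h2 : 1 ≤ exp a := one_le_exp ha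
    have h3 : exp a * 2 ≤ exp a * exp 1 := by gcongr; linarith [add_one_le_exp (1:ℝ)]
    rw [exp_add]; linarith
  have hQl : exp (v ^ 15) ≤ Q0 := Nat.le_ceil _
  have hQu : (Q0 : ℝ) ≤ exp (v ^ 15 + 1) := ceilb _ (by positivity)
  have hEl : exp (v ^ 16) ≤ E := Nat.le_ceil _
  have hEu : (E : ℝ) ≤ exp (v ^ 16 + 1) := ceilb _ (by positivity)
  have e2 : (2:ℝ) ≤ exp 1 := by linarith [add_one_le_exp (1:ℝ)]
  have e50 : (50:ℝ) ≤ exp 4 := by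
    have : exp (4:ℝ) = exp 1 ^ 4 := by rw [← exp_nat_mul]; norm_num
    rw [this]
    have h27 : (2.7:ℝ) ≤ exp 1 := by linarith [exp_one_gt_d9]
    calc (50:ℝ) ≤ 2.7 ^ 4 := by norm_num
      _ ≤ _ := by gcongr
  have e4 : (4:ℝ) ≤ exp 2 := by
    have : exp (2:ℝ) = exp 1 ^ 2 := by rw [← exp_nat_mul]; norm_num
    rw [this]; nlinarith
  have hQ2 : 2 * (Q0 : ℝ) ^ 2 ≤ exp (2 * v ^ 15 + 3) := by
    calc 2 * (Q0 : ℝ) ^ 2 ≤ exp 1 * (exp (v ^ 15 + 1)) ^ 2 := by gcongr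
      _ = _ := by rw [← exp_nat_mul, ← exp_add]; congr 1; push_cast; ring
  have hyyU : ((⌊U⌋₊ : ℕ) : ℝ) ≤ U := Nat.floor_le hU0.le
  have hx0 : 1 ≤ x := by
    have : (1:ℝ) ≤ x := v1
    exact_mod_cast this
  have h50 : ∀ n : ℕ, (50:ℝ) ^ n ≤ exp (4 * n) := fun n => by
    calc (50:ℝ) ^ n ≤ exp 4 ^ n := by gcongr
      _ = _ := by rw [← exp_nat_mul]; congr 1; ring
  have hYC : exp (v ^ 12 / (4 * C0)) ^ C0 = U := by
    rw [← exp_nat_mul, hU]; congr 1; field_simp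
  have hUv : v ^ 50 ≤ U * v ^ 15 := by
    rw [show v ^ 50 = v ^ 35 * v ^ 15 by ring]; gcongr
  have hU16 : U * v ^ 16 = (U * v ^ 15) * v := by ring
  have hU16' : 1000000 * (U * v ^ 15) ≤ U * v ^ 16 := by rw [hU16]; nlinarith [mul_pos hU0 (pow_pos v0 15)]
  have hUU : U ≤ U * v ^ 15 := le_mul_of_one_le_right hU0.le (p1 15)
  have hm50 : 4 * (50:ℝ) ^ (x ^ 9) ≤ exp (2 + 4 * v ^ 9) := by
    rw [exp_add]
    have := h50 (x ^ 9)
    push_cast at this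
    gcongr
  refine ⟨Q0, E, ⌊U⌋₊, x ^ 4, x ^ 9, exp (v ^ 12 / (4 * C0)), exp (v ^ 12 / (8 * C0)), ?_, ?_, ?_, ?_, ?_, ?_, ?_, ?_, ?_, ?_, hQu, ?_, ?_, hU35⟩
  · intro σ hσ
    have hσ0 : 0 < σ := (exp_pos _).trans_le hσ
    refine ⟨?_, ?_, ?_, ?_⟩
    · have h1 : 4 * C0 / σ ≤ exp (v + v ^ 14) := by
        rw [div_le_iff₀ hσ0]
        calc 4 * (C0 : ℝ) ≤ exp v := by linarith [le_exp_self v]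
          _ = exp (v + v ^ 14) * exp (-v ^ 14) := by rw [← exp_add]; congr 1; ring
          _ ≤ _ := by gcongr
      calc (4 * C0 / σ) ^ C0 ≤ exp (v + v ^ 14) ^ C0 := by gcongr
        _ = exp (C0 * (v + v ^ 14)) := by rw [← exp_nat_mul]
        _ ≤ exp (v ^ 15) := by
            refine exp_le_exp.mpr ?_
            have a1 := stC 14 15 rfl
            have a2 := vle 14 (by norm_num)
            nlinarith
        _ ≤ Q0 := hQl
    · calc 8 * (k : ℝ) ≤ exp v := by linarith [le_exp_self v]
        _ ≤ exp (-v ^ 14 + v ^ 15) := by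
            refine exp_le_exp.mpr ?_
            have a1 := st 14 15 rfl
            have a2 := vle 14 (by norm_num)
            linarith
        _ = exp (-v ^ 14) * exp (v ^ 15) := exp_add _ _
        _ ≤ σ * Q0 := by gcongr
    · calc (c1 : ℝ) * Q0 ≤ exp v * exp (v ^ 15 + 1) := by gcongr; linarith [le_exp_self v]
        _ = exp (v + (v ^ 15 + 1)) := (exp_add _ _).symm
        _ ≤ exp (-v ^ 14 + v ^ 16) := by
            refine exp_le_exp.mpr ?_
            have a1 := st 15 16 rfl
            have a3 := vle 15 (by norm_num)
            have a4 : v ^ 14 ≤ v ^ 15 := pw v1 (by norm_num)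
            linarith
        _ = exp (-v ^ 14) * exp (v ^ 16) := exp_add _ _
        _ ≤ σ * E := by gcongr
    · have h1 : (2 * (Q0 : ℝ) ^ 2) ^ (2 * x ^ 4) ≤ exp ((2 * v ^ 4) * (2 * v ^ 15 + 3)) := by
        calc _ ≤ exp (2 * v ^ 15 + 3) ^ (2 * x ^ 4) := by gcongr
          _ = _ := by rw [← exp_nat_mul]; push_cast; rfl
      have h2 : ((50:ℝ) ^ (x ^ 9)) ^ (x ^ 4) ≤ exp (4 * v ^ 13) := by
        rw [← pow_mul]
        refine (h50 _).trans (le_of_eq ?_)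
        push_cast; congr 1; ring
      have h3 : (4 * (50:ℝ) ^ (x ^ 9)) ^ (x ^ 9) ≤ exp (v ^ 9 * (2 + 4 * v ^ 9)) := by
        calc _ ≤ exp (2 + 4 * v ^ 9) ^ (x ^ 9) := by gcongr
          _ = _ := by rw [← exp_nat_mul]; push_cast; rfl
      have h5 : (5:ℝ) ≤ exp 4 := by linarith
      calc _ ≤ exp 4 * exp ((2 * v ^ 4) * (2 * v ^ 15 + 3)) * exp (4 * v ^ 13) * exp (v ^ 9 * (2 + 4 * v ^ 9)) := by gcongr
        _ = exp (4 + (2 * v ^ 4) * (2 * v ^ 15 + 3) + 4 * v ^ 13 + v ^ 9 * (2 + 4 * v ^ 9)) := by rw [exp_add, exp_add, exp_add]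
        _ ≤ exp (-v ^ 14 + v ^ 9 * (v ^ 12 / (8 * C0))) := by
            refine exp_le_exp.mpr ?_
            have a1 : 125000 * v ^ 20 ≤ v ^ 9 * (v ^ 12 / (8 * C0)) := by
              rw [show v ^ 9 * (v ^ 12 / (8 * C0)) = v ^ 21 / (8 * C0) by ring, le_div_iff₀ (by positivity)]
              linarith [stC 20 21 rfl]
            have a2 : v ^ 19 ≤ v ^ 20 := pw v1 (by norm_num)
            have a3 : v ^ 4 ≤ v ^ 20 := pw v1 (by norm_num)
            have a4 : v ^ 13 ≤ v ^ 20 := pw v1 (by norm_num)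
            have a5 : v ^ 9 ≤ v ^ 20 := pw v1 (by norm_num)
            have a6 : v ^ 18 ≤ v ^ 20 := pw v1 (by norm_num)
            have a7 : v ^ 14 ≤ v ^ 20 := pw v1 (by norm_num)
            have a8 := p1 20
            have a9 : (2 * v ^ 4) * (2 * v ^ 15 + 3) = 4 * v ^ 19 + 6 * v ^ 4 := by ring
            have a10 : v ^ 9 * (2 + 4 * v ^ 9) = 2 * v ^ 9 + 4 * v ^ 18 := by ring
            linarith
        _ = exp (-v ^ 14) * exp (v ^ 12 / (8 * C0)) ^ (x ^ 9) := by rw [exp_add, ← exp_nat_mul]; push_cast; rfl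
        _ ≤ σ * exp (v ^ 12 / (8 * C0)) ^ (x ^ 9) := by gcongr
        _ ≤ 2 * σ * exp (v ^ 12 / (8 * C0)) ^ (x ^ 9) := by gcongr; linarith
  · have h1 : (2:ℝ) ≤ Q0 := by linarith [add_one_le_exp (v ^ 15), p1 15]
    exact_mod_cast h1
  · have h1 : (1000:ℝ) ≤ E := by linarith [add_one_le_exp (v ^ 16), vle 16 (by norm_num)]
    exact_mod_cast h1
  · exact one_le_exp (by positivity)
  · rw [hYC]; exact (Nat.lt_floor_add_one U).le
  · rw [hYC]
    refine lt_of_le_of_lt hQu ?_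
    rw [hU, ← exp_nat_mul, exp_lt_exp]
    push_cast
    have a1 := st 15 16 rfl
    have a2 : (v ^ 4 + 1) * (v ^ 12 / 4) = v ^ 16 / 4 + v ^ 12 / 4 := by ring
    rw [← hv, a2]
    linarith [p1 15, p1 12]
  · calc 8000 * (C0 : ℝ) * exp (v ^ 12 / (8 * C0)) ≤ exp (v ^ 12 / (8 * C0)) * exp (v ^ 12 / (8 * C0)) := by
          gcongr
          refine le_trans ?_ (le_exp_self _)
          rw [le_div_iff₀ (by positivity)]
          have a1 := stC 11 12 rfl
          have a2 := vle 11 (by norm_num)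
          calc 8000 * (C0 : ℝ) * (8 * C0) = 64000 * C0 * C0 := by ring
            _ ≤ 1000000 * C0 * v ^ 11 := by
                have : (C0 : ℝ) ≤ v ^ 11 := by linarith
                gcongr
                norm_num
            _ ≤ _ := a1
      _ = _ := by rw [← exp_add]; congr 1; field_simp; norm_num
  · exact Nat.one_le_pow _ _ hx0
  · exact Nat.one_le_pow _ _ hx0
  · refine hm50.trans (exp_le_exp.mpr ?_)
    rw [le_div_iff₀ (by positivity)]
    have a1 := stC 11 12 rfl
    have a2 : C0 * v ^ 9 ≤ C0 * v ^ 11 := mul_le_mul_of_nonneg_left (pw v1 (by norm_num)) (by linarith)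
    have a3 : (C0 : ℝ) ≤ C0 * v ^ 11 := le_mul_of_one_le_right (by linarith) (p1 11)
    nlinarith
  · push_cast
    calc 2 * (E : ℝ) * (Q0 : ℝ) ^ (⌊U⌋₊ + x ^ 4) ≤ exp 1 * exp (v ^ 16 + 1) * exp (v ^ 15 + 1) ^ (⌊U⌋₊ + x ^ 4) := by gcongr
      _ = exp (1 + (v ^ 16 + 1) + (⌊U⌋₊ + v ^ 4) * (v ^ 15 + 1)) := by
          rw [← exp_nat_mul, ← exp_add, ← exp_add]; push_cast; rfl
      _ ≤ exp (1 + (v ^ 16 + 1) + (U + v ^ 4) * (v ^ 15 + 1)) := by gcongr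
      _ ≤ _ := by
          refine exp_le_exp.mpr ?_
          have a1 : v ^ 16 ≤ v ^ 50 := pw v1 (by norm_num)
          have a2 : v ^ 19 ≤ v ^ 50 := pw v1 (by norm_num)
          have a3 : v ^ 4 ≤ v ^ 50 := pw v1 (by norm_num)
          have a4 := p1 50
          have a5 : (U + v ^ 4) * (v ^ 15 + 1) = U * v ^ 15 + U + v ^ 19 + v ^ 4 := by ring
          linarith
  · push_cast
    have h9 : (9:ℝ) ^ (x ^ 9) ≤ exp (4 * v ^ 9) := by
      have := h50 (x ^ 9)
      push_cast at this
      exact le_trans (pow_le_pow_left₀ (by norm_num) (by norm_num) _) this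
    have h10 : (2 * (Q0 : ℝ) ^ 2) ^ (4 * x ^ 4 * x ^ 9) ≤ exp ((4 * v ^ 4 * v ^ 9) * (2 * v ^ 15 + 3)) := by
      calc _ ≤ exp (2 * v ^ 15 + 3) ^ (4 * x ^ 4 * x ^ 9) := by gcongr
        _ = _ := by rw [← exp_nat_mul]; push_cast; rfl
    calc 2 * (E : ℝ) * (Q0 : ℝ) ^ ⌊U⌋₊ * (9 ^ (x ^ 9) * (2 * (Q0 : ℝ) ^ 2) ^ (4 * x ^ 4 * x ^ 9)) ≤
          exp 1 * exp (v ^ 16 + 1) * exp (v ^ 15 + 1) ^ ⌊U⌋₊ * (exp (4 * v ^ 9) * exp ((4 * v ^ 4 * v ^ 9) * (2 * v ^ 15 + 3))) := by gcongr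
      _ = exp (1 + (v ^ 16 + 1) + ⌊U⌋₊ * (v ^ 15 + 1) + (4 * v ^ 9 + (4 * v ^ 4 * v ^ 9) * (2 * v ^ 15 + 3))) := by
          rw [← exp_nat_mul]; simp only [← exp_add]
      _ ≤ exp (1 + (v ^ 16 + 1) + U * (v ^ 15 + 1) + (4 * v ^ 9 + (4 * v ^ 4 * v ^ 9) * (2 * v ^ 15 + 3))) := by gcongr
      _ ≤ _ := by
          refine exp_le_exp.mpr ?_
          have a1 : v ^ 16 ≤ v ^ 50 := pw v1 (by norm_num)
          have a2 : v ^ 28 ≤ v ^ 50 := pw v1 (by norm_num)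
          have a3 : v ^ 9 ≤ v ^ 50 := pw v1 (by norm_num)
          have a6 : v ^ 13 ≤ v ^ 50 := pw v1 (by norm_num)
          have a4 := p1 50
          have a5 : (4 * v ^ 4 * v ^ 9) * (2 * v ^ 15 + 3) = 8 * v ^ 28 + 12 * v ^ 13 := by ring
          linarith
end

section
open Finset Real

theorem xexists (N x0 : ℕ) (hN : exp (exp ((x0 : ℝ) ^ 12)) ≤ N) : ∃ x : ℕ, x0 ≤ x ∧
    exp ((x : ℝ) ^ 12) ≤ log N ∧ log (log N) ≤ ((x : ℝ) + 1) ^ 12 := by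
  have hL : exp ((x0 : ℝ) ^ 12) ≤ log N := by
    rw [← log_exp (exp _)]; exact log_le_log (exp_pos _) hN
  have hD : (x0 : ℝ) ^ 12 ≤ log (log N) := by
    rw [← log_exp ((x0 : ℝ) ^ 12)]; exact log_le_log (exp_pos _) hL
  have hL0 : 0 < log N := lt_of_lt_of_le (exp_pos _) hL
  set D := log (log N) with hDd
  have hD0 : 0 ≤ D := le_trans (by positivity) hD
  have hp : (D ^ ((1:ℝ) / 12)) ^ 12 = D := by
    rw [← rpow_natCast, ← rpow_mul hD0]; norm_num
  have hr0 : 0 ≤ D ^ ((1:ℝ) / 12) := rpow_nonneg hD0 _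
  refine ⟨⌊D ^ ((1:ℝ) / 12)⌋₊, ?_, ?_, ?_⟩
  · apply Nat.le_floor
    apply le_of_pow_le_pow_left₀ (n := 12) (by norm_num) hr0
    rw [hp]; exact hD
  · have : ((⌊D ^ ((1:ℝ) / 12)⌋₊ : ℕ) : ℝ) ^ 12 ≤ D := by
      conv_rhs => rw [← hp]
      gcongr
      exact Nat.floor_le hr0
    calc _ ≤ exp D := exp_le_exp.mpr this
      _ = _ := exp_log hL0
  · conv_lhs => rw [← hp]
    gcongr
    exact (Nat.lt_floor_add_one _).le

theorem sig_bound (L v σ : ℝ) (hv : 1000000 ≤ v) (h1 : exp (v ^ 12) ≤ L) (h2 : log L ≤ (v + 1) ^ 12)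
    (hσ : L ^ (-log (log L)) < σ) : 0 < σ ∧ -(v ^ 14) + 1 ≤ log σ := by
  have hL0 : 0 < L := lt_of_lt_of_le (exp_pos _) h1
  have hD : v ^ 12 ≤ log L := by rw [← log_exp (v ^ 12)]; exact log_le_log (exp_pos _) h1
  have hv0 : 0 < v := by linarith
  have hv1 : 1 ≤ v := by linarith
  have hD0 : 0 < log L := lt_of_lt_of_le (by positivity) hD
  rw [rpow_def_of_pos hL0] at hσ
  have hs : 0 < σ := lt_trans (exp_pos _) hσ
  refine ⟨hs, ?_⟩
  have h3 : log L * -log (log L) ≤ log σ := by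
    rw [← log_exp (log L * _)]; exact log_le_log (exp_pos _) hσ.le
  have h4 : log (log L) ≤ 12 * v := by
    calc _ ≤ log ((v + 1) ^ 12) := log_le_log hD0 h2
      _ = 12 * log (v + 1) := by rw [log_pow]; norm_num
      _ ≤ _ := by linarith [log_le_sub_one_of_pos (show 0 < v + 1 by linarith)]
  have h5 : log L * log (log L) ≤ 49152 * v ^ 13 := by
    calc _ ≤ log L * (12 * v) := by gcongr
      _ ≤ (v + 1) ^ 12 * (12 * v) := by gcongr
      _ ≤ (2 * v) ^ 12 * (12 * v) := by gcongr; linarith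
      _ = _ := by ring
  have h6 : (1:ℝ) ≤ v ^ 13 := one_le_pow₀ hv1
  have h7 : v ^ 14 = v * v ^ 13 := by ring
  nlinarith

set_option maxHeartbeats 2000000 in
theorem final {k : ℕ} {lam : ℕ → ℕ} {H : ℕ → Polynomial ℤ} {b G Ch : ℕ} (hk : 0 < k) (hHD : HD k lam H b G Ch) :
    ∃ N₀ : ℕ, ∀ N : ℕ, N₀ ≤ N → ∀ d : ℕ, 0 < d →
      (d : ℝ) ≤ (N : ℝ) ^ ((1 : ℝ) / ((2 : ℝ) ^ (k + 2) * (k : ℝ) ^ 2)) →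
      ∀ A : Finset ℤ, A ⊆ Icc 1 (N : ℤ) →
        (∀ a ∈ A, ∀ b ∈ A, a ≠ b → ∀ n : ℕ, 0 < n → a - b ≠ (H d).eval (n : ℤ)) →
        Real.log N ^ (-Real.log (Real.log (Real.log N))) < (A.card : ℝ) / N → False := by
  obtain ⟨C0, c1, hC0, hcore⟩ := core2 hHD
  refine ⟨⌈exp (exp (((1000000 * ((k + 1) * C0 * (c1 + 1)) : ℕ) : ℝ) ^ 12))⌉₊, ?_⟩
  intro N hN d hd hdN A hA hfree hσ
  obtain ⟨x, hx, hx1, hx2⟩ := xexists N _ ((Nat.le_ceil _).trans (by exact_mod_cast hN))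
  obtain ⟨Q0, E, yy, J, m, Y, K, hpσ, hQ2, hE, hY, hYy, hYJ, hYK, hm, hJ, hK, hQx, hZ, hZ2, hU⟩ :=
    params k C0 c1 x hC0 hx
  have hC0r : (1:ℝ) ≤ C0 := by exact_mod_cast hC0
  have hkr : (1:ℝ) ≤ k := by exact_mod_cast hk
  have hc0 : (0:ℝ) ≤ c1 := Nat.cast_nonneg c1
  set v : ℝ := (x : ℝ) with hvd
  have hxv : 1000000 * ((k + 1) * C0 * (c1 + 1)) ≤ v := by rw [hvd]; exact_mod_cast hx
  have b2 : 1000000 * ((k : ℝ) + 1) ≤ v := le_trans (by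
    have : (1:ℝ) ≤ C0 * (c1 + 1) := by nlinarith
    nlinarith) hxv
  have b3 : 1000000 * ((c1 : ℝ) + 1) ≤ v := le_trans (by
    have : (1:ℝ) ≤ (k + 1) * C0 := by nlinarith
    nlinarith) hxv
  have b0 : 1000000 ≤ v := by linarith
  have v1 : 1 ≤ v := by linarith
  have v0 : 0 < v := by linarith
  obtain ⟨hσ0, hlσ⟩ := sig_bound (log N) v _ b0 hx1 hx2 hσ
  set L := log (N : ℝ) with hL
  set U := exp (v ^ 12 / 4) with hUd
  have hU4 : U ^ 4 ≤ L := by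
    rw [hUd, ← exp_nat_mul]
    refine le_trans (le_of_eq ?_) hx1
    congr 1; push_cast; ring
  have hU0 : 0 < U := exp_pos _
  have hUb : 1000000 ≤ U := by
    refine le_trans ?_ hU
    calc (1000000:ℝ) ≤ v ^ 1 := by simpa using b0
      _ ≤ v ^ 35 := pw v1 (by norm_num)
  have hUv : ∀ i, i ≤ 35 → v ^ i ≤ U := fun i hi => (pw v1 hi).trans hU
  have hL0 : 0 < L := lt_of_lt_of_le (by positivity) hU4
  have hN0 : 0 < N := by
    rcases Nat.eq_zero_or_pos N with h | h
    · subst h; simp [hL] at hL0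
    · exact h
  have hNr : (0:ℝ) < N := by exact_mod_cast hN0
  have hAc : 0 < A.card := by
    rcases Nat.eq_zero_or_pos A.card with h | h
    · rw [h] at hσ0; simp at hσ0
    · exact h
  set Z := 2 * E * Q0 ^ (yy + J) with hZd
  have hZ1 : 1 ≤ Z := by
    have : 0 < Q0 ^ (yy + J) := by positivity
    rw [hZd]; exact Nat.succ_le_of_lt (Nat.mul_pos (by omega) this)
  have hZr : (1:ℝ) ≤ Z := by exact_mod_cast hZ1
  have hlZ : log Z ≤ U * v ^ 16 := by
    rw [← log_exp (U * _)]; exact log_le_log (by linarith) hZ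
  have hlZ0 : 0 ≤ log Z := log_nonneg hZr
  have hθZ : (1 / U ^ 2) * ((k + 2) * Real.log Z) ≤ 1 / 1000 := by
    rw [div_mul_eq_mul_div, one_mul, div_le_iff₀ (by positivity)]
    have h1 : (k + 2) * Real.log Z ≤ (v / 1000) * (U * v ^ 16) := by
      gcongr; linarith
    have h2 : v ^ 17 ≤ U := hUv 17 (by norm_num)
    have h3 : v ^ 17 * U ≤ U * U := by gcongr
    have h4 : (v / 1000) * (U * v ^ 16) = v ^ 17 * U / 1000 := by ring
    have h5 : 1 / 1000 * U ^ 2 = U * U / 1000 := by ring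
    linarith
  obtain ⟨t, N', A', ht, hN', hNN, hA', hAc', hfree', hpot, hG⟩ :=
    potential hHD N d Z hN0 hd hZ1 A hA hAc hfree (1 / U ^ 2) (by positivity) hθZ
  have htr : (1:ℝ) ≤ t := by exact_mod_cast ht
  have hdr : (1:ℝ) ≤ d := by exact_mod_cast hd
  have hNr' : (0:ℝ) < N' := by exact_mod_cast hN'
  have hNNr : (N':ℝ) ≤ N := by exact_mod_cast hNN
  have hAcr : (0:ℝ) < A'.card := by exact_mod_cast hAc'
  set σ' : ℝ := (A'.card : ℝ) / N' with hσ'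
  have hσ'0 : 0 < σ' := by positivity
  have hσN : σ' * N' = A'.card := by rw [hσ']; field_simp
  have hσ'1 : σ' ≤ 1 := by
    rw [hσ', div_le_one hNr']
    have := card_le_card hA'
    rw [Int.card_Icc] at this
    have h2 : A'.card ≤ N' := by omega
    exact_mod_cast h2
  have hlσ1 : log σ' ≤ 0 := log_nonpos hσ'0.le hσ'1
  have hT : log ((t : ℝ) * N / N') = log t + (L - log N') := by
    rw [log_div (by positivity) (by positivity), log_mul (by positivity) (by positivity)]; ring
  have hlt : 0 ≤ log (t:ℝ) := log_nonneg htr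
  have hld : 0 ≤ log (d:ℝ) := log_nonneg hdr
  have hlN : log (N':ℝ) ≤ L := log_le_log hNr' hNNr
  rw [hT] at hpot
  set T := log (t:ℝ) + (L - log N') with hTd
  have hT0 : 0 ≤ T := by linarith
  have hθT : 0 ≤ 1 / U ^ 2 * T := by positivity
  have hlσ' : -(v ^ 14) ≤ log σ' := by linarith
  have hTU : T ≤ v ^ 14 * U ^ 2 := by
    have : 1 / U ^ 2 * T ≤ v ^ 14 := by linarith
    rwa [div_mul_eq_mul_div, one_mul, div_le_iff₀ (by positivity)] at this
  have hTL : 16 * (k:ℝ) ^ 2 * T ≤ L := by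
    have h1 : (16:ℝ) * (k:ℝ) ^ 2 ≤ v ^ 2 := by
      calc (16:ℝ) * (k:ℝ) ^ 2 = (4 * k) ^ 2 := by ring
        _ ≤ _ := by gcongr; linarith
    calc 16 * (k:ℝ) ^ 2 * T ≤ v ^ 2 * (v ^ 14 * U ^ 2) := by gcongr
      _ = v ^ 16 * U ^ 2 := by ring
      _ ≤ (U * U) * U ^ 2 := by
        gcongr
        exact (hUv 16 (by norm_num)).trans (le_mul_of_one_le_left hU0.le (by linarith))
      _ = U ^ 4 := by ring
      _ ≤ L := hU4
  have hk2 : (1:ℝ) ≤ (k:ℝ) ^ 2 := one_le_pow₀ hkr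
  have hT16 : 16 * T ≤ L := by
    have h1 : 1 * T ≤ (k:ℝ) ^ 2 * T := by gcongr
    linarith
  have hlN' : L - L / 16 ≤ log N' := by linarith
  have hdL : 8 * (k:ℝ) ^ 2 * log d ≤ L := by
    have h1 : log (d:ℝ) ≤ (1 : ℝ) / ((2 : ℝ) ^ (k + 2) * (k : ℝ) ^ 2) * L := by
      rw [hL, ← log_rpow hNr]; exact log_le_log (by linarith) hdN
    have h2 : (8:ℝ) ≤ 2 ^ (k + 2) := by
      calc (8:ℝ) = 2 ^ 3 := by norm_num
        _ ≤ _ := pow_le_pow_right₀ (by norm_num) (by omega)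
    rw [div_mul_eq_mul_div, one_mul, le_div_iff₀ (by positivity)] at h1
    refine le_trans ?_ h1
    have : 8 * ((k:ℝ) ^ 2 * log d) ≤ 2 ^ (k + 2) * ((k:ℝ) ^ 2 * log d) := by gcongr
    linarith
  have hdt : (k * (k + 1) : ℝ) * (log d + log t) ≤ 3 * L / 8 := by
    have h1 : (k * (k + 1) : ℝ) ≤ 2 * (k:ℝ) ^ 2 := by
      have : (k:ℝ) * 1 ≤ k * k := by gcongr
      linarith
    have h2 : (k * (k + 1) : ℝ) * (log d + log t) ≤ 2 * (k:ℝ) ^ 2 * (log d + log t) := by gcongr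
    have h3 : (k:ℝ) ^ 2 * log t ≤ (k:ℝ) ^ 2 * T := by gcongr; linarith
    have h4 : 2 * (k:ℝ) ^ 2 * (log d + log t) = (8 * (k:ℝ) ^ 2 * log d) / 4 + 2 * ((k:ℝ) ^ 2 * log t) := by ring
    have h5 : 2 * ((k:ℝ) ^ 2 * T) = (16 * (k:ℝ) ^ 2 * T) / 8 := by ring
    linarith
  have hUL : 8 * (U * U) ≤ L := by
    have h1 : U ^ 4 = (U * U) * (U * U) := by ring
    have h2 : (8:ℝ) ≤ U * U := by
      calc (8:ℝ) ≤ 1000000 * 1000000 := by norm_num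
        _ ≤ U * U := by gcongr
    have h3 : 8 * (U * U) ≤ (U * U) * (U * U) := by gcongr
    linarith
  have hUUL : U ≤ U * U := le_mul_of_one_le_left hU0.le (by linarith)
  have hexpN : exp (log N') = N' := exp_log hNr'
  have g1 : exp (-(v ^ 14)) ≤ σ' := by
    rw [← exp_log hσ'0]; exact exp_le_exp.mpr hlσ'
  obtain ⟨q1, q2, q3, q4⟩ := hpσ σ' g1
  have hZ16 : U * v ^ 16 ≤ U * U / 1000000 := by
    have h1 : v ^ 17 ≤ U := hUv 17 (by norm_num)
    have h2 : v ^ 17 = v ^ 16 * v := by ring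
    have h3 : v ^ 16 * 1000000 ≤ v ^ 16 * v := by gcongr
    have h4 : v ^ 16 ≤ U / 1000000 := by linarith
    calc U * v ^ 16 ≤ U * (U / 1000000) := by gcongr
      _ = _ := by ring
  have hkZ : (k + 1) * (U * v ^ 16) ≤ U * U := by
    have h1 : v ^ 17 ≤ U := hUv 17 (by norm_num)
    calc (k + 1) * (U * v ^ 16) ≤ v * (U * v ^ 16) := by gcongr; linarith
      _ = U * v ^ 17 := by ring
      _ ≤ _ := by gcongr
  refine hcore N' (d * t) Q0 E yy J m σ' Y K A' hN' (Nat.mul_pos hd ht) hσ'0 hσ'1 hA' hσN hfree' ?_ hQ2 q1 q2 ?_ q3 hE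
    ?_ hY hYy hYJ hYK hm hJ hK q4
  · apply hG
    have : ((1000 * Z ^ (k + 1) : ℕ) : ℝ) ≤ N' := by
      push_cast
      calc (1000:ℝ) * (Z:ℝ) ^ (k + 1) ≤ exp 1000 * (exp (U * v ^ 16)) ^ (k + 1) := by
            gcongr
            exact le_exp_self 1000
        _ = exp (1000 + (k + 1) * (U * v ^ 16)) := by
            rw [← exp_nat_mul, ← exp_add]; push_cast; rfl
        _ ≤ exp (log N') := exp_le_exp.mpr (by linarith)
        _ = N' := hexpN
    exact_mod_cast this
  · have hQ : 2 * (Q0:ℝ) ≤ exp (v ^ 15 + 2) := by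
      have h2 : (2:ℝ) ≤ exp 1 := by linarith [add_one_le_exp (1:ℝ)]
      calc 2 * (Q0:ℝ) ≤ exp 1 * exp (v ^ 15 + 1) := by gcongr
        _ = _ := by rw [← exp_add]; congr 1; ring
    have hdte : (((d * t : ℕ) : ℝ)) ^ (k * (k + 1)) = exp ((k * (k + 1) : ℝ) * (log d + log t)) := by
      rw [← log_mul (by positivity) (by positivity)]
      have : exp (log ((d:ℝ) * t)) = d * t := exp_log (by positivity)
      conv_lhs => rw [Nat.cast_mul, ← this, ← exp_nat_mul]
      push_cast; rfl
    rw [hdte]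
    have hvv : v + k * (v ^ 15 + 2) + v ^ 14 ≤ U := by
      have e1 : v + k * (v ^ 15 + 2) + v ^ 14 ≤ v ^ 17 := by
        have a1 : v ≤ v ^ 16 := by simpa using pw v1 (show 1 ≤ 16 by norm_num)
        have a2 : v ^ 15 ≤ v ^ 16 := pw v1 (by norm_num)
        have a3 : v ^ 14 ≤ v ^ 16 := pw v1 (by norm_num)
        have a5 : k * (v ^ 15 + 2) ≤ v / 1000000 * (2 * v ^ 16) := by
          gcongr
          · linarith
          · linarith
        have a6 : v ^ 17 = v * v ^ 16 := by ring
        have a7 : 1000000 * v ^ 16 ≤ v * v ^ 16 := by gcongr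
        have a8 : v / 1000000 * (2 * v ^ 16) = v * v ^ 16 / 500000 := by ring
        linarith
      exact e1.trans (hUv 17 (by norm_num))
    calc c1 * (2 * (Q0:ℝ)) ^ k * exp ((k * (k + 1) : ℝ) * (log d + log t))
        ≤ exp v * (exp (v ^ 15 + 2)) ^ k * exp (3 * L / 8) := by
          gcongr
          exact le_trans (by linarith) (le_exp_self v)
      _ = exp (v + k * (v ^ 15 + 2) + 3 * L / 8) := by rw [← exp_nat_mul, ← exp_add, ← exp_add]
      _ ≤ exp (-(v ^ 14) + log N') := exp_le_exp.mpr (by linarith)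
      _ = exp (-(v ^ 14)) * N' := by rw [exp_add, hexpN]
      _ ≤ σ' * N' := by gcongr
  · have : ((2 * E * Q0 ^ yy * (9 ^ m * (2 * Q0 ^ 2) ^ (4 * J * m)) : ℕ) : ℝ) ≤ N' := by
      refine hZ2.trans ?_
      rw [← hexpN]
      exact exp_le_exp.mpr (by linarith)
    exact_mod_cast this
end

open scoped Classical in
/-- Lemma 5.2: if `A ⊆ [N]` is `h_d`-free of density `σ > (log N)^{-log log log N}`, then
there are `B, Q ≪ σ^{-O(1)}` (with `B ≫ σ^{O(1)}`) and a set `Γ` of reduced fractions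
`a/q`, `q ≤ Q`, with frequencies `γ_{a,q} ∈ 𝔐_{a,q}(N,κ/σ)`, such that
`∑ |1̂_A(γ_{a,q})| ≫ B|A|Q^{1/2}/((log N)^{1/4}(log(1/σ))²)` and each arc carries
`L²` mass `≫ σ|A|/B²` of `1̂_A - σ·1̂_{[N]}`. -/
theorem stmt15
    (k : ℕ) (hk : 0 < k)
    (h : Polynomial ℤ) (hdeg : h.natDegree = k) (hlead : 0 < h.leadingCoeff)
    (hint : ∀ q : ℕ, 0 < q → ∃ n : ℤ, (q : ℤ) ∣ h.eval n)
    (z : ∀ (p : ℕ) [Fact p.Prime], ℤ_[p])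
    (hz : ∀ (p : ℕ) [Fact p.Prime], Polynomial.aeval (z p) h = 0)
    (lam : ℕ → ℕ) (hlam1 : lam 1 = 1)
    (hlamMul : ∀ a b : ℕ, lam (a * b) = lam a * lam b)
    (hlamP : ∀ (p : ℕ) [Fact p.Prime],
      lam p = p ^ Polynomial.rootMultiplicity (z p) (h.map (algebraMap ℤ ℤ_[p])))
    (r : ℕ → ℤ)
    (hr : ∀ d : ℕ, 0 < d → -(d : ℤ) < r d ∧ r d ≤ 0)
    (hrz : ∀ d : ℕ, 0 < d → ∀ (p : ℕ) [Fact p.Prime], ∀ α : ℕ, p ^ α ∣ d →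
      (p : ℤ_[p]) ^ α ∣ (z p - (r d : ℤ_[p])))
    (H : ℕ → Polynomial ℤ)
    (hH : ∀ d : ℕ, 0 < d →
      Polynomial.C (lam d : ℤ) * H d =
        h.comp (Polynomial.C (r d) + Polynomial.C (d : ℤ) * Polynomial.X))
    :
    ∃ κ C c : ℝ, 0 < κ ∧ 1 ≤ C ∧ 0 < c ∧ ∃ N₀ : ℕ, ∀ N : ℕ, N₀ ≤ N → ∀ d : ℕ, 0 < d →
      (d : ℝ) ≤ (N : ℝ) ^ ((1 : ℝ) / ((2 : ℝ) ^ (k + 2) * (k : ℝ) ^ 2)) →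
      ∀ A : Finset ℕ, A ⊆ Finset.Icc 1 N →
        (∀ a ∈ A, ∀ b ∈ A, a ≠ b →
          ∀ n : ℕ, 0 < n → (a : ℤ) - (b : ℤ) ≠ (H d).eval (n : ℤ)) →
        let σ : ℝ := (A.card : ℝ) / N
        let ghat : ℝ → ℂ := fun γ =>
          (∑ n ∈ A, e ((n : ℝ) * γ)) - (σ : ℂ) * ∑ n ∈ Finset.Icc 1 N, e ((n : ℝ) * γ)
        σ > Real.log N ^ (-Real.log (Real.log (Real.log N))) →
        ∃ B : ℝ, c * σ ^ (C : ℝ) ≤ B ∧ B ≤ C * σ ^ (-(C : ℝ)) ∧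
        ∃ Q : ℕ, 1 ≤ Q ∧ (Q : ℝ) ≤ C * σ ^ (-(C : ℝ)) ∧
        ∃ Γ : Finset (ℕ × ℕ),
          (∀ p ∈ Γ, 1 ≤ p.1 ∧ p.1 ≤ p.2 ∧ p.2 ≤ Q ∧ Nat.gcd p.1 p.2 = 1) ∧
        ∃ γf : ℕ × ℕ → ℝ,
          (∀ p ∈ Γ, torusNorm (γf p - (p.1 : ℝ) / p.2) ≤ (κ / σ) / N) ∧
          (∑ p ∈ Γ, ‖∑ n ∈ A, e ((n : ℝ) * γf p)‖ ≥
            c * B * A.card * (Q : ℝ) ^ ((1 : ℝ) / 2) /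
              (Real.log N ^ ((1 : ℝ) / 4) * Real.log (1 / σ) ^ 2)) ∧
          (∀ p ∈ Γ,
            (∫ γ in Set.Icc ((p.1 : ℝ) / p.2 - (κ / σ) / N) ((p.1 : ℝ) / p.2 + (κ / σ) / N),
                ‖ghat γ‖ ^ 2) ≥ c * σ * A.card / B ^ 2) := by
  obtain ⟨b, G, Ch, hHD⟩ := mkHD k hk h hdeg hlead z hz lam hlam1 hlamMul hlamP r hr hrz H hH
  obtain ⟨N₀, hfin⟩ := final hk hHD
  refine ⟨1, 1, 1, one_pos, le_rfl, one_pos, N₀, ?_⟩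
  intro N hN d hd hdN A hA hfree σ ghat hσ
  exfalso
  have hinj : Function.Injective (fun n : ℕ => (n : ℤ)) := fun a b h => by simpa using h
  refine hfin N hN d hd hdN (A.image (fun n : ℕ => (n : ℤ))) ?_ ?_ ?_
  · intro a ha
    obtain ⟨n, hn, rfl⟩ := Finset.mem_image.mp ha
    have := Finset.mem_Icc.mp (hA hn)
    rw [Finset.mem_Icc]
    omega
  · intro a ha b hb hab n hn
    obtain ⟨a', ha', rfl⟩ := Finset.mem_image.mp ha
    obtain ⟨b', hb', rfl⟩ := Finset.mem_image.mp hb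
    exact hfree a' ha' b' hb' (fun h => hab (by rw [h])) n hn
  · rw [Finset.card_image_of_injective _ hinj]
    exact hσ
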